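/- Let c_n denote the number of congruence subgroups of SL_2(ℤ) of index at most n. Then the limsup as n → ∞ of (log c_n) / ((log n)^2 / log log n) is at most (3 − 2√2)/4. -/

import Mathlib

open Filter

/-- `H` is a congruence subgroup of `SL_d(ℤ)`: it contains the kernel of the
reduction homomorphism `SL_d(ℤ) → SL_d(ℤ/mℤ)` for some integer `m ≥ 1`. -/
def IsCongruenceSubgroup {d : ℕ} (H : Subgroup (Matrix.SpecialLinearGroup (Fin d) ℤ)) : Prop :=
  ∃ m : ℕ, 1 ≤ m ∧
    (Matrix.SpecialLinearGroup.map (n := Fin d) (Int.castRingHom (ZMod m))).ker ≤ H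

/-- The number of congruence subgroups of `SL_d(ℤ)` of index at most `n`. -/
noncomputable def congCount (d n : ℕ) : ℕ :=
  Nat.card {H : Subgroup (Matrix.SpecialLinearGroup (Fin d) ℤ) //
    IsCongruenceSubgroup H ∧ H.index ≤ n}

/-- Every subgroup of `G` is generated by at most `c` elements. -/
def RankLE (G : Type*) [Group G] (c : ℕ) : Prop :=
  ∀ H : Subgroup G, ∃ f : Fin c → G, Subgroup.closure (Set.range f) = H

theorem exists_fin_range {G : Type*} [Group G] {c : ℕ} (s : Set G) (hs : s.Finite)
    (hc : s.ncard ≤ c) :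
    ∃ f : Fin c → G, Subgroup.closure (Set.range f) = Subgroup.closure s := by
  classical
  obtain ⟨t, rfl⟩ := hs.exists_finset_coe
  rw [Set.ncard_coe_finset] at hc
  let e := t.equivFin
  refine ⟨fun i => if h : (i : ℕ) < t.card then (e.symm ⟨i, h⟩ : G) else 1, ?_⟩
  apply le_antisymm
  · rw [Subgroup.closure_le]
    rintro _ ⟨i, rfl⟩
    dsimp only
    split_ifs with h
    · exact Subgroup.subset_closure (e.symm ⟨i, h⟩).2
    · exact one_mem _
  · rw [Subgroup.closure_le]
    intro x hx
    apply Subgroup.subset_closure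
    refine ⟨⟨e ⟨x, hx⟩, lt_of_lt_of_le (e ⟨x, hx⟩).2 hc⟩, ?_⟩
    simp

theorem rankLE_of_set {G : Type*} [Group G] {c : ℕ}
    (h : ∀ H : Subgroup G, ∃ s : Set G, s.Finite ∧ s.ncard ≤ c ∧ Subgroup.closure s = H) :
    RankLE G c := by
  intro H
  obtain ⟨s, hs, hc, rfl⟩ := h H
  exact exists_fin_range s hs hc

theorem ncard_range_fin_le {G : Type*} {c : ℕ} (f : Fin c → G) : (Set.range f).ncard ≤ c := by
  rw [← Set.image_univ]
  refine (Set.ncard_image_le Set.finite_univ).trans ?_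
  simp [Set.ncard_univ]

theorem RankLE.mono {G : Type*} [Group G] {c c' : ℕ} (h : RankLE G c) (hc : c ≤ c') :
    RankLE G c' := by
  apply rankLE_of_set
  intro H
  obtain ⟨f, hf⟩ := h H
  exact ⟨Set.range f, Set.finite_range f, (ncard_range_fin_le f).trans hc, hf⟩

theorem RankLE.of_injective {G Q : Type*} [Group G] [Group Q] {c : ℕ} (π : G →* Q)
    (hπ : Function.Injective π) (h : RankLE Q c) : RankLE G c := by
  intro H
  obtain ⟨f, hf⟩ := h (H.map π)
  have : ∀ i, ∃ g ∈ H, π g = f i := by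
    intro i
    have : f i ∈ H.map π := hf ▸ Subgroup.subset_closure ⟨i, rfl⟩
    simpa using this
  choose g hg hgf using this
  refine ⟨g, ?_⟩
  apply Subgroup.map_injective hπ
  rw [← hf, MonoidHom.map_closure, ← Set.range_comp]
  congr 2
  funext i
  exact hgf i

theorem RankLE.of_surjective {G Q : Type*} [Group G] [Group Q] {c : ℕ} (π : G →* Q)
    (hπ : Function.Surjective π) (h : RankLE G c) : RankLE Q c := by
  intro H
  obtain ⟨f, hf⟩ := h (H.comap π)
  refine ⟨π ∘ f, ?_⟩
  rw [Set.range_comp, ← MonoidHom.map_closure, hf, Subgroup.map_comap_eq_self_of_surjective hπ]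

theorem RankLE.subgroup {G : Type*} [Group G] {c : ℕ} (h : RankLE G c) (H : Subgroup G) :
    RankLE H c := h.of_injective H.subtype H.subtype_injective

theorem RankLE.ext {G Q : Type*} [Group G] [Group Q] {a b : ℕ} (π : G →* Q)
    (hk : RankLE π.ker a) (hq : RankLE Q b) : RankLE G (a + b) := by
  apply rankLE_of_set
  intro H
  obtain ⟨f, hf⟩ := hk (H.subgroupOf π.ker)
  obtain ⟨f', hf'⟩ := hq (H.map π)
  have : ∀ i, ∃ g ∈ H, π g = f' i := by
    intro i
    have : f' i ∈ H.map π := hf' ▸ Subgroup.subset_closure ⟨i, rfl⟩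
    simpa using this
  choose g hg hgf using this
  refine ⟨Set.range (fun i => (f i : G)) ∪ Set.range g,
    (Set.finite_range _).union (Set.finite_range _), ?_, ?_⟩
  · exact (Set.ncard_union_le _ _).trans
      (add_le_add (ncard_range_fin_le _) (ncard_range_fin_le _))
  · apply le_antisymm
    · rw [Subgroup.closure_le]
      rintro _ (⟨i, rfl⟩ | ⟨i, rfl⟩)
      · have : f i ∈ H.subgroupOf π.ker := hf ▸ Subgroup.subset_closure ⟨i, rfl⟩
        exact this
      · exact hg i
    · intro x hx
      have h1 : π x ∈ (Subgroup.closure (Set.range g)).map π := by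
        rw [MonoidHom.map_closure, ← Set.range_comp]
        have : π ∘ g = f' := funext hgf
        rw [this, hf']
        exact ⟨x, hx, rfl⟩
      obtain ⟨y, hy, hyx⟩ := h1
      have hyH : y ∈ H := by
        have : Subgroup.closure (Set.range g) ≤ H := by
          rw [Subgroup.closure_le]; rintro _ ⟨i, rfl⟩; exact hg i
        exact this hy
      have h2 : y⁻¹ * x ∈ π.ker := by simp [MonoidHom.mem_ker, hyx]
      have h3 : (⟨y⁻¹ * x, h2⟩ : π.ker) ∈ Subgroup.closure (Set.range f) := by
        rw [hf]
        exact H.mul_mem (H.inv_mem hyH) hx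
      have h4 : y⁻¹ * x ∈ Subgroup.closure (Set.range (fun i => (f i : G))) := by
        have := Subgroup.mem_map_of_mem π.ker.subtype h3
        rw [MonoidHom.map_closure, ← Set.range_comp] at this
        exact this
      have h5 : x = y * (y⁻¹ * x) := by group
      rw [h5]
      exact mul_mem (Subgroup.closure_mono Set.subset_union_right hy)
        (Subgroup.closure_mono Set.subset_union_left h4)

theorem rankLE_of_card {G : Type*} [Group G] [Finite G] {c : ℕ} (h : Nat.card G ≤ c) :
    RankLE G c := by
  apply rankLE_of_set
  intro H
  refine ⟨H, Set.toFinite _, ?_, Subgroup.closure_eq H⟩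
  refine le_trans ?_ h
  rw [← Set.ncard_univ]
  exact Set.ncard_le_ncard (Set.subset_univ _) Set.finite_univ

theorem rankLE_of_isCyclic {G : Type*} [Group G] [IsCyclic G] : RankLE G 1 := by
  intro H
  obtain ⟨g, hg⟩ := (Subgroup.isCyclic_iff_exists_zpowers_eq_top H).1 inferInstance
  refine ⟨fun _ => g, ?_⟩
  rw [← hg, Set.range_const, Subgroup.zpowers_eq_closure]

theorem rankLE_pi_aux {ι : Type*} [DecidableEq ι] (G : ι → Type*) [∀ i, Group (G i)]
    {c : ℕ} (h : ∀ i, RankLE (G i) c) (s : Finset ι) :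
    RankLE (Subgroup.pi (Set.univ) (fun i => if i ∈ s then (⊤ : Subgroup (G i)) else ⊥))
      (c * s.card) := by
  induction s using Finset.induction_on with
  | empty =>
    have : Subsingleton (Subgroup.pi (Set.univ) (fun i => if i ∈ (∅ : Finset ι) then
        (⊤ : Subgroup (G i)) else ⊥)) := by
      constructor
      rintro ⟨a, ha⟩ ⟨b, hb⟩
      ext i
      have h1 := ha i (Set.mem_univ _)
      have h2 := hb i (Set.mem_univ _)
      simp at h1 h2
      simp [h1, h2]
    exact rankLE_of_set fun H => ⟨∅, Set.finite_empty,
      (Set.ncard_empty _).le.trans (Nat.zero_le _), Subsingleton.elim _ _⟩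
  | insert a s ha ih =>
    rw [Finset.card_insert_of_notMem ha, mul_add, mul_one]
    let π := (Pi.evalMonoidHom G a).comp (Subgroup.pi (Set.univ)
      (fun i => if i ∈ insert a s then (⊤ : Subgroup (G i)) else ⊥)).subtype
    refine RankLE.ext π ?_ (h a)
    have key : ∀ x : π.ker, (x : ∀ i, G i) ∈ Subgroup.pi (Set.univ)
        (fun i => if i ∈ s then (⊤ : Subgroup (G i)) else ⊥) := by
      rintro ⟨⟨x, hx⟩, hx'⟩ i -
      have h1 := hx i (Set.mem_univ _)
      have h2 : x a = 1 := hx'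
      by_cases hi : i ∈ s
      · simp [hi]
      · by_cases hia : i = a
        · subst hia; simp [hi, h2]
        · simpa [hi, hia] using h1
    refine ih.of_injective (((Subgroup.subtype _).comp π.ker.subtype).codRestrict _ key) ?_
    intro x y hxy
    have : x.1.1 = y.1.1 := congrArg (fun z => z.1) hxy
    exact Subtype.ext (Subtype.ext this)

theorem RankLE.pi {ι : Type*} [Fintype ι] (G : ι → Type*) [∀ i, Group (G i)]
    {c : ℕ} (h : ∀ i, RankLE (G i) c) : RankLE (∀ i, G i) (c * Fintype.card ι) := by
  classical
  have h1 := rankLE_pi_aux G h Finset.univ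
  have key : ∀ x : ∀ i, G i, x ∈ Subgroup.pi (Set.univ)
      (fun i => if i ∈ (Finset.univ : Finset ι) then (⊤ : Subgroup (G i)) else ⊥) := by
    intro x i _; simp
  refine RankLE.of_injective ((MonoidHom.id _).codRestrict _ key) ?_ h1
  intro x y hxy
  exact congrArg Subtype.val hxy

/-! ### Counting -/

theorem card_le_of_surj_on {α β : Type*} [Finite β] (s : Set α) (g : β → α)
    (h : ∀ x ∈ s, ∃ b, g b = x) : s.ncard ≤ Nat.card β := by
  have h1 : s ⊆ g '' Set.univ := by
    intro x hx
    obtain ⟨b, hb⟩ := h x hx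
    exact ⟨b, trivial, hb⟩
  refine (Set.ncard_le_ncard h1 (Set.toFinite _)).trans ?_
  refine (Set.ncard_image_le (Set.toFinite _)).trans ?_
  rw [Set.ncard_univ]

theorem ncard_le_mul {α β : Type*} (s : Set α) (f : α → β) (t : Set β) (ht : t.Finite)
    (hs : s.Finite)
    (hf : ∀ x ∈ s, f x ∈ t) (k : ℕ) (hk : ∀ b ∈ t, {x ∈ s | f x = b}.ncard ≤ k) :
    s.ncard ≤ t.ncard * k := by
  classical
  obtain ⟨s, rfl⟩ := hs.exists_finset_coe
  obtain ⟨t, rfl⟩ := ht.exists_finset_coe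
  rw [Set.ncard_coe_finset, Set.ncard_coe_finset, mul_comm]
  apply Finset.card_le_mul_card_image_of_maps_to (f := f) (fun x hx => hf x hx)
  intro b hb
  have := hk b hb
  rw [← Set.ncard_coe_finset]
  convert this using 2
  ext x; simp

theorem card_subgroups_le {G : Type*} [Group G] [Finite G] {c : ℕ} (h : RankLE G c) :
    Nat.card (Subgroup G) ≤ Nat.card G ^ c := by
  rw [← Set.ncard_univ]
  refine (card_le_of_surj_on Set.univ (fun f : Fin c → G => Subgroup.closure (Set.range f))
    (fun H _ => h H)).trans ?_
  simp [Nat.card_fun]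

/-- Subgroups with prescribed intersection with a kernel. -/
theorem lemmaI {G Q : Type*} [Group G] [Finite G] [Group Q] {r : ℕ} (π : G →* Q)
    (hq : RankLE Q r) (N : Subgroup G) :
    {H : Subgroup G | H ⊓ π.ker = N}.ncard ≤ Nat.card G ^ r := by
  refine (card_le_of_surj_on _ (fun f : Fin r → G => N ⊔ Subgroup.closure (Set.range f))
    ?_).trans (by simp [Nat.card_fun])
  rintro H rfl
  obtain ⟨f', hf'⟩ := hq (H.map π)
  have : ∀ i, ∃ g ∈ H, π g = f' i := by
    intro i
    have : f' i ∈ H.map π := hf' ▸ Subgroup.subset_closure ⟨i, rfl⟩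
    simpa using this
  choose g hg hgf using this
  have hgH : Subgroup.closure (Set.range g) ≤ H := by
    rw [Subgroup.closure_le]; rintro _ ⟨i, rfl⟩; exact hg i
  refine ⟨g, le_antisymm (sup_le inf_le_left hgH) ?_⟩
  intro x hx
  have h1 : π x ∈ (Subgroup.closure (Set.range g)).map π := by
    rw [MonoidHom.map_closure, ← Set.range_comp]
    have : π ∘ g = f' := funext hgf
    rw [this, hf']
    exact ⟨x, hx, rfl⟩
  obtain ⟨y, hy, hyx⟩ := h1
  have h2 : y⁻¹ * x ∈ π.ker := by simp [MonoidHom.mem_ker, hyx]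
  have h5 : x = y * (y⁻¹ * x) := by group
  rw [h5]
  exact mul_mem (Subgroup.mem_sup_right hy)
    (Subgroup.mem_sup_left ⟨H.mul_mem (H.inv_mem (hgH hy)) hx, h2⟩)

/-- Supplements of a normal subgroup `U` in `Λ = ⟨E, g⟩` containing `E`. -/
theorem lemmaS {G : Type*} [Group G] [Finite G] {r k : ℕ} (U : Subgroup G) [U.Normal]
    (hU : RankLE U r) (E Λ : Subgroup G) (g : Fin k → G)
    (hΛ : Λ ≤ E ⊔ Subgroup.closure (Set.range g)) (hg : ∀ i, g i ∈ Λ) :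
    {X : Subgroup G | E ≤ X ∧ X ⊔ U = Λ}.ncard ≤ Nat.card U ^ (r + k) := by
  refine (card_le_of_surj_on _ (fun p : (Fin r → U) × (Fin k → U) =>
    E ⊔ (Subgroup.closure (Set.range p.1)).map U.subtype ⊔
      Subgroup.closure (Set.range fun i => g i * (p.2 i : G))) ?_).trans
      (by simp [Nat.card_prod, Nat.card_fun, pow_add])
  rintro X ⟨hEX, hXU⟩
  obtain ⟨f, hf⟩ := hU (X.subgroupOf U)
  have : ∀ i, ∃ u : U, g i * (u : G) ∈ X := by
    intro i
    have h1 := hg i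
    rw [← hXU, Subgroup.mem_sup_of_normal_right] at h1
    obtain ⟨y, hy, z, hz, hyz⟩ := h1
    exact ⟨⟨z⁻¹, U.inv_mem hz⟩, by simpa [← hyz] using hy⟩
  choose u hu using this
  refine ⟨(f, u), ?_⟩
  dsimp only
  rw [hf]
  set Z := E ⊔ (X.subgroupOf U).map U.subtype ⊔
      Subgroup.closure (Set.range fun i => g i * (u i : G)) with hZ
  have hXUle : (X.subgroupOf U).map U.subtype ≤ X := by
    rintro _ ⟨x, hx, rfl⟩; exact hx
  have hZX : Z ≤ X := by
    refine sup_le (sup_le hEX hXUle) ?_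
    rw [Subgroup.closure_le]; rintro _ ⟨i, rfl⟩; exact hu i
  have hZU : Λ ≤ Z ⊔ U := by
    refine hΛ.trans (sup_le ?_ ?_)
    · exact le_sup_of_le_left (le_sup_of_le_left le_sup_left)
    · rw [Subgroup.closure_le]
      rintro _ ⟨i, rfl⟩
      have h1 : g i * (u i : G) ∈ Z :=
        Subgroup.mem_sup_right (Subgroup.subset_closure ⟨i, rfl⟩)
      have : g i = g i * (u i : G) * ((u i)⁻¹ : U) := by simp
      rw [this]
      exact mul_mem (Subgroup.mem_sup_left h1) (Subgroup.mem_sup_right (SetLike.coe_mem _))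
  refine le_antisymm hZX ?_
  intro x hx
  have h1 : x ∈ Z ⊔ U := hZU (hXU ▸ Subgroup.mem_sup_left hx)
  rw [Subgroup.mem_sup_of_normal_right] at h1
  obtain ⟨y, hy, z, hz, rfl⟩ := h1
  refine mul_mem hy ?_
  have hzX : z ∈ X := by
    have := mul_mem (X.inv_mem (hZX hy)) hx
    simpa using this
  exact Subgroup.mem_sup_left (Subgroup.mem_sup_right ⟨⟨z, hz⟩, hzX, rfl⟩)

theorem exists_gens_mod_ker {G Q : Type*} [Group G] [Group Q] {r : ℕ} (π : G →* Q)
    (hq : RankLE Q r) (H : Subgroup G) :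
    ∃ g : Fin r → G, (∀ i, g i ∈ H) ∧ H ≤ (H ⊓ π.ker) ⊔ Subgroup.closure (Set.range g) := by
  obtain ⟨f', hf'⟩ := hq (H.map π)
  have : ∀ i, ∃ g ∈ H, π g = f' i := by
    intro i
    have : f' i ∈ H.map π := hf' ▸ Subgroup.subset_closure ⟨i, rfl⟩
    simpa using this
  choose g hg hgf using this
  have hgH : Subgroup.closure (Set.range g) ≤ H := by
    rw [Subgroup.closure_le]; rintro _ ⟨i, rfl⟩; exact hg i
  refine ⟨g, hg, ?_⟩
  intro x hx
  have h1 : π x ∈ (Subgroup.closure (Set.range g)).map π := by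
    rw [MonoidHom.map_closure, ← Set.range_comp]
    have : π ∘ g = f' := funext hgf
    rw [this, hf']
    exact ⟨x, hx, rfl⟩
  obtain ⟨y, hy, hyx⟩ := h1
  have h2 : y⁻¹ * x ∈ π.ker := by simp [MonoidHom.mem_ker, hyx]
  have h5 : x = y * (y⁻¹ * x) := by group
  rw [h5]
  exact mul_mem (Subgroup.mem_sup_right hy)
    (Subgroup.mem_sup_left ⟨H.mul_mem (H.inv_mem (hgH hy)) hx, h2⟩)

theorem RankLE.prod {G Q : Type*} [Group G] [Group Q] {a b : ℕ}
    (hG : RankLE G a) (hQ : RankLE Q b) : RankLE (G × Q) (b + a) := by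
  refine RankLE.ext (MonoidHom.fst G Q) ?_ hG
  refine hQ.of_injective ((MonoidHom.snd G Q).comp (Subgroup.subtype _)) ?_
  rintro ⟨⟨a, b⟩, h⟩ ⟨⟨a', b'⟩, h'⟩ hh
  simp only [MonoidHom.mem_ker, MonoidHom.coe_fst] at h h'
  simp at hh
  simp [h, h', hh]

theorem mem_of_pow_mem_coprime {G : Type*} [Group G] (H : Subgroup G) {x : G} {n m : ℕ}
    (hx : x ^ m = 1) (hn : n.Coprime m) (h : x ^ n ∈ H) : x ∈ H := by
  have hc : n.Coprime (orderOf x) := hn.coprime_dvd_right (orderOf_dvd_of_pow_eq_one hx)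
  obtain ⟨k, hk⟩ := exists_pow_eq_self_of_coprime hc
  rw [← hk]
  exact pow_mem h k

theorem pi_update_mem {ι : Type*} [DecidableEq ι] {G : ι → Type*} [∀ i, Group (G i)]
    (u : ∀ i, G i) (i : ι) : u = Function.update u i 1 * Pi.mulSingle i (u i) := by
  ext j
  by_cases h : j = i
  · subst h; simp
  · simp [h]

/-- elements of `∏ U_j` that are trivial at `i` -/
def Uhat {ι : Type*} {G : ι → Type*} [∀ i, Group (G i)]
    (U : ∀ i, Subgroup (G i)) (i : ι) : Subgroup (∀ i, G i) :=
  Subgroup.pi Set.univ U ⊓ (Pi.evalMonoidHom G i).ker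

theorem mem_Uhat {ι : Type*} {G : ι → Type*} [∀ i, Group (G i)]
    {U : ∀ i, Subgroup (G i)} {i : ι} {x : ∀ i, G i} :
    x ∈ Uhat U i ↔ (∀ j, x j ∈ U j) ∧ x i = 1 := by
  simp [Uhat, Subgroup.mem_inf, Subgroup.mem_pi, MonoidHom.mem_ker]

theorem pi_eq_of_Uhat {ι : Type*} [Fintype ι] [DecidableEq ι] {G : ι → Type*}
    [∀ i, Group (G i)] [∀ i, Finite (G i)] (U : ∀ i, Subgroup (G i)) [hN : ∀ i, (U i).Normal]
    (hcop : ∀ i j, i ≠ j → (Nat.card (U i)).Coprime (Nat.card (U j)))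
    (H : Subgroup (∀ i, G i)) (x : ∀ i, G i) (hx : x ∈ H ⊔ Subgroup.pi Set.univ U)
    (hx' : ∀ i, x ∈ H ⊔ Uhat U i) : x ∈ H := by
  have hn : ∀ i, (Uhat U i).Normal := fun i => by
    have : (Subgroup.pi Set.univ U).Normal := by
      refine ⟨fun n hn g i hi => ?_⟩
      exact (hN i).conj_mem _ (hn i hi) (g i)
    unfold Uhat; infer_instance
  have hpn : (Subgroup.pi Set.univ U).Normal := by
    refine ⟨fun n hn g i hi => ?_⟩
    exact (hN i).conj_mem _ (hn i hi) (g i)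
  rw [Subgroup.mem_sup_of_normal_right] at hx
  obtain ⟨h, hh, u, hu, rfl⟩ := hx
  refine mul_mem hh ?_
  apply Subgroup.pi_mem_of_mulSingle_mem
  intro i
  have h1 := hx' i
  rw [Subgroup.mem_sup_of_normal_right] at h1
  obtain ⟨k, hk, w, hw, hkw⟩ := h1
  -- u * w⁻¹ = h⁻¹ * k ∈ H
  have h2 : u * w⁻¹ ∈ H := by
    have : u * w⁻¹ = h⁻¹ * k := by
      rw [mul_inv_eq_iff_eq_mul, mul_assoc, hkw]; group
    rw [this]; exact mul_mem (inv_mem hh) hk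
  rw [mem_Uhat] at hw
  have hu' : ∀ j, u j ∈ U j := fun j => hu j (Set.mem_univ _)
  set v := u * w⁻¹ with hv
  have hvU : ∀ j, v j ∈ U j := fun j => mul_mem (hu' j) (inv_mem (hw.1 j))
  have hvi : v i = u i := by simp [hv, hw.2]
  let N := ∏ j ∈ Finset.univ.erase i, Nat.card (U j)
  have hcard : ∀ j, v j ^ Nat.card (U j) = 1 := fun j => by
    have := pow_card_eq_one' (x := (⟨v j, hvU j⟩ : U j))
    exact congrArg Subtype.val this
  have hvN : v ^ N = Pi.mulSingle i (u i) ^ N := by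
    ext j
    by_cases hj : j = i
    · subst hj; simp [hvi]
    · have : Nat.card (U j) ∣ N := Finset.dvd_prod_of_mem _ (by simp [hj])
      obtain ⟨q, hq⟩ := this
      simp [hj, hq, pow_mul, hcard]
  refine mem_of_pow_mem_coprime H (n := N) (m := Nat.card (U i)) ?_ ?_ ?_
  · rw [← Pi.mulSingle_pow, ← hvi, hcard]; simp
  · refine Nat.Coprime.prod_left fun j hj => ?_
    exact hcop j i (by simpa using hj)
  · rw [← hvN]; exact pow_mem h2 _

theorem stepU {ι : Type*} [Fintype ι] [DecidableEq ι] (G : ι → Type*) [∀ i, Group (G i)]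
    [∀ i, Finite (G i)] (U : ∀ i, Subgroup (G i)) [hN : ∀ i, (U i).Normal] (p : ι → ℕ)
    (hp : ∀ i, (p i).Prime) (hinj : Function.Injective p) (hU : ∀ i, IsPGroup (p i) (U i))
    (c d : ℕ) (hr : ∀ i, RankLE (G i) c)
    (hd : ∀ i, (Finset.univ.filter fun j => j ≠ i ∧ p i ∣ (U j).index).card ≤ d)
    (Λ : Subgroup (∀ i, G i)) :
    {H : Subgroup (∀ i, G i) | H ⊔ Subgroup.pi Set.univ U = Λ}.ncard ≤
      ∏ i, Nat.card (U i) ^ (c + (c * d + c)) := by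
  have hcop : ∀ i j, i ≠ j → (Nat.card (U i)).Coprime (Nat.card (U j)) := by
    intro i j hij
    have := fun i => Fact.mk (hp i)
    obtain ⟨a, ha⟩ := IsPGroup.iff_card.1 (hU i)
    obtain ⟨b, hb⟩ := IsPGroup.iff_card.1 (hU j)
    rw [ha, hb]
    exact Nat.Coprime.pow _ _ ((Nat.coprime_primes (hp i) (hp j)).2 fun h => hij (hinj h))
  have hpn : (Subgroup.pi Set.univ U).Normal := by
    refine ⟨fun n hn g i hi => ?_⟩
    exact (hN i).conj_mem _ (hn i hi) (g i)
  have hUn : ∀ i, (Uhat U i).Normal := fun i => by unfold Uhat; infer_instance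
  let Us : ∀ i, Subgroup (∀ i, G i) := fun i => (U i).map (MonoidHom.mulSingle G i)
  have hUsn : ∀ i, (Us i).Normal := by
    intro i
    refine ⟨?_⟩
    rintro _ ⟨u, hu, rfl⟩ g
    refine ⟨g i * u * (g i)⁻¹, (hN i).conj_mem _ hu (g i), ?_⟩
    ext j
    by_cases hj : j = i
    · subst hj; simp
    · simp [hj]
  have hsup : ∀ i, Uhat U i ⊔ Us i = Subgroup.pi Set.univ U := by
    intro i
    apply le_antisymm
    · refine sup_le inf_le_left ?_
      rintro _ ⟨u, hu, rfl⟩ j -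
      by_cases hj : j = i
      · subst hj; simpa using hu
      · simp [hj]
    · intro u hu
      rw [pi_update_mem u i]
      refine mul_mem (Subgroup.mem_sup_left ?_) (Subgroup.mem_sup_right ?_)
      · rw [mem_Uhat]
        refine ⟨fun j => ?_, by simp⟩
        by_cases hj : j = i
        · subst hj; simp
        · simpa [hj] using hu j (Set.mem_univ _)
      · exact ⟨u i, hu i (Set.mem_univ _), rfl⟩
  let J : ι → Finset ι := fun i => Finset.univ.filter fun j => j ≠ i ∧ p i ∣ (U j).index
  let φ : ∀ i, (∀ j, G j) →* G i × (∀ j : J i, G j ⧸ U j) := fun i =>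
    MonoidHom.prod (Pi.evalMonoidHom G i)
      (MonoidHom.pi fun j : J i => (QuotientGroup.mk' (U j)).comp (Pi.evalMonoidHom G j))
  have hφ : ∀ i x, x ∈ (φ i).ker ↔ x i = 1 ∧ ∀ j ∈ J i, x j ∈ U j := by
    intro i x
    rw [MonoidHom.mem_ker]
    simp only [φ, MonoidHom.prod_apply, Prod.mk_eq_one, funext_iff]
    refine and_congr (by simp) ⟨fun h j hj => ?_, fun h j => ?_⟩
    · have := h ⟨j, hj⟩
      simpa [MonoidHom.pi] using this
    · have := h j j.2
      simpa [MonoidHom.pi] using this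
  have hφr : ∀ i, RankLE (G i × (∀ j : J i, G j ⧸ U j)) (c * d + c) := by
    intro i
    refine (RankLE.prod (hr i) (RankLE.pi (fun j : J i => G j ⧸ U j) (c := c) ?_)).mono ?_
    · intro j
      exact (hr j).of_surjective (QuotientGroup.mk' (U j)) (QuotientGroup.mk'_surjective _)
    · have := hd i
      rw [Fintype.card_coe]
      gcongr
  let S : ι → Set (Subgroup (∀ i, G i)) := fun i =>
    {X | Λ ⊓ (φ i).ker ≤ X ∧ X ⊔ Us i = Λ}
  have hS : ∀ i, (S i).ncard ≤ Nat.card (U i) ^ (c + (c * d + c)) := by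
    intro i
    obtain ⟨g, hg, hgΛ⟩ := exists_gens_mod_ker (φ i) (hφr i) Λ
    have hcard : Nat.card (Us i) = Nat.card (U i) :=
      Nat.card_congr ((U i).equivMapOfInjective _ (Pi.mulSingle_injective i)).symm.toEquiv
    rw [← hcard]
    refine lemmaS (Us i) ?_ _ Λ g hgΛ hg
    exact ((hr i).subgroup (U i)).of_injective
      ((U i).equivMapOfInjective _ (Pi.mulSingle_injective i)).symm.toMonoidHom
      (MulEquiv.injective _)
  have key : ∀ H : Subgroup (∀ i, G i), H ⊔ Subgroup.pi Set.univ U = Λ → ∀ i,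
      H ⊔ Uhat U i ∈ S i := by
    intro H hH i
    refine ⟨?_, by rw [sup_assoc, hsup, hH]⟩
    intro g hgg
    obtain ⟨hgΛ, hg⟩ := Subgroup.mem_inf.1 hgg
    rw [hφ] at hg
    rw [← hH, Subgroup.mem_sup_of_normal_right] at hgΛ
    obtain ⟨h, hh, u, hu, rfl⟩ := hgΛ
    set X := H ⊔ Uhat U i with hX
    have hu' : ∀ j, u j ∈ U j := fun j => hu j (Set.mem_univ _)
    set u1 : ∀ j, G j := Pi.mulSingle i (u i) with hu1
    have h1 : h * Function.update u i 1 ∈ X := by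
      refine mul_mem (Subgroup.mem_sup_left hh) (Subgroup.mem_sup_right ?_)
      rw [mem_Uhat]
      refine ⟨fun j => ?_, by simp⟩
      by_cases hj : j = i
      · subst hj; simp
      · simpa [hj] using hu' j
    set z := h * Function.update u i 1 with hz
    have hzu : h * u = z * u1 := by
      rw [hz, mul_assoc, ← pi_update_mem u i]
    rw [hzu] at hg ⊢
    refine mul_mem h1 ?_
    obtain ⟨hg1, hg2⟩ := hg
    set g := z * u1 with hgdef
    have hcomm : Commute g u1 := by
      rw [commute_iff_eq]
      ext j
      by_cases hj : j = i
      · subst hj; simp [hg1]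
      · simp [hj, hu1]
    let N := ∏ j ∈ (Finset.univ.erase i) \ J i, (U j).index
    have hNc : N.Coprime (p i) := by
      refine Nat.Coprime.prod_left fun j hj => ?_
      rw [Nat.coprime_comm, Nat.Prime.coprime_iff_not_dvd (hp i)]
      intro hdvd
      simp [J] at hj
      exact hj.2 hj.1 hdvd
    have hgN : g ^ N ∈ Uhat U i := by
      rw [mem_Uhat]
      refine ⟨fun j => ?_, by simp [hg1]⟩
      by_cases hj : j = i
      · subst hj; simp [hg1]
      by_cases hjJ : j ∈ J i
      · exact pow_mem (hg2 j hjJ) _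
      · have : (U j).index ∣ N := Finset.dvd_prod_of_mem _ (by simp [hj, hjJ])
        obtain ⟨q, hq⟩ := this
        rw [Pi.pow_apply, hq, pow_mul]
        exact pow_mem (Subgroup.pow_index_mem _ _) _
    have hzN : z ^ N = g ^ N * (u1 ^ N)⁻¹ := by
      have : z = g * u1⁻¹ := by rw [hgdef]; group
      rw [this, (hcomm.inv_right).mul_pow, inv_pow]
    have hu1N : u1 ^ N ∈ X := by
      have h2 : z ^ N ∈ X := pow_mem h1 _
      have h3 : u1 ^ N = (z ^ N)⁻¹ * g ^ N := by rw [hzN]; group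
      rw [h3]
      exact mul_mem (inv_mem h2) (Subgroup.mem_sup_right hgN)
    obtain ⟨k, hk⟩ := hU i ⟨u i, hu' i⟩
    have hk' : u i ^ p i ^ k = 1 := congrArg Subtype.val hk
    refine mem_of_pow_mem_coprime X (n := N) (m := p i ^ k) ?_ (hNc.pow_right k) hu1N
    rw [hu1, ← Pi.mulSingle_pow, hk']; simp
  have hfin : ∀ i, Finite (S i) := fun i => Set.toFinite _
  let F : {H : Subgroup (∀ i, G i) | H ⊔ Subgroup.pi Set.univ U = Λ} → ∀ i, S i :=
    fun H i => ⟨H.1 ⊔ Uhat U i, key H.1 H.2 i⟩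
  have hF : Function.Injective F := by
    have aux : ∀ H H' : {H : Subgroup (∀ i, G i) | H ⊔ Subgroup.pi Set.univ U = Λ},
        F H = F H' → H.1 ≤ H'.1 := by
      intro H H' hFF x hx
      refine pi_eq_of_Uhat U hcop H'.1 x ?_ ?_
      · have h1 := H.2
        have h2 := H'.2
        simp only [Set.mem_ofPred_eq] at h1 h2
        rw [h2, ← h1]; exact Subgroup.mem_sup_left hx
      · intro i
        have : H.1 ⊔ Uhat U i = H'.1 ⊔ Uhat U i := congrArg (fun f => (f i).1) hFF
        rw [← this]; exact Subgroup.mem_sup_left hx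
    intro H H' hFF
    exact Subtype.ext (le_antisymm (aux _ _ hFF) (aux _ _ hFF.symm))
  have h1 := Nat.card_le_card_of_injective F hF
  rw [Nat.card_pi] at h1
  exact h1.trans (Finset.prod_le_prod' fun i _ => hS i)

/-- Number of `s`-dimensional subspaces of a `d`-dimensional space over `ZMod q`. -/
theorem card_subspaces_le {q : ℕ} [hq : Fact q.Prime] (V : Type*) [AddCommGroup V]
    [Module (ZMod q) V] [Finite V] (s : ℕ) :
    {W : Submodule (ZMod q) V | Module.finrank (ZMod q) W = s}.ncard * q ^ (s * s) ≤
      2 ^ s * Nat.card V ^ s := by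
  classical
  set S := {W : Submodule (ZMod q) V | Module.finrank (ZMod q) W = s} with hS
  have : Fintype S := Fintype.ofFinite S
  have hcard : ∀ W : S, q ^ (s * s) ≤
      2 ^ s * Nat.card {f : Fin s → W.1 // LinearIndependent (ZMod q) f} := by
    rintro ⟨W, hW⟩
    have hW' : Module.finrank (ZMod q) W = s := hW
    rw [card_linearIndependent (K := ZMod q) (V := W) hW'.ge, hW', ZMod.card]
    have h2 : (2 : ℕ) ^ s = ∏ _i : Fin s, 2 := by simp
    rw [h2, ← Finset.prod_mul_distrib, pow_mul]
    have h3 : (q ^ s) ^ s = ∏ _i : Fin s, q ^ s := by simp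
    rw [h3]
    refine Finset.prod_le_prod' fun i _ => ?_
    have h4 : 2 * q ^ (i : ℕ) ≤ q ^ s := by
      calc 2 * q ^ (i : ℕ) ≤ q * q ^ (i : ℕ) := Nat.mul_le_mul_right _ hq.out.two_le
        _ = q ^ ((i : ℕ) + 1) := by ring
        _ ≤ q ^ s := Nat.pow_le_pow_right hq.out.pos i.2
    omega
  let F : (Σ W : S, {f : Fin s → W.1 // LinearIndependent (ZMod q) f}) → (Fin s → V) :=
    fun p i => (p.2.1 i : V)
  have hspan : ∀ p : (Σ W : S, {f : Fin s → W.1 // LinearIndependent (ZMod q) f}),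
      Submodule.span (ZMod q) (Set.range (F p)) = p.1.1 := by
    rintro ⟨⟨W, hW⟩, f, hf⟩
    have hW' : Module.finrank (ZMod q) W = s := hW
    have h1 := hf.span_eq_top_of_card_eq_finrank' (by simp [hW'])
    have h2 : Set.range (F ⟨⟨W, hW⟩, f, hf⟩) = W.subtype '' Set.range f := by
      rw [← Set.range_comp]; rfl
    rw [h2, Submodule.span_image, h1]
    simp
  have hF : Function.Injective F := by
    intro a b hab
    have h1 : a.1 = b.1 := by
      apply Subtype.ext
      rw [← hspan a, ← hspan b, hab]
    obtain ⟨W, f⟩ := a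
    obtain ⟨W', f'⟩ := b
    dsimp at h1
    subst h1
    congr 1
    apply Subtype.ext
    funext i
    apply Subtype.ext
    exact congrFun hab i
  have h1 := Nat.card_le_card_of_injective F hF
  rw [Nat.card_sigma, Nat.card_fun, Nat.card_fin] at h1
  have h2 : S.ncard * q ^ (s * s) ≤ ∑ W : S, 2 ^ s *
      Nat.card {f : Fin s → W.1 // LinearIndependent (ZMod q) f} := by
    calc S.ncard * q ^ (s * s) = ∑ _W : S, q ^ (s * s) := by
          rw [Finset.sum_const, smul_eq_mul, Finset.card_univ, ← Nat.card_eq_fintype_card]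
          rfl
      _ ≤ _ := Finset.sum_le_sum fun W _ => hcard W
  rw [← Finset.mul_sum] at h2
  exact h2.trans (Nat.mul_le_mul_left _ h1)

/-- Number of subgroups of order `q ^ s` of an elementary abelian group. -/
theorem card_addSubgroups_le_aux {q : ℕ} [hq : Fact q.Prime] (E : Type*) [AddCommGroup E] [Finite E]
    [Module (ZMod q) E] (s : ℕ) :
    {W : AddSubgroup E | Nat.card W = q ^ s}.ncard * q ^ (s * s) ≤ 2 ^ s * Nat.card E ^ s := by
  refine le_trans (Nat.mul_le_mul_right _ ?_) (card_subspaces_le (q := q) E s)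
  refine Set.ncard_le_ncard_of_injOn (AddSubgroup.toZModSubmodule q) ?_
    ((AddSubgroup.toZModSubmodule q).injective.injOn) ?_
  swap
  · have : Finite (Submodule (ZMod q) E) := inferInstance
    exact Set.toFinite _
  intro W hW
  have h1 : Nat.card (AddSubgroup.toZModSubmodule q W) = q ^ s := hW
  rw [Module.natCard_eq_pow_finrank (K := ZMod q), Nat.card_zmod] at h1
  exact Nat.pow_right_injective hq.out.two_le h1

theorem card_addSubgroups_le {q : ℕ} [hq : Fact q.Prime] (E : Type*) [AddCommGroup E] [Finite E]
    (hE : ∀ x : E, q • x = 0) (s : ℕ) :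
    {W : AddSubgroup E | Nat.card W = q ^ s}.ncard * q ^ (s * s) ≤ 2 ^ s * Nat.card E ^ s :=
  @card_addSubgroups_le_aux q _ E _ _ (AddCommGroup.zmodModule hE) s

/-- the subgroup `q A` -/
abbrev mulSub (A : Type*) [AddCommGroup A] (q : ℕ) : AddSubgroup A :=
  (nsmulAddMonoidHom q : A →+ A).range

theorem mem_mulSub {A : Type*} [AddCommGroup A] {q : ℕ} {x : A} :
    x ∈ mulSub A q ↔ ∃ y, q • y = x := by
  simp [mulSub, AddMonoidHom.mem_range]

theorem relIndex_of_inf {A : Type*} [AddCommGroup A] (P N : AddSubgroup A) :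
    (P ⊓ N).relIndex P * (P ⊔ N).index = N.index := by
  rw [inf_comm, AddSubgroup.inf_relIndex_right, ← AddSubgroup.relIndex_sup_right P N]
  exact AddSubgroup.relIndex_mul_index le_sup_right

theorem abelian_step {q : ℕ} [hq : Fact q.Prime] (A : Type*) [AddCommGroup A] [Finite A]
    (d r : ℕ) (hd : (mulSub A q).index = q ^ d) (P1 : AddSubgroup A) (hP1 : P1 ≤ mulSub A q)
    (hr : r ≤ d) :
    {P : AddSubgroup A | P ⊓ mulSub A q = P1 ∧ (P ⊔ mulSub A q).index = q ^ r}.ncard ≤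
      2 ^ d * q ^ (r * (d - r)) := by
  classical
  set s := d - r with hs
  let E : AddSubgroup (A ⧸ P1) := (nsmulAddMonoidHom q : (A ⧸ P1) →+ (A ⧸ P1)).ker
  have hE : ∀ x : E, q • x = 0 := fun x => Subtype.ext x.2
  have hcardE : Nat.card E = q ^ d := by
    have h1 := AddSubgroup.card_mul_index E
    have h2 := AddSubgroup.card_mul_index (mulSub (A ⧸ P1) q)
    rw [AddSubgroup.index_ker] at h1
    have h3 : Nat.card E = (mulSub (A ⧸ P1) q).index := by
      have : 0 < Nat.card (mulSub (A ⧸ P1) q) := Nat.card_pos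
      apply Nat.eq_of_mul_eq_mul_right this
      rw [h1, mul_comm, h2]
    have h4 : mulSub (A ⧸ P1) q = (mulSub A q).map (QuotientAddGroup.mk' P1) := by
      ext x
      simp only [mem_mulSub, AddSubgroup.mem_map]
      constructor
      · rintro ⟨y, rfl⟩
        obtain ⟨y, rfl⟩ := QuotientAddGroup.mk'_surjective P1 y
        exact ⟨q • y, ⟨y, rfl⟩, by simp⟩
      · rintro ⟨_, ⟨y, rfl⟩, rfl⟩
        exact ⟨QuotientAddGroup.mk' P1 y, by simp⟩
    rw [h3, h4, AddSubgroup.index_map, QuotientAddGroup.ker_mk', sup_eq_left.2 hP1, hd,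
      QuotientAddGroup.range_mk']
    simp
  let F : AddSubgroup A → AddSubgroup E := fun P =>
    (P.map (QuotientAddGroup.mk' P1)).addSubgroupOf E
  set S := {P : AddSubgroup A | P ⊓ mulSub A q = P1 ∧ (P ⊔ mulSub A q).index = q ^ r} with hSdef
  have hPE : ∀ P ∈ S, P.map (QuotientAddGroup.mk' P1) ≤ E := by
    rintro P ⟨hP, -⟩ _ ⟨x, hx, rfl⟩
    change q • (QuotientAddGroup.mk' P1 x) = 0
    rw [← map_nsmul]
    rw [← AddMonoidHom.mem_ker, QuotientAddGroup.ker_mk', ← hP]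
    exact ⟨P.nsmul_mem hx q, mem_mulSub.2 ⟨x, rfl⟩⟩
  have hinj : Set.InjOn F S := by
    intro P hP P' hP' hPP
    have h1 : (P.map (QuotientAddGroup.mk' P1)).addSubgroupOf E =
        (P'.map (QuotientAddGroup.mk' P1)).addSubgroupOf E := hPP
    rw [AddSubgroup.addSubgroupOf_inj, inf_eq_left.2 (hPE P hP), inf_eq_left.2 (hPE P' hP')] at h1
    have h2 := congrArg (AddSubgroup.comap (QuotientAddGroup.mk' P1)) h1
    rw [AddSubgroup.comap_map_eq, AddSubgroup.comap_map_eq, QuotientAddGroup.ker_mk'] at h2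
    rwa [sup_eq_left.2 (hP.1 ▸ inf_le_left), sup_eq_left.2 (hP'.1 ▸ inf_le_left)] at h2
  have hmaps : ∀ P ∈ S, F P ∈ {W : AddSubgroup E | Nat.card W = q ^ s} := by
    intro P hP
    have h1 : Nat.card (F P) = q ^ s := by
      have h2 : Nat.card (F P) = Nat.card (P.map (QuotientAddGroup.mk' P1)) :=
        Nat.card_congr (AddSubgroup.addSubgroupOfEquivOfLe (hPE P hP)).toEquiv
      rw [h2]
      have h3 := relIndex_of_inf P (mulSub A q)
      rw [hP.1, hP.2, hd] at h3
      have h4 : Nat.card (P.map (QuotientAddGroup.mk' P1)) = P1.relIndex P := by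
        have := AddSubgroup.relIndex_ker P (QuotientAddGroup.mk' P1)
        rw [QuotientAddGroup.ker_mk'] at this
        exact this.symm
      rw [h4]
      have h5 : q ^ d = q ^ s * q ^ r := by rw [← pow_add]; congr 1; omega
      rw [h5] at h3
      exact Nat.eq_of_mul_eq_mul_right (pow_pos hq.out.pos r) h3
    exact h1
  have h1 := Set.ncard_le_ncard_of_injOn F hmaps hinj (Set.toFinite _)
  have h2 := card_addSubgroups_le (q := q) E hE s
  rw [hcardE] at h2
  have h3 : S.ncard * q ^ (s * s) ≤ (2 ^ s * q ^ (r * s)) * q ^ (s * s) := by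
    refine (Nat.mul_le_mul_right _ h1).trans (h2.trans (le_of_eq ?_))
    rw [mul_assoc, ← pow_add, ← pow_mul]
    congr 2
    have : d = r + s := by omega
    rw [this]; ring
  have h4 := Nat.le_of_mul_le_mul_right h3 (pow_pos hq.out.pos _)
  refine h4.trans ?_
  gcongr
  · norm_num
  · omega

theorem index_split {A : Type*} [AddCommGroup A] (P B N : AddSubgroup A) (hN : N ≤ B) :
    (P ⊔ N).index = (P ⊔ B).index * (P.addSubgroupOf B ⊔ N.addSubgroupOf B).index := by
  have h1 : P.addSubgroupOf B ⊔ N.addSubgroupOf B = (P ⊔ N).addSubgroupOf B := by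
    apply AddSubgroup.map_injective B.subtype_injective
    rw [AddSubgroup.map_sup]
    simp only [AddSubgroup.addSubgroupOf_map_subtype]
    rw [inf_eq_left.2 hN, sup_comm, sup_comm P N, sup_inf_assoc_of_le P hN]
  rw [h1]
  change _ = _ * (P ⊔ N).relIndex B
  have h2 : P ⊔ B = (P ⊔ N) ⊔ B := by rw [sup_assoc, sup_eq_right.2 hN]
  rw [h2, ← AddSubgroup.relIndex_sup_right B (P ⊔ N), mul_comm, sup_comm B]
  exact (AddSubgroup.relIndex_mul_index le_sup_left).symm

theorem abelian_step_sum {q : ℕ} [hq : Fact q.Prime] (A : Type*) [AddCommGroup A] [Finite A]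
    [Fintype (AddSubgroup A)] (B : AddSubgroup A) (hB : B = mulSub A q) [Fintype (AddSubgroup B)]
    (d b : ℕ) (hd : B.index = q ^ d) {ι : Type*} (J : Finset ι)
    (N : ι → AddSubgroup A) (hN : ∀ j ∈ J, N j ≤ B) (C : ℝ)
    (hC : ∀ r ≤ d, (q : ℝ) ^ (r * (d - r) + r * J.card) ≤ C * q ^ (b * r)) :
    ∑ P : AddSubgroup A, (∏ j ∈ J, ((P ⊔ N j).index : ℝ)) / (P.index : ℝ) ^ b ≤
      4 ^ d * C * ∑ P : AddSubgroup B,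
        (∏ j ∈ J, ((P ⊔ (N j).addSubgroupOf B).index : ℝ)) / (P.index : ℝ) ^ b := by
  classical
  have hq0 : (0 : ℝ) < q := by exact_mod_cast hq.out.pos
  have hC0 : 0 ≤ C := by
    have := hC 0 (Nat.zero_le _)
    simp at this
    linarith
  rw [← Finset.sum_fiberwise_of_maps_to (s := Finset.univ) (t := Finset.univ)
    (g := fun P : AddSubgroup A => P.addSubgroupOf B) (fun _ _ => Finset.mem_univ _), Finset.mul_sum]
  apply Finset.sum_le_sum
  intro P1 _
  set g1 : ℝ := (∏ j ∈ J, ((P1 ⊔ (N j).addSubgroupOf B).index : ℝ)) / (P1.index : ℝ) ^ b with hg1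
  have hg10 : 0 ≤ g1 := by positivity
  have hval : ∀ P : AddSubgroup A, P.addSubgroupOf B = P1 → ∀ r, (P ⊔ B).index = q ^ r →
      (∏ j ∈ J, ((P ⊔ N j).index : ℝ)) / (P.index : ℝ) ^ b =
        (q : ℝ) ^ (r * J.card) / q ^ (b * r) * g1 := by
    intro P hP r hr
    have h1 : P.index = q ^ r * P1.index := by
      have := index_split P B ⊥ bot_le
      rw [sup_bot_eq, hr, hP] at this
      rw [this]
      simp
    have h2 : ∀ j ∈ J, ((P ⊔ N j).index : ℝ) =
        (q : ℝ) ^ r * ((P1 ⊔ (N j).addSubgroupOf B).index : ℝ) := by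
      intro j hj
      rw [index_split P B (N j) (hN j hj), hr, hP]
      push_cast
      ring
    rw [Finset.prod_congr rfl h2, Finset.prod_mul_distrib, Finset.prod_const, h1, hg1]
    push_cast
    rw [mul_pow, ← pow_mul, ← pow_mul, mul_comm r b, mul_div_mul_comm]
  have hrex : ∀ P : AddSubgroup A, ∃ r ≤ d, (P ⊔ B).index = q ^ r := by
    intro P
    have h1 : (P ⊔ B).index ∣ q ^ d := hd ▸ AddSubgroup.index_dvd_of_le le_sup_right
    exact (Nat.dvd_prime_pow hq.out).1 h1
  choose ρ hρd hρ using hrex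
  rw [← Finset.sum_fiberwise_of_maps_to (t := Finset.range (d + 1)) (g := ρ)
    (by intro P _; simp only [Finset.mem_range]; have := hρd P; omega)]
  have hmain : ∀ r ∈ Finset.range (d + 1),
      ∑ P ∈ (Finset.univ.filter fun P : AddSubgroup A => P.addSubgroupOf B = P1).filter
        (fun P => ρ P = r), (∏ j ∈ J, ((P ⊔ N j).index : ℝ)) / (P.index : ℝ) ^ b
      ≤ 2 ^ d * C * g1 := by
    intro r hr
    have hrd : r ≤ d := by simp at hr; omega
    have h1 : ∀ P ∈ (Finset.univ.filter fun P : AddSubgroup A => P.addSubgroupOf B = P1).filter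
        (fun P => ρ P = r), (∏ j ∈ J, ((P ⊔ N j).index : ℝ)) / (P.index : ℝ) ^ b
          = (q : ℝ) ^ (r * J.card) / q ^ (b * r) * g1 := by
      intro P hP
      simp only [Finset.mem_filter, Finset.mem_univ, true_and] at hP
      exact hval P hP.1 r (hP.2 ▸ hρ P)
    rw [Finset.sum_congr rfl h1, Finset.sum_const, nsmul_eq_mul]
    have h2 : (((Finset.univ.filter fun P : AddSubgroup A => P.addSubgroupOf B = P1).filter
        (fun P => ρ P = r)).card : ℝ) ≤ 2 ^ d * (q : ℝ) ^ (r * (d - r)) := by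
      have h3 := abelian_step (q := q) A d r (hB ▸ hd) (P1.map B.subtype)
        (hB ▸ AddSubgroup.map_subtype_le P1) hrd
      rw [← hB] at h3
      have h4 : ((Finset.univ.filter fun P : AddSubgroup A => P.addSubgroupOf B = P1).filter
        (fun P => ρ P = r)).card ≤ 2 ^ d * q ^ (r * (d - r)) := by
        refine le_trans ?_ h3
        rw [← Set.ncard_coe_finset]
        refine Set.ncard_le_ncard ?_ (Set.toFinite _)
        intro P hP
        simp only [Finset.coe_filter, Finset.mem_filter, Finset.mem_univ, true_and,
          Set.mem_ofPred_eq] at hP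
        refine ⟨?_, hP.2 ▸ hρ P⟩
        rw [← hP.1, AddSubgroup.addSubgroupOf_map_subtype]
      exact_mod_cast h4
    have hqb : (0 : ℝ) < q ^ (b * r) := by positivity
    calc _ ≤ 2 ^ d * (q : ℝ) ^ (r * (d - r)) * ((q : ℝ) ^ (r * J.card) / q ^ (b * r) * g1) := by
          gcongr
      _ = 2 ^ d * ((q : ℝ) ^ (r * (d - r) + r * J.card) / q ^ (b * r)) * g1 := by
          rw [pow_add]; ring
      _ ≤ 2 ^ d * C * g1 := by
          gcongr
          rw [div_le_iff₀ hqb]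
          exact hC r hrd
  refine (Finset.sum_le_sum hmain).trans ?_
  rw [Finset.sum_const, Finset.card_range, nsmul_eq_mul]
  have h5 : ((d + 1 : ℕ) : ℝ) ≤ 2 ^ d := by
    have : d + 1 ≤ 2 ^ d := Nat.lt_two_pow_self
    exact_mod_cast this
  calc ((d + 1 : ℕ) : ℝ) * (2 ^ d * C * g1) ≤ 2 ^ d * (2 ^ d * C * g1) := by gcongr
    _ = 4 ^ d * C * g1 := by
      rw [show (4 : ℝ) = 2 * 2 by norm_num, mul_pow]; ring

/-- `A` has the same power indices as a product of cyclic groups of orders `x i`. -/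
def IdxP (A : Type*) [AddCommGroup A] {ι : Type*} [Fintype ι] (x : ι → ℕ) : Prop :=
  ∀ N, 0 < N → (mulSub A N).index = ∏ i, Nat.gcd N (x i)

/-- the part of `x` composed of primes in `Q`. -/
noncomputable def Qp (Q : Set ℕ) (x : ℕ) : ℕ := by
  classical
  exact x.factorization.prod fun q e => if q ∈ Q then q ^ e else 1

theorem Qp_mul (Q : Set ℕ) {x y : ℕ} (hx : x ≠ 0) (hy : y ≠ 0) : Qp Q (x * y) = Qp Q x * Qp Q y := by
  classical
  unfold Qp
  rw [Nat.factorization_mul hx hy]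
  apply Finsupp.prod_add_index'
  · intro a; split_ifs <;> simp
  · intro a b c; split_ifs
    · rw [pow_add]
    · simp

theorem Qp_one (Q : Set ℕ) : Qp Q 1 = 1 := by
  simp [Qp]

theorem Qp_prime_mem (Q : Set ℕ) {q : ℕ} (hq : q.Prime) (h : q ∈ Q) : Qp Q q = q := by
  classical
  simp [Qp, hq.factorization, h]

theorem Qp_prime_notMem (Q : Set ℕ) {q : ℕ} (hq : q.Prime) (h : q ∉ Q) : Qp Q q = 1 := by
  classical
  simp [Qp, hq.factorization, h]

theorem Qp_pos (Q : Set ℕ) (x : ℕ) : 0 < Qp Q x := by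
  classical
  unfold Qp
  apply Finset.prod_pos
  intro q hq
  dsimp only
  split_ifs
  · exact pow_pos (Nat.prime_of_mem_primeFactors hq).pos _
  · exact one_pos

theorem mulSub_mul_addSubgroupOf (A : Type*) [AddCommGroup A] (q N : ℕ) :
    (mulSub A (q * N)).addSubgroupOf (mulSub A q) = mulSub (mulSub A q) N := by
  ext ⟨x, hx⟩
  simp only [AddSubgroup.mem_addSubgroupOf, mem_mulSub]
  constructor
  · rintro ⟨y, hy⟩
    refine ⟨⟨q • y, mem_mulSub.2 ⟨y, rfl⟩⟩, ?_⟩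
    ext
    change N • (q • y) = x
    rw [← mul_nsmul]
    exact hy
  · rintro ⟨⟨y, hy⟩, hyx⟩
    obtain ⟨z, rfl⟩ := mem_mulSub.1 hy
    refine ⟨z, ?_⟩
    have := congrArg Subtype.val hyx
    change N • (q • z) = x at this
    rw [mul_nsmul]
    exact this

theorem mulSub_mul_le (A : Type*) [AddCommGroup A] (q N : ℕ) : mulSub A (q * N) ≤ mulSub A q := by
  intro x hx
  obtain ⟨y, rfl⟩ := mem_mulSub.1 hx
  exact mem_mulSub.2 ⟨N • y, by rw [← mul_nsmul, mul_comm]⟩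

theorem mulSub_one (A : Type*) [AddCommGroup A] : mulSub A 1 = ⊤ := by
  rw [eq_top_iff]
  intro x _
  exact mem_mulSub.2 ⟨x, one_nsmul x⟩

theorem gcd_prime_eq {q : ℕ} (hq : q.Prime) (x : ℕ) : Nat.gcd q x = if q ∣ x then q else 1 := by
  split_ifs with h
  · exact Nat.gcd_eq_left h
  · exact (Nat.Prime.coprime_iff_not_dvd hq).2 h

theorem IdxP.sub {A : Type*} [AddCommGroup A] {ι : Type*} [Fintype ι] {x : ι → ℕ} (h : IdxP A x)
    {q : ℕ} (hq : q.Prime) (hx : ∀ i, 0 < x i) :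
    IdxP (mulSub A q) (fun i => if q ∣ x i then x i / q else x i) := by
  intro N hN
  have h1 := AddSubgroup.relIndex_mul_index (mulSub_mul_le A q N)
  have h2 : (mulSub A (q * N)).relIndex (mulSub A q) = (mulSub (mulSub A q) N).index := by
    rw [← mulSub_mul_addSubgroupOf]; rfl
  rw [h2, h q hq.pos, h _ (Nat.mul_pos hq.pos hN)] at h1
  have h3 : 0 < ∏ i, Nat.gcd q (x i) := Finset.prod_pos fun i _ => Nat.gcd_pos_of_pos_left _ hq.pos
  apply Nat.eq_of_mul_eq_mul_right h3
  rw [h1, ← Finset.prod_mul_distrib]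
  refine Finset.prod_congr rfl fun i _ => ?_
  rw [gcd_prime_eq hq]
  dsimp only
  split_ifs with hd
  · obtain ⟨y, hy⟩ := hd
    rw [hy, Nat.mul_div_cancel_left _ hq.pos, Nat.gcd_mul_left, mul_comm]
  · rw [mul_one]
    exact Nat.Coprime.gcd_mul_left_cancel _ ((Nat.Prime.coprime_iff_not_dvd hq).2 hd)

/-- The constant `3 - 2 √2`. -/
noncomputable def KK : ℝ := 3 - 2 * Real.sqrt 2

theorem KK_pos : 0 < KK := by
  unfold KK
  have : Real.sqrt 2 < 3 / 2 := by
    rw [Real.sqrt_lt' (by norm_num)]; norm_num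
  linarith

theorem KK_key (d r : ℝ) : r * (d - r) ≤ KK * (d * (d + r)) := by
  unfold KK
  have h2 : Real.sqrt 2 * Real.sqrt 2 = 2 := Real.mul_self_sqrt (by norm_num)
  have h3 : (3 - 2 * Real.sqrt 2) * (d * (d + r)) - r * (d - r) = (r - (Real.sqrt 2 - 1) * d) ^ 2 := by
    linear_combination (-d ^ 2) * h2
  linarith [sq_nonneg (r - (Real.sqrt 2 - 1) * d)]

theorem abelian_sum {ι : Type*} [Fintype ι] [DecidableEq ι] (D : Finset ι) (w : ι → ℕ)
    (hw : ∀ i, w i = if i ∈ D then 2 else 1) (Q : Set ℕ) (W b : ℕ) (hW : ∑ i, w i ≤ W)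
    (hb : KK * W ≤ b) (n : ℕ) :
    ∀ (A : Type) [AddCommGroup A] [Finite A] [Fintype (AddSubgroup A)] (x : ι → ℕ),
      (∏ i, x i ≤ n) → (∀ i, 0 < x i) → IdxP A x →
      (∀ q : ℕ, q.Prime → q ∉ Q → ∑ i ∈ Finset.univ.filter (fun i => q ∣ x i), w i ≤ b) →
      ∑ P : AddSubgroup A, (∏ j ∈ D, ((P ⊔ mulSub A (2 ^ (x j).factorization 2)).index : ℝ)) /
        (P.index : ℝ) ^ b ≤
      (∏ i, (x i : ℝ)) ^ 2 * ∏ i, (Qp Q (x i) : ℝ) ^ (KK * W * w i) := by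
  classical
  induction n using Nat.strong_induction_on with
  | _ n ih =>
  intro A _ _ _ x hxn hx hA hnQ
  by_cases hone : ∀ i, x i = 1
  · have hc : Nat.card A = 1 := by
      have h1 := hA (Nat.card A) Nat.card_pos
      have h2 : mulSub A (Nat.card A) = ⊥ := by
        rw [eq_bot_iff]
        intro y hy
        obtain ⟨z, rfl⟩ := mem_mulSub.1 hy
        simp
      rw [h2, AddSubgroup.index_bot] at h1
      rw [h1]
      simp [hone]
    have hsub : Subsingleton A := (Nat.card_eq_one_iff_unique.1 hc).1
    have hall : ∀ P : AddSubgroup A, P = ⊤ := fun P => by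
      ext y; simp [Subsingleton.elim y 0]
    have : Unique (AddSubgroup A) := ⟨⟨⊤⟩, hall⟩
    rw [Fintype.sum_unique]
    rw [hall (@default _ (@Unique.instInhabited _ this))]
    simp [hone, Qp_one]
  · -- choose the prime
    obtain ⟨q, hqp, ⟨i₀, hi₀⟩, hq2⟩ : ∃ q : ℕ, q.Prime ∧ (∃ i, q ∣ x i) ∧
        (q = 2 ∨ ∀ i, ¬ 2 ∣ x i) := by
      by_cases h2 : ∃ i, 2 ∣ x i
      · exact ⟨2, Nat.prime_two, h2, Or.inl rfl⟩
      · push Not at hone h2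
        obtain ⟨i, hi⟩ := hone
        obtain ⟨q, hq, hqd⟩ := Nat.exists_prime_and_dvd hi
        exact ⟨q, hq, ⟨i, hqd⟩, Or.inr h2⟩
    have : Fact q.Prime := ⟨hqp⟩
    set x' : ι → ℕ := fun i => if q ∣ x i then x i / q else x i with hx'
    set d := (Finset.univ.filter (fun i => q ∣ x i)).card with hd
    set d'' := ∑ i ∈ Finset.univ.filter (fun i => q ∣ x i), w i with hd''
    have hxx' : ∀ i, x i = (if q ∣ x i then q else 1) * x' i := by
      intro i
      simp only [hx']
      split_ifs with h
      · exact (Nat.mul_div_cancel' h).symm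
      · simp
    have hx'pos : ∀ i, 0 < x' i := by
      intro i
      by_contra h0
      have h1 := hxx' i
      have h2 := hx i
      rw [Nat.eq_zero_of_not_pos h0, mul_zero] at h1
      omega
    have hprodq : ∀ (y : ι → ℕ), (∏ i, if q ∣ x i then (y i) else 1) =
        ∏ i ∈ Finset.univ.filter (fun i => q ∣ x i), y i := fun y => by
      rw [Finset.prod_filter]
    have hidx : (mulSub A q).index = q ^ d := by
      rw [hA q hqp.pos, Finset.prod_congr rfl fun i _ => gcd_prime_eq hqp (x i), hprodq,
        Finset.prod_const]
    have hxprod : ∏ i, x i = q ^ d * ∏ i, x' i := by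
      rw [Finset.prod_congr rfl fun i _ => hxx' i, Finset.prod_mul_distrib, hprodq,
        Finset.prod_const]
    have hdpos : 0 < d := Finset.card_pos.2 ⟨i₀, by simp [hi₀]⟩
    have hlt : ∏ i, x' i < n := by
      refine lt_of_lt_of_le ?_ hxn
      rw [hxprod]
      have h1 : 0 < ∏ i, x' i := Finset.prod_pos fun i _ => hx'pos i
      have h2 : 1 < q ^ d := Nat.one_lt_pow hdpos.ne' hqp.one_lt
      nlinarith
    set J := D.filter (fun j => 2 ∣ x j) with hJ
    have hJ2 : ∀ j ∈ J, q = 2 := by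
      intro j hj
      rcases hq2 with h | h
      · exact h
      · exact absurd (Finset.mem_filter.1 hj).2 (h j)
    set N : ι → AddSubgroup A := fun j => mulSub A (2 ^ (x j).factorization 2) with hN
    have hv : ∀ j ∈ J, (x j).factorization 2 = (x' j).factorization 2 + 1 := by
      intro j hj
      have hq := hJ2 j hj
      have h2 := (Finset.mem_filter.1 hj).2
      have h3 := hxx' j
      rw [hq, if_pos h2] at h3
      rw [h3, Nat.factorization_mul two_ne_zero (hx'pos j).ne', Finsupp.add_apply,
        Nat.prime_two.factorization_self, add_comm]
    have hNj : ∀ j ∈ J, N j = mulSub A (q * 2 ^ (x' j).factorization 2) := by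
      intro j hj
      simp only [hN]
      rw [hv j hj, hJ2 j hj, pow_succ, mul_comm]
    have hNle : ∀ j ∈ J, N j ≤ mulSub A q := by
      intro j hj
      rw [hNj j hj]
      exact mulSub_mul_le A q _
    have hsumw : d + J.card ≤ d'' := by
      by_cases hJe : J.card = 0
      · rw [hJe, add_zero, hd, hd'', Finset.card_eq_sum_ones]
        refine Finset.sum_le_sum fun i _ => ?_
        rw [hw]; split_ifs <;> omega
      · obtain ⟨j, hj⟩ := Finset.card_pos.1 (Nat.pos_of_ne_zero hJe)
        have hq := hJ2 j hj
        have h1 : d'' = ∑ i ∈ Finset.univ.filter (fun i => q ∣ x i), (1 + if i ∈ D then 1 else 0) := by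
          rw [hd'']
          refine Finset.sum_congr rfl fun i _ => ?_
          rw [hw]; split_ifs <;> rfl
        rw [h1, Finset.sum_add_distrib, ← Finset.card_eq_sum_ones, ← Finset.card_filter]
        apply Nat.add_le_add_left
        apply Finset.card_le_card
        intro i hi
        have := Finset.mem_filter.1 hi
        simp [this.1, hq, this.2]
    have hd''W : d'' ≤ W := le_trans (Finset.sum_le_sum_of_subset (Finset.filter_subset _ _)) hW
    set C : ℝ := if q ∈ Q then (q : ℝ) ^ (KK * W * d'') else 1 with hCdef
    have hq1 : (1 : ℝ) ≤ q := by exact_mod_cast hqp.one_lt.le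
    have hC : ∀ r ≤ d, (q : ℝ) ^ (r * (d - r) + r * J.card) ≤ C * q ^ (b * r) := by
      intro r hr
      have hcast : ((r * (d - r) + r * J.card : ℕ) : ℝ) = r * ((d + J.card : ℕ) - (r : ℝ)) := by
        push_cast [Nat.cast_sub hr]; ring
      simp only [hCdef]
      split_ifs with hqQ
      · rw [← Real.rpow_natCast, ← Real.rpow_natCast, ← Real.rpow_add (by linarith)]
        apply Real.rpow_le_rpow_of_exponent_le hq1
        rw [hcast]
        obtain ⟨d', hd'⟩ : ∃ d' : ℝ, d' = ((d + J.card : ℕ) : ℝ) := ⟨_, rfl⟩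
        rw [← hd']
        have h1 := KK_key d' r
        have h2 : d' ≤ d'' := by rw [hd']; exact_mod_cast hsumw
        have h3 : (d'' : ℝ) ≤ W := by exact_mod_cast hd''W
        have h4 : (0 : ℝ) ≤ d' := by rw [hd']; exact Nat.cast_nonneg _
        have h5 : KK * (d' * (d' + r)) ≤ KK * (W * (d'' + r)) := by
          have := KK_pos
          gcongr
          exact h2.trans h3
        have h6 : KK * W * r ≤ b * r := by gcongr
        push_cast
        linarith
      · rw [one_mul]
        apply pow_le_pow_right₀ hq1
        have h1 := hnQ q hqp hqQ
        have h2 : r * (d - r) + r * J.card ≤ r * b := by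
          rw [← Nat.mul_add]
          apply Nat.mul_le_mul_left
          omega
        rw [mul_comm b]; exact h2
    have : Fintype (AddSubgroup (mulSub A q)) := Fintype.ofFinite _
    have hstep := abelian_step_sum (q := q) A (mulSub A q) rfl d b hidx J N hNle C hC
    have hIH := ih _ hlt (mulSub A q) x' le_rfl hx'pos (hA.sub hqp hx) (by
      intro q' hq' hq'Q
      refine le_trans (Finset.sum_le_sum_of_subset ?_) (hnQ q' hq' hq'Q)
      intro i hi
      simp only [Finset.mem_filter, Finset.mem_univ, true_and] at hi ⊢
      rw [hxx' i]
      exact hi.mul_left _)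
    have hA1 : ∑ P : AddSubgroup A, (∏ j ∈ D, ((P ⊔ mulSub A (2 ^ (x j).factorization 2)).index : ℝ)) /
        (P.index : ℝ) ^ b = ∑ P : AddSubgroup A, (∏ j ∈ J, ((P ⊔ N j).index : ℝ)) / (P.index : ℝ) ^ b := by
      refine Finset.sum_congr rfl fun P _ => ?_
      congr 1
      symm
      apply Finset.prod_subset (Finset.filter_subset _ _)
      intro j hj hjJ
      have h2 : ¬ 2 ∣ x j := fun h => hjJ (Finset.mem_filter.2 ⟨hj, h⟩)
      simp only [hN]
      rw [Nat.factorization_eq_zero_of_not_dvd h2, pow_zero, mulSub_one]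
      simp
    have hB1 : ∑ P : AddSubgroup (mulSub A q),
        (∏ j ∈ J, ((P ⊔ (N j).addSubgroupOf (mulSub A q)).index : ℝ)) / (P.index : ℝ) ^ b =
        ∑ P : AddSubgroup (mulSub A q), (∏ j ∈ D,
          ((P ⊔ mulSub (mulSub A q) (2 ^ (x' j).factorization 2)).index : ℝ)) /
        (P.index : ℝ) ^ b := by
      refine Finset.sum_congr rfl fun P _ => ?_
      congr 1
      have h1 : ∀ j ∈ J, ((P ⊔ (N j).addSubgroupOf (mulSub A q)).index : ℝ) =
          ((P ⊔ mulSub (mulSub A q) (2 ^ (x' j).factorization 2)).index : ℝ) := by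
        intro j hj
        rw [hNj j hj, mulSub_mul_addSubgroupOf]
      rw [Finset.prod_congr rfl h1]
      apply Finset.prod_subset (Finset.filter_subset _ _)
      intro j hj hjJ
      have h2 : ¬ 2 ∣ x j := fun h => hjJ (Finset.mem_filter.2 ⟨hj, h⟩)
      have h3 : ¬ 2 ∣ x' j := fun h => h2 (by rw [hxx' j]; exact h.mul_left _)
      rw [Nat.factorization_eq_zero_of_not_dvd h3, pow_zero, mulSub_one]
      simp
    rw [hA1]
    refine hstep.trans ?_
    rw [hB1]
    have hC0 : 0 ≤ C := by
      simp only [hCdef]; split_ifs <;> positivity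
    have h4 : (4 : ℝ) ^ d ≤ ((q : ℝ) ^ d) ^ 2 := by
      rw [← pow_mul, mul_comm, pow_mul]
      apply pow_le_pow_left₀ (by norm_num)
      have : (2 : ℝ) ≤ q := by exact_mod_cast hqp.two_le
      nlinarith
    have hQprod : ∏ i, (Qp Q (x i) : ℝ) ^ (KK * W * w i) =
        C * ∏ i, (Qp Q (x' i) : ℝ) ^ (KK * W * w i) := by
      have h1 : ∀ i, (Qp Q (x i) : ℝ) ^ (KK * W * w i) =
          (if q ∣ x i then (if q ∈ Q then (q : ℝ) ^ (KK * W * w i) else 1) else 1) *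
          (Qp Q (x' i) : ℝ) ^ (KK * W * w i) := by
        intro i
        have h2 : Qp Q (x i) = (if q ∣ x i then (if q ∈ Q then q else 1) else 1) * Qp Q (x' i) := by
          conv_lhs => rw [hxx' i]
          split_ifs with h5 h6
          · rw [Qp_mul Q hqp.ne_zero (hx'pos i).ne', Qp_prime_mem Q hqp h6]
          · rw [Qp_mul Q hqp.ne_zero (hx'pos i).ne', Qp_prime_notMem Q hqp h6]
          · rw [one_mul, one_mul]
        rw [h2]
        push_cast
        rw [Real.mul_rpow (by split_ifs <;> positivity) (by positivity)]
        congr 1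
        split_ifs <;> simp
      rw [Finset.prod_congr rfl fun i _ => h1 i, Finset.prod_mul_distrib]
      congr 1
      rw [← Finset.prod_filter]
      simp only [hCdef]
      split_ifs with hqQ
      · rw [← Real.rpow_sum_of_pos (by linarith)]
        congr 1
        rw [← Finset.mul_sum, hd'']
        push_cast
        rfl
      · simp
    rw [hQprod]
    have hxprodR : (∏ i, (x i : ℝ)) = (q : ℝ) ^ d * ∏ i, (x' i : ℝ) := by exact_mod_cast hxprod
    rw [hxprodR]
    calc _ ≤ ((q : ℝ) ^ d) ^ 2 * C * ((∏ i, (x' i : ℝ)) ^ 2 * ∏ i, (Qp Q (x' i) : ℝ) ^ (KK * W * w i)) := by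
          gcongr
      _ = _ := by ring

/-- the additive trace of `Λ` on `A`. -/
def traceA {A M : Type*} [AddCommGroup A] [Group M] (τ : Multiplicative A →* M) (Λ : Subgroup M) :
    AddSubgroup A := Subgroup.toAddSubgroup' (Λ.comap τ)

theorem mem_traceA {A M : Type*} [AddCommGroup A] [Group M] (τ : Multiplicative A →* M)
    (Λ : Subgroup M) (a : A) : a ∈ traceA τ Λ ↔ τ (Multiplicative.ofAdd a) ∈ Λ := Iff.rfl

/-- The set of subgroups with given trace, generated by the trace and the intersection with `Y`. -/
def SY {A M : Type*} [AddCommGroup A] [Group M] (τ : Multiplicative A →* M) (Y : Subgroup M)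
    (P : AddSubgroup A) (N : Subgroup M) : Set (Subgroup M) :=
  {Λ | Λ ≤ N ∧ traceA τ Λ = P ∧ Λ ≤ (Λ ⊓ τ.range) ⊔ (Λ ⊓ Y)}

theorem theta_fibre {A M : Type*} [AddCommGroup A] [Finite A] [Group M] [Finite M]
    (τ : Multiplicative A →* M) (hT : τ.range.Normal) (Y Me Ma : Subgroup M)
    (hTM : τ.range ≤ Me) (h2 : ∀ x ∈ Ma, x ∉ Me → ∀ z ∈ Ma, z ∉ Me → x⁻¹ * z ∈ Me) (m : ℕ)
    (hpow : ∀ x ∈ Ma, ∀ t ∈ τ.range, t ∈ Y → ((x⁻¹ * t * x) * t) ^ m = t ^ (2 * m))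
    (P : AddSubgroup A) (hle : Me ≤ Ma) :
    (SY τ Y P Ma).ncard ≤ (SY τ Y P Me).ncard *
      (1 + τ.range.index * Nat.card {c : A ⧸ P // (2 * m) • c = 0}) := by
  classical
  refine ncard_le_mul _ (fun Λ => Λ ⊓ Me) _ (Set.toFinite _) (Set.toFinite _) ?_ _ ?_
  · rintro Λ ⟨h1, h3, h4⟩
    refine ⟨inf_le_right, ?_, ?_⟩
    · ext a
      rw [← h3, mem_traceA, mem_traceA, Subgroup.mem_inf]
      exact ⟨fun h => h.1, fun h => ⟨h, hTM ⟨_, rfl⟩⟩⟩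
    · have h5 : Λ ⊓ τ.range ≤ Me := inf_le_right.trans hTM
      have h6 : Λ ⊓ Me ⊓ τ.range = Λ ⊓ τ.range := by
        rw [inf_assoc, inf_eq_right.2 hTM]
      rw [h6]
      intro z hz
      obtain ⟨hzΛ, hzM⟩ := Subgroup.mem_inf.1 hz
      have hz' : z ∈ τ.range ⊔ (Λ ⊓ Y) := 
        (sup_le (inf_le_right.trans le_sup_left) le_sup_right : (Λ ⊓ τ.range) ⊔ (Λ ⊓ Y) ≤ _) (h4 hzΛ)
      obtain ⟨a, ha, b, hb, rfl⟩ := Subgroup.mem_sup_of_normal_left.1 hz'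
      obtain ⟨hb1, hb2⟩ := Subgroup.mem_inf.1 hb
      refine Subgroup.mul_mem_sup (Subgroup.mem_inf.2 ⟨?_, ha⟩) (Subgroup.mem_inf.2 ⟨Subgroup.mem_inf.2 ⟨hb1, ?_⟩, hb2⟩)
      · simpa using Λ.mul_mem hzΛ (Λ.inv_mem hb1)
      · simpa using Me.mul_mem (Me.inv_mem (hTM ha)) hzM
  · rintro Λk hΛk
    set F := {Λ | Λ ∈ SY τ Y P Ma ∧ Λ ⊓ Me = Λk} with hF
    let valid : M ⧸ τ.range → M → Prop := fun θ x =>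
      ∃ Λ ∈ F, x ∈ Λ ∧ x ∈ Y ∧ x ∉ Me ∧ (QuotientGroup.mk x : M ⧸ τ.range) = θ
    let r : M ⧸ τ.range → M := fun θ => if h : ∃ x, valid θ x then h.choose else 1
    let β := Option ((M ⧸ τ.range) × {c : A ⧸ P // (2 * m) • c = 0})
    let g : β → Subgroup M := fun o => match o with
      | none => Λk
      | some (θ, c) => Λk ⊔ Subgroup.zpowers (r θ * τ (Multiplicative.ofAdd (Quotient.out c.1)))
    have hcard : Nat.card β = 1 + τ.range.index * Nat.card {c : A ⧸ P // (2 * m) • c = 0} := by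
      simp only [β]
      rw [Finite.card_option, Nat.card_prod, add_comm]
      rfl
    rw [← hcard]
    apply card_le_of_surj_on F g
    rintro Λ hΛ
    have hΛk' : ∀ {z}, z ∈ Λ → z ∈ Me → z ∈ Λk := fun hz hz' => by
      rw [← hΛ.2]; exact Subgroup.mem_inf.2 ⟨hz, hz'⟩
    have hΛkle : Λk ≤ Λ := by rw [← hΛ.2]; exact inf_le_left
    by_cases hLM : Λ ≤ Me
    · exact ⟨none, by change Λk = Λ; rw [← hΛ.2, inf_eq_left.2 hLM]⟩
    obtain ⟨x, hxΛ, hxY, hxM⟩ : ∃ x, x ∈ Λ ∧ x ∈ Y ∧ x ∉ Me := by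
      by_contra hcon
      push Not at hcon
      apply hLM
      refine hΛ.1.2.2.trans (sup_le (inf_le_right.trans hTM) ?_)
      intro x hx
      exact hcon x (Subgroup.mem_inf.1 hx).1 (Subgroup.mem_inf.1 hx).2
    set θ : M ⧸ τ.range := QuotientGroup.mk x with hθ
    have hex : ∃ x, valid θ x := ⟨x, Λ, hΛ, hxΛ, hxY, hxM, rfl⟩
    have hr : valid θ (r θ) := by
      simp only [r]
      rw [dif_pos hex]
      exact hex.choose_spec
    obtain ⟨Λ0, hΛ0, hrΛ0, hrY, hrM, hrθ⟩ := hr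
    set ρ := r θ with hρ
    have hρa : ρ ∈ Ma := hΛ0.1.1 hrΛ0
    have hxa : x ∈ Ma := hΛ.1.1 hxΛ
    have hyT : ρ⁻¹ * x ∈ τ.range := QuotientGroup.eq.1 (hrθ.trans hθ)
    obtain ⟨y, hy⟩ := hyT
    have hsq : ∀ z ∈ Ma, z ∉ Me → z * z ∈ Me := by
      intro z hz hz'
      have := h2 z⁻¹ (Ma.inv_mem hz) (fun h => hz' (by simpa using Me.inv_mem h)) z hz hz'
      simpa using this
    have hρ2 : ρ * ρ ∈ Λk := by
      rw [← hΛ0.2]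
      exact Subgroup.mem_inf.2 ⟨Λ0.mul_mem hrΛ0 hrΛ0, hsq ρ hρa hrM⟩
    have hx2 : x * x ∈ Λk := hΛk' (Λ.mul_mem hxΛ hxΛ) (hsq x hxa hxM)
    have hw : (ρ⁻¹ * τ y * ρ) * τ y ∈ Λk := by
      have : (ρ⁻¹ * τ y * ρ) * τ y = (ρ * ρ)⁻¹ * (x * x) := by rw [hy]; group
      rw [this]
      exact Λk.mul_mem (Λk.inv_mem hρ2) hx2
    have hyY : τ y ∈ Y := by rw [hy]; exact Y.mul_mem (Y.inv_mem hrY) hxY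
    have hypow : τ y ^ (2 * m) ∈ Λ := by
      rw [← hpow ρ hρa (τ y) ⟨y, rfl⟩ hyY]
      exact hΛkle (Λk.pow_mem hw m)
    have hyP : (2 * m) • (Multiplicative.toAdd y) ∈ P := by
      rw [← hΛ.1.2.1, mem_traceA]
      rw [ofAdd_nsmul, ofAdd_toAdd, map_pow]
      exact hypow
    let c : {c : A ⧸ P // (2 * m) • c = 0} := ⟨QuotientAddGroup.mk (Multiplicative.toAdd y), by
      rw [← QuotientAddGroup.mk_nsmul, QuotientAddGroup.eq_zero_iff]
      exact hyP⟩
    refine ⟨some (θ, c), ?_⟩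
    change Λk ⊔ Subgroup.zpowers (r θ * τ (Multiplicative.ofAdd (Quotient.out c.1))) = Λ
    have hout : (-(Multiplicative.toAdd y) + Quotient.out c.1) ∈ P := by
      rw [← QuotientAddGroup.eq]
      exact (Quotient.out_eq c.1).symm
    set p := (-(Multiplicative.toAdd y) + Quotient.out c.1) with hp
    have houteq : Quotient.out c.1 = Multiplicative.toAdd y + p := by rw [hp]; abel
    have hx' : r θ * τ (Multiplicative.ofAdd (Quotient.out c.1)) = x * τ (Multiplicative.ofAdd p) := by
      rw [houteq, ofAdd_add, ofAdd_toAdd, map_mul, hy, ← hρ]; group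
    have hpΛ : τ (Multiplicative.ofAdd p) ∈ Λ := by
      rw [← mem_traceA, hΛ.1.2.1]; exact hout
    rw [hx']
    set x' := x * τ (Multiplicative.ofAdd p) with hx'def
    have hx'Λ : x' ∈ Λ := Λ.mul_mem hxΛ hpΛ
    have hx'M : x' ∉ Me := by
      intro h
      apply hxM
      have : x = x' * (τ (Multiplicative.ofAdd p))⁻¹ := by rw [hx'def]; group
      rw [this]
      exact Me.mul_mem h (Me.inv_mem (hTM ⟨_, rfl⟩))
    apply le_antisymm
    · exact sup_le hΛkle (by rw [Subgroup.zpowers_le]; exact hx'Λ)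
    · intro z hz
      by_cases hzM : z ∈ Me
      · exact (le_sup_left : Λk ≤ _) (hΛk' hz hzM)
      · have h3 := h2 x' (hΛ.1.1 hx'Λ) hx'M z (hΛ.1.1 hz) hzM
        have h4 := hΛk' (Λ.mul_mem (Λ.inv_mem hx'Λ) hz) h3
        have : z = x' * (x'⁻¹ * z) := by group
        rw [this]
        exact Subgroup.mul_mem _ ((le_sup_right : Subgroup.zpowers x' ≤ _)
          (Subgroup.mem_zpowers x')) ((le_sup_left : Λk ≤ _) h4)

theorem card_torsion_quot {A : Type*} [AddCommGroup A] [Finite A] (P : AddSubgroup A) (n : ℕ) :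
    Nat.card {c : A ⧸ P // n • c = 0} = (P ⊔ mulSub A n).index := by
  have h0 : Nat.card {c : A ⧸ P // n • c = 0} =
      Nat.card (nsmulAddMonoidHom n : (A ⧸ P) →+ (A ⧸ P)).ker := rfl
  rw [h0]
  set E := (nsmulAddMonoidHom n : (A ⧸ P) →+ (A ⧸ P)).ker with hE
  have h1 := AddSubgroup.card_mul_index E
  have h2 := AddSubgroup.card_mul_index (mulSub (A ⧸ P) n)
  rw [hE, AddSubgroup.index_ker] at h1
  have h3 : Nat.card E = (mulSub (A ⧸ P) n).index := by
    have : 0 < Nat.card (mulSub (A ⧸ P) n) := Nat.card_pos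
    apply Nat.eq_of_mul_eq_mul_right this
    rw [h1, mul_comm, h2]
  have h4 : mulSub (A ⧸ P) n = (mulSub A n).map (QuotientAddGroup.mk' P) := by
    ext x
    simp only [mem_mulSub, AddSubgroup.mem_map]
    constructor
    · rintro ⟨y, rfl⟩
      obtain ⟨y, rfl⟩ := QuotientAddGroup.mk'_surjective P y
      exact ⟨n • y, ⟨y, rfl⟩, by simp⟩
    · rintro ⟨_, ⟨y, rfl⟩, rfl⟩
      exact ⟨QuotientAddGroup.mk' P y, by simp⟩
  rw [h3, h4, AddSubgroup.index_map, QuotientAddGroup.ker_mk', QuotientAddGroup.range_mk', sup_comm]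
  simp

theorem idxP_pi {ι : Type*} [Fintype ι] (x : ι → ℕ) (hx : ∀ i, 0 < x i) :
    IdxP (∀ i, ZMod (x i)) x := by
  intro N _
  have : ∀ i, NeZero (x i) := fun i => ⟨(hx i).ne'⟩
  have h1 := AddSubgroup.card_mul_index (mulSub (∀ i, ZMod (x i)) N)
  have h2 : Nat.card (mulSub (∀ i, ZMod (x i)) N) = ∏ i, Nat.card (mulSub (ZMod (x i)) N) := by
    rw [← Nat.card_pi]
    refine Nat.card_congr ⟨fun a i => ⟨a.1 i, ?_⟩, fun a => ⟨fun i => (a i).1, ?_⟩, ?_, ?_⟩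
    · obtain ⟨y, hy⟩ := mem_mulSub.1 a.2
      exact mem_mulSub.2 ⟨y i, by rw [← hy]; rfl⟩
    · choose y hy using fun i => mem_mulSub.1 (a i).2
      exact mem_mulSub.2 ⟨y, funext hy⟩
    · intro a; rfl
    · intro a; rfl
  have h3 : ∀ i, Nat.card (mulSub (ZMod (x i)) N) * Nat.gcd N (x i) = x i := by
    intro i
    have := IsAddCyclic.card_nsmulAddMonoidHom_range (ZMod (x i)) N
    change Nat.card (nsmulAddMonoidHom N : ZMod (x i) →+ ZMod (x i)).range * _ = _
    rw [this, Nat.card_zmod, Nat.gcd_comm N]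
    exact Nat.div_mul_cancel (Nat.gcd_dvd_left _ _)
  have h4 : Nat.card (∀ i, ZMod (x i)) = ∏ i, x i := by
    rw [Nat.card_pi]; simp
  have h5 : 0 < Nat.card (mulSub (∀ i, ZMod (x i)) N) := Nat.card_pos
  apply Nat.eq_of_mul_eq_mul_left h5
  rw [h1, h4, h2, ← Finset.prod_mul_distrib]
  exact Finset.prod_congr rfl fun i _ => (h3 i).symm

section theta
variable {ι : Type} [Fintype ι] [DecidableEq ι] (L : ι → Type) [∀ i, Group (L i)]
  [∀ i, Finite (L i)] (x : ι → ℕ) 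
  (τ : ∀ i, Multiplicative (ZMod (x i)) →* L i)

/-- product of the maps `τ i`. -/
def tauHat : Multiplicative (∀ i, ZMod (x i)) →* (∀ i, L i) where
  toFun a i := τ i (Multiplicative.ofAdd (Multiplicative.toAdd a i))
  map_one' := by
    funext i
    exact (τ i).map_one
  map_mul' a b := by
    funext i
    exact (τ i).map_mul _ _

theorem tauHat_range : (tauHat L x τ).range = Subgroup.pi Set.univ (fun i => (τ i).range) := by
  ext g
  rw [Subgroup.mem_pi]
  constructor
  · rintro ⟨a, rfl⟩ i _
    exact ⟨_, rfl⟩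
  · intro h
    choose y hy using fun i => h i (Set.mem_univ i)
    exact ⟨Multiplicative.ofAdd (fun i => Multiplicative.toAdd (y i)), funext hy⟩

theorem theta_count (hx : ∀ i, 0 < x i)
    (hnorm : ∀ i, (τ i).range.Normal) (D : Finset ι) (hB : ∀ i, i ∉ D → (τ i).range = ⊤)
    (hD : ∀ i, (τ i).range.index ∣ 2) (Y : Subgroup (∀ i, L i)) (hY : IsPGroup 2 Y)
    (P : AddSubgroup (∀ i, ZMod (x i))) :
    (SY (tauHat L x τ) Y P ⊤).ncard ≤ ∏ j ∈ D, (1 + (tauHat L x τ).range.index *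
      (P ⊔ mulSub (∀ i, ZMod (x i)) (2 * 2 ^ (x j).factorization 2)).index) := by
  classical
  have hNZ : ∀ i, NeZero (x i) := fun i => ⟨(hx i).ne'⟩
  have hTn : (tauHat L x τ).range.Normal := by
    rw [tauHat_range]
    refine ⟨fun n hn g => ?_⟩
    rw [Subgroup.mem_pi] at hn ⊢
    exact fun i hi => (hnorm i).conj_mem _ (hn i hi) (g i)
  let ME : Finset ι → Subgroup (∀ i, L i) := fun E =>
    Subgroup.pi {i | i ∉ E} (fun i => (τ i).range)
  have hmem : ∀ E g, g ∈ ME E ↔ ∀ i, i ∉ E → g i ∈ (τ i).range := fun E g => Subgroup.mem_pi _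
  have hmemT : ∀ g, g ∈ (tauHat L x τ).range ↔ ∀ i, g i ∈ (τ i).range := by
    intro g; rw [tauHat_range, Subgroup.mem_pi]; simp
  have key : ∀ E : Finset ι, (SY (tauHat L x τ) Y P (ME E)).ncard ≤ ∏ j ∈ E,
      (1 + (tauHat L x τ).range.index *
      (P ⊔ mulSub (∀ i, ZMod (x i)) (2 * 2 ^ (x j).factorization 2)).index) := by
    intro E
    induction E using Finset.induction_on_max_value (fun j => (x j).factorization 2) with
    | empty =>
      rw [Finset.prod_empty]
      rw [Set.ncard_le_one]
      intro Λ hΛ Λ2 hΛ2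
      have haux : ∀ Λ ∈ SY (tauHat L x τ) Y P (ME ∅), ∀ g, g ∈ Λ ↔
          ∃ a ∈ P, tauHat L x τ (Multiplicative.ofAdd a) = g := by
        rintro Λ ⟨h1, h2, -⟩ g
        constructor
        · intro hg
          have h3 : g ∈ (tauHat L x τ).range := by
            rw [hmemT]
            intro i
            exact (hmem _ _).1 (h1 hg) i (by simp)
          obtain ⟨a, rfl⟩ := h3
          refine ⟨Multiplicative.toAdd a, ?_, rfl⟩
          rw [← h2, mem_traceA]
          exact hg
        · rintro ⟨a, ha, rfl⟩
          rw [← h2, mem_traceA] at ha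
          exact ha
      ext g
      rw [haux Λ hΛ, haux Λ2 hΛ2]
    | insert a E haE hmax ih =>
      rw [Finset.prod_insert haE, mul_comm]
      have hstep := theta_fibre (tauHat L x τ) hTn Y (ME E) (ME (insert a E)) ?_ ?_
        (2 ^ (x a).factorization 2) ?_ P ?_
      · rw [card_torsion_quot] at hstep
        exact hstep.trans (Nat.mul_le_mul_right _ ih)
      · intro g hg
        rw [hmem]
        intro i _
        exact (hmemT g).1 hg i
      · intro g hg hgE z hz hzE
        rw [hmem] at hg hz
        have hcase : ∀ g : ∀ i, L i, (∀ i, i ∉ insert a E → g i ∈ (τ i).range) → g ∉ ME E →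
            g a ∉ (τ a).range := by
          intro g hg hgE hga
          apply hgE
          rw [hmem]
          intro i hi
          by_cases hia : i = a
          · subst hia; exact hga
          · exact hg i (by simp [hia, hi])
        have hga := hcase g hg hgE
        have hza := hcase z hz hzE
        rw [hmem]
        intro i hi
        by_cases hia : i = a
        · subst hia
          rcases (Nat.dvd_prime Nat.prime_two).1 (hD i) with h | h
          · rw [Subgroup.index_eq_one] at h
            rw [h] at hga; simp at hga
          · have := (Subgroup.mul_mem_iff_of_index_two h (a := (g i)⁻¹) (b := z i))
            change (g i)⁻¹ * z i ∈ _
            rw [this]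
            simp only [inv_mem_iff]
            tauto
        · have hi' : i ∉ insert a E := by simp [hia, hi]
          exact (τ i).range.mul_mem ((τ i).range.inv_mem (hg i hi')) (hz i hi')
      · intro g hg t ht htY
        rw [hmem] at hg
        rw [hmemT] at ht
        funext i
        change (((g i)⁻¹ * t i * g i) * t i) ^ _ = t i ^ _
        have hcomm : ∀ u v, u ∈ (τ i).range → v ∈ (τ i).range → Commute u v := by
          rintro _ _ ⟨u, rfl⟩ ⟨v, rfl⟩
          change τ i u * τ i v = τ i v * τ i u
          rw [← map_mul, ← map_mul, mul_comm]
        by_cases hi : i ∈ insert a E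
        · have h1 : t i ^ (2 ^ (x a).factorization 2) = 1 := by
            obtain ⟨y, hy⟩ := ht i
            obtain ⟨k, hk⟩ := hY ⟨t, htY⟩
            have hk' : t ^ 2 ^ k = 1 := congrArg Subtype.val hk
            have hki : t i ^ 2 ^ k = 1 := congrFun hk' i
            have hxi : t i ^ (x i) = 1 := by
              rw [← hy, ← map_pow]
              have : y ^ x i = 1 := by
                have h := pow_card_eq_one' (x := y)
                rwa [Nat.card_eq_fintype_card, Fintype.card_multiplicative, ZMod.card] at h
              rw [this, map_one]
            have h2 := orderOf_dvd_of_pow_eq_one hki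
            have h3 := orderOf_dvd_of_pow_eq_one hxi
            obtain ⟨l, -, hl⟩ := (Nat.dvd_prime_pow Nat.prime_two).1 h2
            apply orderOf_dvd_iff_pow_eq_one.1
            rw [hl] at h3 ⊢
            apply pow_dvd_pow
            have h4 := (Nat.prime_two.pow_dvd_iff_le_factorization (hx i).ne').1 h3
            refine h4.trans ?_
            rcases Finset.mem_insert.1 hi with rfl | hiE
            · exact le_rfl
            · exact hmax i hiE
          rw [(hcomm _ _ ?_ (ht i)).mul_pow, h1, mul_comm 2, pow_mul (t i), h1]
          · have : (g i)⁻¹ * t i * g i = (g i)⁻¹ * t i * ((g i)⁻¹)⁻¹ := by simp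
            rw [this, conj_pow, h1]; simp
          · have := (hnorm i).conj_mem _ (ht i) (g i)⁻¹
            simpa using this
        · have h1 := hcomm _ _ (hg i hi) (ht i)
          have h2 : (g i)⁻¹ * t i * g i = t i := by
            rw [mul_assoc, ← h1.eq]; group
          rw [h2, ← pow_two, ← pow_mul]
      · intro g hg
        rw [hmem] at hg ⊢
        exact fun i hi => hg i (fun h => hi (Finset.mem_insert_of_mem h))
  have htop : ME D = ⊤ := by
    rw [eq_top_iff]
    intro g _
    rw [hmem]
    intro i hi
    rw [hB i hi]; trivial
  rw [← htop]
  exact key D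
end theta

theorem card_pi_subgroup {ι : Type*} [Fintype ι] (L : ι → Type*) [∀ i, Group (L i)]
    (T : ∀ i, Subgroup (L i)) :
    Nat.card (Subgroup.pi Set.univ T) = ∏ i, Nat.card (T i) := by
  rw [← Nat.card_pi]
  refine Nat.card_congr ⟨fun a i => ⟨a.1 i, a.2 i (Set.mem_univ i)⟩,
    fun a => ⟨fun i => (a i).1, fun i _ => (a i).2⟩, ?_, ?_⟩
  · intro a; rfl
  · intro a; rfl

theorem index_pi_subgroup {ι : Type*} [Fintype ι] (L : ι → Type*) [∀ i, Group (L i)]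
    [∀ i, Finite (L i)] (T : ∀ i, Subgroup (L i)) :
    (Subgroup.pi Set.univ T).index = ∏ i, (T i).index := by
  have h1 := Subgroup.card_mul_index (Subgroup.pi Set.univ T)
  have h0 : 0 < Nat.card (Subgroup.pi Set.univ T) := Nat.card_pos
  apply Nat.eq_of_mul_eq_mul_left h0
  rw [h1, card_pi_subgroup, ← Finset.prod_mul_distrib, Nat.card_pi]
  exact Finset.prod_congr rfl fun i _ => (Subgroup.card_mul_index (T i)).symm

theorem exists_sylow_SY {A M : Type*} [AddCommGroup A] [Group M] [Finite M]
    (τ : Multiplicative A →* M) (hT : τ.range.Normal) (k : ℕ) (hk : τ.range.index ∣ 2 ^ k)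
    (Λ : Subgroup M) : ∃ Y : Sylow 2 M, Λ ∈ SY τ Y (traceA τ Λ) ⊤ := by
  classical
  have : Fact (Nat.Prime 2) := ⟨Nat.prime_two⟩
  obtain ⟨S⟩ : Nonempty (Sylow 2 Λ) := inferInstance
  have hp : IsPGroup 2 ((S : Subgroup Λ).map Λ.subtype) := S.2.map _
  obtain ⟨Y, hY⟩ := hp.exists_le_sylow
  refine ⟨Y, le_top, rfl, ?_⟩
  have h1 : (τ.range.subgroupOf Λ ⊔ (S : Subgroup Λ)).index = 1 := by
    have h2 : (τ.range.subgroupOf Λ ⊔ (S : Subgroup Λ)).index ∣ 2 ^ k :=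
      ((Subgroup.index_dvd_of_le le_sup_left).trans
        (Subgroup.relIndex_dvd_index_of_normal τ.range Λ)).trans hk
    have h3 : (τ.range.subgroupOf Λ ⊔ (S : Subgroup Λ)).index ∣ (S : Subgroup Λ).index :=
      Subgroup.index_dvd_of_le le_sup_right
    obtain ⟨l, -, hl⟩ := (Nat.dvd_prime_pow Nat.prime_two).1 h2
    have h4 := S.not_dvd_index
    rcases Nat.eq_zero_or_pos l with h | h
    · rw [hl, h, pow_zero]
    · exact absurd (((dvd_pow_self 2 h.ne').trans (hl ▸ dvd_rfl)).trans h3) h4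
  rw [Subgroup.index_eq_one] at h1
  have h5 := congrArg (Subgroup.map Λ.subtype) h1
  rw [Subgroup.map_sup, Subgroup.subgroupOf_map_subtype, ← MonoidHom.range_eq_map,
    Subgroup.range_subtype] at h5
  conv_lhs => rw [← h5]
  refine sup_le ?_ ?_
  · rw [inf_comm]; exact le_sup_left
  · exact le_trans (le_inf (Subgroup.map_subtype_le _) hY) le_sup_right

theorem index_sup_two_mul {A : Type*} [AddCommGroup A] [Finite A] {ι : Type*} [Fintype ι]
    {x : ι → ℕ} (hA : IdxP A x) (P : AddSubgroup A) (n : ℕ) :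
    (P ⊔ mulSub A (2 * n)).index ≤ 2 ^ Fintype.card ι * (P ⊔ mulSub A n).index := by
  have hle : mulSub A (2 * n) ≤ mulSub A n := by rw [mul_comm]; exact mulSub_mul_le A n 2
  rw [index_split P (mulSub A n) _ hle, mul_comm]
  refine Nat.mul_le_mul_right _ ?_
  have h1 : (mulSub A (2 * n)).addSubgroupOf (mulSub A n) = (mulSub A 2).map
      (nsmulAddMonoidHom n : A →+ A).rangeRestrict := by
    ext ⟨z, hz⟩
    simp only [AddSubgroup.mem_addSubgroupOf, mem_mulSub, AddSubgroup.mem_map]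
    constructor
    · rintro ⟨y, hy⟩
      refine ⟨2 • y, ⟨y, rfl⟩, ?_⟩
      ext
      change n • (2 • y) = z
      rw [← mul_nsmul]; exact hy
    · rintro ⟨_, ⟨y, rfl⟩, hy⟩
      refine ⟨y, ?_⟩
      have := congrArg Subtype.val hy
      change n • (2 • y) = z at this
      rw [mul_nsmul]; exact this
  have h2 : ((mulSub A (2 * n)).addSubgroupOf (mulSub A n)).index ≤ 2 ^ Fintype.card ι := by
    rw [h1]
    have h3 := AddSubgroup.index_map_dvd (mulSub A 2)
      (f := (nsmulAddMonoidHom n : A →+ A).rangeRestrict) (AddMonoidHom.rangeRestrict_surjective _)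
    have h4 : (mulSub A 2).index ≤ 2 ^ Fintype.card ι := by
      rw [hA 2 two_pos]
      calc _ ≤ ∏ _i : ι, 2 := Finset.prod_le_prod' fun i _ => Nat.gcd_le_left _ two_pos
        _ = _ := by simp
    exact (Nat.le_of_dvd (Nat.pos_of_ne_zero AddSubgroup.index_ne_zero_of_finite) h3).trans h4
  refine le_trans ?_ h2
  exact Nat.le_of_dvd (Nat.pos_of_ne_zero AddSubgroup.index_ne_zero_of_finite)
    (AddSubgroup.index_dvd_of_le le_sup_right)

theorem prod_fac_bound {ι : Type*} (D : Finset ι) (f g : ι → ℕ) (C t : ℕ)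
    (h : ∀ j, f j ≤ 2 ^ C * g j) (hD : D.card ≤ t) :
    ((∏ j ∈ D, f j : ℕ) : ℝ) ≤ 2 ^ (C * t) * ∏ j ∈ D, (g j : ℝ) := by
  have h1 : (∏ j ∈ D, f j) ≤ 2 ^ (C * t) * ∏ j ∈ D, g j := by
    refine (Finset.prod_le_prod' fun j _ => h j).trans ?_
    rw [Finset.prod_mul_distrib, Finset.prod_const, ← pow_mul]
    gcongr
    norm_num
  exact_mod_cast h1

theorem le_pow_mul_div (X : ℝ) (hX : 0 ≤ X) (p I b : ℕ) (hp : 0 < p) (hI : p ≤ I) :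
    X ≤ (I : ℝ) ^ b * (X / (p : ℝ) ^ b) := by
  have h3 : (0 : ℝ) < (p : ℝ) ^ b := by positivity
  rw [mul_div_assoc', le_div_iff₀ h3, mul_comm]
  gcongr

theorem theta_total {ι : Type} [Fintype ι] [DecidableEq ι] (L : ι → Type) [∀ i, Group (L i)]
    [∀ i, Finite (L i)] (x : ι → ℕ) (τ : ∀ i, Multiplicative (ZMod (x i)) →* L i)
    (hx : ∀ i, 0 < x i) (hnorm : ∀ i, (τ i).range.Normal) (D : Finset ι)
    (hB : ∀ i, i ∉ D → (τ i).range = ⊤) (hD : ∀ i, (τ i).range.index ∣ 2) (I b : ℕ)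
    [Fintype (AddSubgroup (∀ i, ZMod (x i)))] :
    ({Λ : Subgroup (∀ i, L i) | Λ.index ≤ I}.ncard : ℝ) ≤
      Nat.card (∀ i, L i) * 2 ^ ((2 * Fintype.card ι + 1) * Fintype.card ι) * (I : ℝ) ^ b *
      ∑ P : AddSubgroup (∀ i, ZMod (x i)),
        (∏ j ∈ D, ((P ⊔ mulSub (∀ i, ZMod (x i)) (2 ^ (x j).factorization 2)).index : ℝ)) /
        (P.index : ℝ) ^ b := by
  classical
  have hNZ : ∀ i, NeZero (x i) := fun i => ⟨(hx i).ne'⟩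
  have : Fact (Nat.Prime 2) := ⟨Nat.prime_two⟩
  set M := ∀ i, L i with hM
  set A := ∀ i, ZMod (x i) with hA
  set t := Fintype.card ι with ht
  set T := tauHat L x τ with hTdef
  have hidx : IdxP A x := idxP_pi x hx
  have hTn : T.range.Normal := by
    rw [hTdef, tauHat_range]
    refine ⟨fun n hn g => ?_⟩
    rw [Subgroup.mem_pi] at hn ⊢
    exact fun i hi => (hnorm i).conj_mem _ (hn i hi) (g i)
  have hTdvd : T.range.index ∣ 2 ^ t := by
    rw [hTdef, tauHat_range, index_pi_subgroup, ht, ← Finset.card_univ, ← Finset.prod_const]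
    exact Finset.prod_dvd_prod_of_dvd _ _ fun i _ => hD i
  have hTle : T.range.index ≤ 2 ^ t := Nat.le_of_dvd (by positivity) hTdvd
  have hTpos : 0 < T.range.index := Nat.pos_of_ne_zero Subgroup.index_ne_zero_of_finite
  have : Fintype (Sylow 2 M) := Fintype.ofFinite _
  have : Fintype (Subgroup M) := Fintype.ofFinite _
  let PI : Finset (AddSubgroup A) := Finset.univ.filter fun P => P.index ≤ I
  have hcover : {Λ : Subgroup M | Λ.index ≤ I}.ncard ≤
      ∑ _Y : Sylow 2 M, ∑ P ∈ PI, ∏ j ∈ D, (1 + T.range.index *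
        (P ⊔ mulSub A (2 * 2 ^ (x j).factorization 2)).index) := by
    have h1 : {Λ : Subgroup M | Λ.index ≤ I} ⊆ ((Finset.univ : Finset (Sylow 2 M)).biUnion
        fun Y => PI.biUnion fun P => (SY T Y P ⊤).toFinset : Finset (Subgroup M)) := by
      intro Λ hΛ
      obtain ⟨Y, hY⟩ := exists_sylow_SY T hTn t hTdvd Λ
      simp only [Finset.coe_biUnion, Set.mem_iUnion]
      refine ⟨Y, by simp, traceA T Λ, ?_, by simpa using hY⟩
      simp only [PI, Finset.coe_filter, Finset.mem_univ, true_and, Set.mem_ofPred_eq]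
      refine le_trans ?_ hΛ
      have h2 : (traceA T Λ).index = (Λ.comap T).index := rfl
      rw [h2, Subgroup.index_comap]
      have h3 : Λ.relIndex ⊤ ≠ 0 := by
        rw [Subgroup.relIndex_top_right]; exact Subgroup.index_ne_zero_of_finite
      have := Subgroup.relIndex_le_of_le_right (le_top : T.range ≤ ⊤) h3
      rwa [Subgroup.relIndex_top_right] at this
    refine (Set.ncard_le_ncard h1 (Finset.finite_toSet _)).trans ?_
    rw [Set.ncard_coe_finset]
    refine Finset.card_biUnion_le.trans (Finset.sum_le_sum fun Y _ => ?_)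
    refine Finset.card_biUnion_le.trans (Finset.sum_le_sum fun P _ => ?_)
    rw [← Set.ncard_eq_toFinset_card']
    exact theta_count L x τ hx hnorm D hB hD Y Y.2 P
  have hfac : ∀ P : AddSubgroup A, ∀ j, 1 + T.range.index *
        (P ⊔ mulSub A (2 * 2 ^ (x j).factorization 2)).index ≤
        2 ^ (2 * t + 1) * (P ⊔ mulSub A (2 ^ (x j).factorization 2)).index := by
    intro P j
    have h1 := index_sup_two_mul hidx P (2 ^ (x j).factorization 2)
    have h2 : 0 < (P ⊔ mulSub A (2 * 2 ^ (x j).factorization 2)).index :=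
      Nat.pos_of_ne_zero AddSubgroup.index_ne_zero_of_finite
    calc 1 + T.range.index * (P ⊔ mulSub A (2 * 2 ^ (x j).factorization 2)).index
        ≤ 2 * (T.range.index * (P ⊔ mulSub A (2 * 2 ^ (x j).factorization 2)).index) := by
          have := Nat.mul_pos hTpos h2
          omega
      _ ≤ 2 * (2 ^ t * (2 ^ t * (P ⊔ mulSub A (2 ^ (x j).factorization 2)).index)) := by
          gcongr
      _ = _ := by ring
  have hDt : D.card ≤ t := Finset.card_le_univ D
  have hprod : ∀ P ∈ PI, ((∏ j ∈ D, (1 + T.range.index *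
        (P ⊔ mulSub A (2 * 2 ^ (x j).factorization 2)).index) : ℕ) : ℝ) ≤
      2 ^ ((2 * t + 1) * t) * ((I : ℝ) ^ b *
        ((∏ j ∈ D, ((P ⊔ mulSub A (2 ^ (x j).factorization 2)).index : ℝ)) / (P.index : ℝ) ^ b)) := by
    intro P hP
    have hPI : P.index ≤ I := (Finset.mem_filter.1 hP).2
    have hP0 : 0 < P.index := Nat.pos_of_ne_zero AddSubgroup.index_ne_zero_of_finite
    have h2 := prod_fac_bound D _ _ _ _ (hfac P) hDt
    refine h2.trans ?_
    exact mul_le_mul_of_nonneg_left (le_pow_mul_div _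
      (Finset.prod_nonneg fun j _ => Nat.cast_nonneg _) _ _ _ hP0 hPI) (by positivity)
  have hsyl : Nat.card (Sylow 2 M) ≤ Nat.card M := by
    obtain ⟨Y⟩ : Nonempty (Sylow 2 M) := inferInstance
    exact Nat.le_of_dvd Nat.card_pos (Y.card_dvd_index.trans (Subgroup.index_dvd_card _))
  have hcoverR : ({Λ : Subgroup M | Λ.index ≤ I}.ncard : ℝ) ≤
      ∑ _Y : Sylow 2 M, ∑ P ∈ PI, ((∏ j ∈ D, (1 + T.range.index *
        (P ⊔ mulSub A (2 * 2 ^ (x j).factorization 2)).index) : ℕ) : ℝ) := by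
    exact_mod_cast hcover
  refine hcoverR.trans ?_
  rw [Finset.sum_const, nsmul_eq_mul, Finset.card_univ, ← Nat.card_eq_fintype_card]
  have hsum : ∑ P ∈ PI, ((∏ j ∈ D, (1 + T.range.index *
        (P ⊔ mulSub A (2 * 2 ^ (x j).factorization 2)).index) : ℕ) : ℝ) ≤
      2 ^ ((2 * t + 1) * t) * ((I : ℝ) ^ b * ∑ P : AddSubgroup A,
        ((∏ j ∈ D, ((P ⊔ mulSub A (2 ^ (x j).factorization 2)).index : ℝ)) / (P.index : ℝ) ^ b)) := by
    refine (Finset.sum_le_sum hprod).trans ?_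
    rw [← Finset.mul_sum, ← Finset.mul_sum]
    gcongr
    exact Finset.filter_subset _ _
  have hsylR : (Nat.card (Sylow 2 M) : ℝ) ≤ Nat.card M := by exact_mod_cast hsyl
  calc _ ≤ (Nat.card M : ℝ) * (2 ^ ((2 * t + 1) * t) * ((I : ℝ) ^ b * ∑ P : AddSubgroup A,
        ((∏ j ∈ D, ((P ⊔ mulSub A (2 ^ (x j).factorization 2)).index : ℝ)) / (P.index : ℝ) ^ b))) := by
        gcongr
    _ = _ := by ring

/-- Shorthand for the special linear group of degree two. -/
abbrev SL2 (R : Type*) [CommRing R] := Matrix.SpecialLinearGroup (Fin 2) R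

/-- Upper elementary matrix. -/
def ua {R : Type*} [CommRing R] (a : R) : SL2 R := ⟨!![1, a; 0, 1], by simp⟩
/-- Lower elementary matrix. -/
def la {R : Type*} [CommRing R] (a : R) : SL2 R := ⟨!![1, 0; a, 1], by simp⟩

section elem
variable {R : Type*} [CommRing R]

@[simp] theorem ua_00 (a : R) : ua a 0 0 = 1 := rfl
@[simp] theorem ua_01 (a : R) : ua a 0 1 = a := rfl
@[simp] theorem ua_10 (a : R) : ua a 1 0 = 0 := rfl
@[simp] theorem ua_11 (a : R) : ua a 1 1 = 1 := rfl
@[simp] theorem la_00 (a : R) : la a 0 0 = 1 := rfl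
@[simp] theorem la_01 (a : R) : la a 0 1 = 0 := rfl
@[simp] theorem la_10 (a : R) : la a 1 0 = a := rfl
@[simp] theorem la_11 (a : R) : la a 1 1 = 1 := rfl

theorem sl2_mul (g h : SL2 R) (i j : Fin 2) : (g * h) i j = g i 0 * h 0 j + g i 1 * h 1 j := by
  rw [Matrix.SpecialLinearGroup.coe_mul, Matrix.mul_apply, Fin.sum_univ_two]

theorem sl2_det (g : SL2 R) : g 0 0 * g 1 1 - g 0 1 * g 1 0 = 1 := by
  have := g.2
  rwa [Matrix.det_fin_two] at this

theorem sl2_inv_00 (g : SL2 R) : g⁻¹ 0 0 = g 1 1 := by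
  simp [Matrix.SpecialLinearGroup.SL2_inv_expl]
theorem sl2_inv_01 (g : SL2 R) : g⁻¹ 0 1 = - g 0 1 := by
  simp [Matrix.SpecialLinearGroup.SL2_inv_expl]
theorem sl2_inv_10 (g : SL2 R) : g⁻¹ 1 0 = - g 1 0 := by
  simp [Matrix.SpecialLinearGroup.SL2_inv_expl]
theorem sl2_inv_11 (g : SL2 R) : g⁻¹ 1 1 = g 0 0 := by
  simp [Matrix.SpecialLinearGroup.SL2_inv_expl]

theorem sl2_one_00 : (1 : SL2 R) 0 0 = 1 := rfl
theorem sl2_one_01 : (1 : SL2 R) 0 1 = 0 := rfl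
theorem sl2_one_10 : (1 : SL2 R) 1 0 = 0 := rfl
theorem sl2_one_11 : (1 : SL2 R) 1 1 = 1 := rfl

theorem sl2_ext {g h : SL2 R} (h00 : g 0 0 = h 0 0) (h01 : g 0 1 = h 0 1) (h10 : g 1 0 = h 1 0)
    (h11 : g 1 1 = h 1 1) : g = h := by
  apply Matrix.SpecialLinearGroup.ext
  intro i j
  fin_cases i <;> fin_cases j <;> assumption

theorem ua_mul (a b : R) : ua a * ua b = ua (a + b) := by
  apply sl2_ext <;> simp [sl2_mul, add_comm]
theorem la_mul (a b : R) : la a * la b = la (a + b) := by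
  apply sl2_ext <;> simp [sl2_mul, add_comm]
theorem ua_zero : ua (0 : R) = 1 := by apply sl2_ext <;> rfl
theorem la_zero : la (0 : R) = 1 := by apply sl2_ext <;> rfl
theorem ua_inv (a : R) : (ua a)⁻¹ = ua (-a) := by
  rw [inv_eq_iff_mul_eq_one, ua_mul, add_neg_cancel, ua_zero]
theorem la_inv (a : R) : (la a)⁻¹ = la (-a) := by
  rw [inv_eq_iff_mul_eq_one, la_mul, add_neg_cancel, la_zero]
theorem ua_pow (a : R) (n : ℕ) : ua a ^ n = ua (n * a) := by
  induction n with
  | zero => simp [ua_zero]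
  | succ n ih => rw [pow_succ, ih, ua_mul]; congr 1; push_cast; ring
theorem la_pow (a : R) (n : ℕ) : la a ^ n = la (n * a) := by
  induction n with
  | zero => simp [la_zero]
  | succ n ih => rw [pow_succ, ih, la_mul]; congr 1; push_cast; ring

theorem sl2_map {S : Type*} [CommRing S] (f : R →+* S) (g : SL2 R) (i j : Fin 2) :
    Matrix.SpecialLinearGroup.map f g i j = f (g i j) := rfl

theorem map_ua {S : Type*} [CommRing S] (f : R →+* S) (a : R) :
    Matrix.SpecialLinearGroup.map f (ua a) = ua (f a) := by
  apply sl2_ext <;> simp [sl2_map]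
theorem map_la {S : Type*} [CommRing S] (f : R →+* S) (a : R) :
    Matrix.SpecialLinearGroup.map f (la a) = la (f a) := by
  apply sl2_ext <;> simp [sl2_map]

theorem elem_decomp (g : SL2 R) (s t w : R) (ha : g 0 0 = 1 + s * t) (hw : w * (1 + s * t) = 1) :
    g = la ((g 1 0 - t) * w) * ua s * la t * ua ((g 0 1 - s) * w) := by
  have hd := sl2_det g
  rw [ha] at hd
  have h11 : g 1 1 = w * (1 + g 0 1 * g 1 0) := by linear_combination w * hd - g 1 1 * hw
  apply sl2_ext
  · simp [sl2_mul]; rw [ha]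
  · simp [sl2_mul]; linear_combination (- g 0 1 + s) * hw
  · simp [sl2_mul]; linear_combination (- g 1 0 + t) * hw
  · simp [sl2_mul]; rw [h11]
    linear_combination (1 - w * (g 0 1 - s) * (g 1 0 - t) ) * hw

/-- A subgroup containing all elementary matrices over a local ring is everything. -/
theorem eq_top_of_elem [IsLocalRing R] (H : Subgroup (SL2 R)) (hu : ∀ a, ua a ∈ H)
    (hl : ∀ a, la a ∈ H) : H = ⊤ := by
  have key : ∀ g : SL2 R, IsUnit (g 0 0) → g ∈ H := by
    intro g hg
    obtain ⟨w, hw⟩ := hg.exists_left_inv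
    rw [elem_decomp g (g 0 0 - 1) 1 w (by ring) (by linear_combination hw)]
    exact H.mul_mem (H.mul_mem (H.mul_mem (hl _) (hu _)) (hl _)) (hu _)
  rw [eq_top_iff]
  intro g _
  by_cases h : IsUnit (g 0 0)
  · exact key g h
  · have h2 : IsUnit ((ua 1 * g : SL2 R) 0 0) := by
      simp only [sl2_mul, ua_00, ua_01, one_mul]
      by_contra h3
      have hc : ¬ IsUnit (g 1 0) → False := by
        intro h4
        have h1 : g 0 0 * g 1 1 + (- g 0 1) * g 1 0 = 1 := by linear_combination sl2_det g
        have := IsLocalRing.nonunits_add (R := R) (a := g 0 0 * g 1 1) (b := (- g 0 1) * g 1 0)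
          (fun h' => h (isUnit_of_mul_isUnit_left h')) (fun h' => h4 (isUnit_of_mul_isUnit_right h'))
        rw [h1] at this
        exact this isUnit_one
      apply hc
      intro h4
      have := IsLocalRing.nonunits_add (R := R) (a := g 0 0 + g 1 0) (b := - g 0 0) h3
        (fun h' => h (by simpa using h'))
      apply this
      simpa using h4
    have := key _ h2
    have h5 := H.mul_mem (H.inv_mem (hu 1)) this
    rwa [inv_mul_cancel_left] at h5

end elem

section zmod
variable {p : ℕ}

/-- Reduction `ℤ/p^e → ℤ/p`. -/
noncomputable def redp (p e : ℕ) [NeZero e] : ZMod (p ^ e) →+* ZMod p :=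
  ZMod.castHom (dvd_pow_self p (NeZero.ne e)) (ZMod p)

theorem redp_natCast (p e : ℕ) [NeZero e] (n : ℕ) : redp p e (n : ZMod (p ^ e)) = n := by
  simp [redp]

theorem isUnit_iff_redp (hp : p.Prime) (e : ℕ) [NeZero e] (a : ZMod (p ^ e)) :
    IsUnit a ↔ redp p e a ≠ 0 := by
  have : NeZero (p ^ e) := ⟨(pow_pos hp.pos _).ne'⟩
  obtain ⟨n, rfl⟩ : ∃ n : ℕ, a = n := ⟨a.val, (ZMod.natCast_zmod_val a).symm⟩
  rw [redp_natCast, ZMod.isUnit_iff_coprime, Ne, ZMod.natCast_eq_zero_iff,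
    Nat.coprime_pow_right_iff (Nat.pos_of_ne_zero (NeZero.ne e)), Nat.coprime_comm,
    Nat.Prime.coprime_iff_not_dvd hp]

theorem isLocalRing_zmod (hp : p.Prime) (e : ℕ) [NeZero e] : IsLocalRing (ZMod (p ^ e)) := by
  have : Fact (1 < p ^ e) := ⟨Nat.one_lt_pow (NeZero.ne e) hp.one_lt⟩
  apply IsLocalRing.of_nonunits_add
  intro a b ha hb
  rw [mem_nonunits_iff, isUnit_iff_redp hp, not_not] at *
  rw [map_add, ha, hb, add_zero]

/-- elements reducing to zero are multiples of `p` -/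
theorem redp_eq_zero_iff (hp : p.Prime) (e : ℕ) [NeZero e] (a : ZMod (p ^ e)) :
    redp p e a = 0 ↔ (p : ZMod (p ^ e)) ∣ a := by
  have : NeZero (p ^ e) := ⟨(pow_pos hp.pos _).ne'⟩
  constructor
  · intro h
    obtain ⟨n, rfl⟩ : ∃ n : ℕ, a = n := ⟨a.val, (ZMod.natCast_zmod_val a).symm⟩
    rw [redp_natCast, ZMod.natCast_eq_zero_iff] at h
    exact_mod_cast Nat.cast_dvd_cast (α := ZMod (p ^ e)) h
  · rintro ⟨b, rfl⟩
    simp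

/-- every element is `p^v * unit` -/
theorem exists_val (hp : p.Prime) (e : ℕ) [NeZero e] (a : ZMod (p ^ e)) :
    ∃ v ≤ e, ∃ w, IsUnit w ∧ a = (p : ZMod (p ^ e)) ^ v * w := by
  have : NeZero (p ^ e) := ⟨(pow_pos hp.pos _).ne'⟩
  by_cases h0 : a = 0
  · refine ⟨e, le_rfl, 1, isUnit_one, ?_⟩
    rw [h0, mul_one, ← Nat.cast_pow, ZMod.natCast_self]
  have hv : a.val ≠ 0 := by rwa [Ne, ZMod.val_eq_zero]
  obtain ⟨v, n, hn, hvn⟩ := Nat.exists_eq_pow_mul_and_not_dvd hv p hp.ne_one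
  refine ⟨v, ?_, n, ?_, ?_⟩
  · have h1 := ZMod.val_lt a
    have h2 : p ^ v ≤ a.val := Nat.le_of_dvd (Nat.pos_of_ne_zero hv) ⟨n, hvn⟩
    exact ((Nat.pow_lt_pow_iff_right hp.one_lt).1 (h2.trans_lt h1)).le
  · rw [isUnit_iff_redp hp, redp_natCast, Ne, ZMod.natCast_eq_zero_iff]; exact hn
  · rw [← ZMod.natCast_zmod_val a, hvn]; push_cast; ring

theorem p_pow_eq_zero_iff (hp : p.Prime) (e v : ℕ) : (p : ZMod (p ^ e)) ^ v = 0 ↔ e ≤ v := by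
  rw [← Nat.cast_pow, ZMod.natCast_eq_zero_iff, Nat.pow_dvd_pow_iff_le_right hp.one_lt]

end zmod

/-- congruent to one modulo `p^k` -/
def CongOne {q f : ℕ} (k : ℕ) (g : SL2 (ZMod (q ^ f))) : Prop :=
  (q : ZMod (q ^ f)) ^ k ∣ g 0 0 - 1 ∧ (q : ZMod (q ^ f)) ^ k ∣ g 0 1 ∧
    (q : ZMod (q ^ f)) ^ k ∣ g 1 0 ∧ (q : ZMod (q ^ f)) ^ k ∣ g 1 1 - 1

theorem mem_gamma_iff (m : ℕ) (g : SL2 ℤ) :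
    g ∈ (Matrix.SpecialLinearGroup.map (n := Fin 2) (Int.castRingHom (ZMod m))).ker ↔
      ((g 0 0 - 1 : ℤ) : ZMod m) = 0 ∧ ((g 0 1 : ℤ) : ZMod m) = 0 ∧ ((g 1 0 : ℤ) : ZMod m) = 0 ∧
      ((g 1 1 - 1 : ℤ) : ZMod m) = 0 := by
  rw [MonoidHom.mem_ker]
  constructor
  · intro h
    have h2 : ∀ i j, (Int.castRingHom (ZMod m)) (g i j) = (1 : SL2 (ZMod m)) i j := by
      intro i j; rw [← sl2_map, h]
    refine ⟨?_, ?_, ?_, ?_⟩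
    · have := h2 0 0
      rw [sl2_one_00] at this; simpa [sub_eq_zero] using this
    · have := h2 0 1
      rw [sl2_one_01] at this; simpa [sub_eq_zero] using this
    · have := h2 1 0
      rw [sl2_one_10] at this; simpa [sub_eq_zero] using this
    · have := h2 1 1
      rw [sl2_one_11] at this; simpa [sub_eq_zero] using this
  · rintro ⟨h1, h2, h3, h4⟩
    apply sl2_ext
    · rw [sl2_map, sl2_one_00]; simpa [sub_eq_zero] using h1
    · rw [sl2_map, sl2_one_01]; simpa [sub_eq_zero] using h2
    · rw [sl2_map, sl2_one_10]; simpa [sub_eq_zero] using h3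
    · rw [sl2_map, sl2_one_11]; simpa [sub_eq_zero] using h4

section prodSL
variable {ι : Type*} [Fintype ι] [DecidableEq ι] (p : ι → ℕ) (e : ι → ℕ)

/-- Reduction of `SL₂(ℤ)` to a product of `SL₂(ℤ/p^e)`. -/
def redAll : SL2 ℤ →* ∀ i, SL2 (ZMod (p i ^ e i)) :=
  MonoidHom.pi fun i => Matrix.SpecialLinearGroup.map (Int.castRingHom (ZMod (p i ^ e i)))

theorem redAll_apply (g : SL2 ℤ) (i : ι) (a b : Fin 2) :
    redAll p e g i a b = ((g a b : ℤ) : ZMod (p i ^ e i)) := rfl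

variable {p} {e}

theorem pairwise_coprime_pe (hp : ∀ i, (p i).Prime) (hinj : Function.Injective p) : Pairwise fun i j => (p i ^ e i).Coprime (p j ^ e j) := by
  intro i j hij
  exact Nat.Coprime.pow _ _ ((Nat.coprime_primes (hp i) (hp j)).2 fun h => hij (hinj h))

theorem intCast_prod_zero_iff (hp : ∀ i, (p i).Prime) (hinj : Function.Injective p) (z : ℤ) :
    ((z : ℤ) : ZMod (∏ i, p i ^ e i)) = 0 ↔ ∀ i, ((z : ℤ) : ZMod (p i ^ e i)) = 0 := by
  simp only [ZMod.intCast_zmod_eq_zero_iff_dvd]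
  constructor
  · intro h i
    exact (Int.natCast_dvd_natCast.2 (Finset.dvd_prod_of_mem _ (Finset.mem_univ i))).trans h
  · intro h
    rw [Nat.cast_prod]
    apply Finset.prod_dvd_of_coprime
    · intro i _ j _ hij
      exact Nat.isCoprime_iff_coprime.2 (pairwise_coprime_pe hp hinj hij)
    · intro i _; exact h i

theorem redAll_ker (hp : ∀ i, (p i).Prime) (hinj : Function.Injective p) : (redAll p e).ker =
    (Matrix.SpecialLinearGroup.map (n := Fin 2) (Int.castRingHom (ZMod (∏ i, p i ^ e i)))).ker := by
  ext g
  rw [mem_gamma_iff]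
  simp only [intCast_prod_zero_iff hp hinj, ← forall_and]
  rw [MonoidHom.mem_ker, funext_iff]
  apply forall_congr'
  intro i
  rw [← mem_gamma_iff, MonoidHom.mem_ker]
  rfl

theorem exists_int_single (hp : ∀ i, (p i).Prime) (hinj : Function.Injective p) (i : ι) (a : ZMod (p i ^ e i)) :
    ∃ x : ℤ, (x : ZMod (p i ^ e i)) = a ∧ ∀ j ≠ i, (x : ZMod (p j ^ e j)) = 0 := by
  set M := ∏ j ∈ Finset.univ.erase i, p j ^ e j with hM
  have hcop : M.Coprime (p i ^ e i) := by
    rw [hM]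
    apply Nat.Coprime.prod_left
    intro j hj
    exact pairwise_coprime_pe hp hinj (Finset.ne_of_mem_erase hj)
  have hu := (ZMod.isUnit_iff_coprime M (p i ^ e i)).2 hcop
  obtain ⟨w, hw⟩ := hu.exists_right_inv
  have : NeZero (p i ^ e i) := ⟨(pow_pos (hp i).pos _).ne'⟩
  refine ⟨M * (w * a).val, ?_, ?_⟩
  · push_cast
    rw [ZMod.natCast_zmod_val, ← mul_assoc, hw, one_mul]
  · intro j hj
    have : (M : ZMod (p j ^ e j)) = 0 := by
      rw [ZMod.natCast_eq_zero_iff]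
      exact Finset.dvd_prod_of_mem _ (Finset.mem_erase.2 ⟨hj, Finset.mem_univ _⟩)
    push_cast
    rw [this, zero_mul]

theorem redAll_surjective (hp : ∀ i, (p i).Prime) (hinj : Function.Injective p) [∀ i, NeZero (e i)] : Function.Surjective (redAll p e) := by
  rw [← MonoidHom.range_eq_top, eq_top_iff]
  intro g _
  apply Subgroup.pi_mem_of_mulSingle_mem
  intro i
  have := isLocalRing_zmod (hp i) (e i)
  have htop : (redAll p e).range.comap (MonoidHom.mulSingle _ i) = ⊤ := by
    apply eq_top_of_elem
    · intro a
      obtain ⟨x, hx, hx'⟩ := exists_int_single (e := e) hp hinj i a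
      refine ⟨ua x, ?_⟩
      funext j
      change Matrix.SpecialLinearGroup.map (Int.castRingHom (ZMod (p j ^ e j))) (ua x) = _
      rw [map_ua]
      by_cases h : j = i
      · subst h; simp [hx]
      · simp [h, hx' j h, ua_zero]
    · intro a
      obtain ⟨x, hx, hx'⟩ := exists_int_single (e := e) hp hinj i a
      refine ⟨la x, ?_⟩
      funext j
      change Matrix.SpecialLinearGroup.map (Int.castRingHom (ZMod (p j ^ e j))) (la x) = _
      rw [map_la]
      by_cases h : j = i
      · subst h; simp [hx]
      · simp [h, hx' j h, la_zero]
  have h2 : g i ∈ (redAll p e).range.comap (MonoidHom.mulSingle (fun i => SL2 (ZMod (p i ^ e i))) i) := by rw [htop]; trivial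
  exact h2

theorem minimal_level (hp : ∀ i, (p i).Prime) (hinj : Function.Injective p) [∀ i, NeZero (e i)] (H : Subgroup (SL2 ℤ)) (m : ℕ)
    (hm : m = ∏ i, p i ^ e i)
    (hmin : ∀ m', 0 < m' → m' < m → ¬
      (Matrix.SpecialLinearGroup.map (n := Fin 2) (Int.castRingHom (ZMod m'))).ker ≤ H)
    (hH : (Matrix.SpecialLinearGroup.map (n := Fin 2) (Int.castRingHom (ZMod m))).ker ≤ H) (i : ι) :
    ¬ ∀ g : SL2 (ZMod (p i ^ e i)), CongOne (e i - 1) g →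
      Pi.mulSingle i g ∈ H.map (redAll p e) := by
  intro hall
  have hei : e i = e i - 1 + 1 := by have := NeZero.pos (e i); omega
  obtain ⟨M, hM⟩ : ∃ M, M = p i ^ (e i - 1) * ∏ j ∈ Finset.univ.erase i, p j ^ e j := ⟨_, rfl⟩
  have hmM : m = p i * M := by
    rw [hm, ← Finset.mul_prod_erase _ _ (Finset.mem_univ i), hM, ← mul_assoc]
    congr 1
    rw [← pow_succ', ← hei]
  have hmpos : 0 < m := by
    rw [hm]; exact Finset.prod_pos fun j _ => pow_pos (hp j).pos _
  have hMpos : 0 < M := Nat.pos_of_ne_zero (by rintro rfl; omega)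
  apply hmin M hMpos
  · rw [hmM]; have := (hp i).one_lt; nlinarith
  intro γ hγ
  rw [mem_gamma_iff] at hγ
  simp only [ZMod.intCast_zmod_eq_zero_iff_dvd] at hγ
  have hker : redAll p e γ ∈ H.map (redAll p e) := by
    have h1 : redAll p e γ = Pi.mulSingle i (redAll p e γ i) := by
      funext j
      by_cases h : j = i
      · subst h; simp
      · rw [Pi.mulSingle_eq_of_ne h]
        have hd : ((p j ^ e j : ℕ) : ℤ) ∣ M := by
          rw [Int.natCast_dvd_natCast, hM]
          exact Dvd.dvd.mul_left
            (Finset.dvd_prod_of_mem _ (Finset.mem_erase.2 ⟨h, Finset.mem_univ _⟩)) _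
        have h3 : γ ∈ (Matrix.SpecialLinearGroup.map (n := Fin 2)
            (Int.castRingHom (ZMod (p j ^ e j)))).ker := by
          rw [mem_gamma_iff]
          simp only [ZMod.intCast_zmod_eq_zero_iff_dvd]
          exact ⟨hd.trans hγ.1, hd.trans hγ.2.1, hd.trans hγ.2.2.1, hd.trans hγ.2.2.2⟩
        exact h3
    rw [h1]
    apply hall
    have hd : ((p i ^ (e i - 1) : ℕ) : ℤ) ∣ M := by
      rw [Int.natCast_dvd_natCast, hM]; exact dvd_mul_right _ _
    have hc : ∀ z : ℤ, (M : ℤ) ∣ z → (p i : ZMod (p i ^ e i)) ^ (e i - 1) ∣ (z : ZMod (p i ^ e i)) := by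
      intro z hz
      have := map_dvd (Int.castRingHom (ZMod (p i ^ e i))) (hd.trans hz)
      simpa using this
    refine ⟨?_, ?_, ?_, ?_⟩
    · have := hc _ hγ.1; push_cast at this; exact this
    · exact hc _ hγ.2.1
    · exact hc _ hγ.2.2.1
    · have := hc _ hγ.2.2.2; push_cast at this; exact this
  obtain ⟨h, hh, hhe⟩ := hker
  have h4 : h⁻¹ * γ ∈ (redAll p e).ker := by
    rw [MonoidHom.mem_ker, map_mul, map_inv, hhe, inv_mul_cancel]
  rw [redAll_ker hp hinj, ← hm] at h4
  have := H.mul_mem hh (hH h4)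
  rwa [mul_inv_cancel_left] at this

end prodSL

theorem pgroup_pow_mem {G : Type*} [Group G] [Finite G] {p : ℕ} (hp : p.Prime) (K A : Subgroup G)
    (hK : IsPGroup p K) (a : ℕ) (hA : A.relIndex K ≤ p ^ a) (x : G) (hx : x ∈ K) :
    x ^ p ^ a ∈ A := by
  have : (A.subgroupOf K).FiniteIndex := inferInstance
  obtain ⟨n, hn0, hn, hmem⟩ := Subgroup.exists_pow_mem_of_index_ne_zero (H := A.subgroupOf K)
    (Subgroup.FiniteIndex.index_ne_zero) ⟨x, hx⟩
  have hxn : x ^ n ∈ A := by simpa [Subgroup.mem_subgroupOf] using hmem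
  obtain ⟨s, n', hn', rfl⟩ := Nat.exists_eq_pow_mul_and_not_dvd hn0.ne' p hp.ne_one
  have hs : s ≤ a := by
    rw [← Nat.pow_le_pow_iff_right hp.one_lt]
    refine le_trans ?_ (hn.trans hA)
    exact Nat.le_mul_of_pos_right _ (Nat.pos_of_ne_zero (by rintro rfl; simp at hn'))
  obtain ⟨k, hk⟩ := hK ⟨x, hx⟩
  have hk' : x ^ p ^ k = 1 := by simpa [Subtype.ext_iff] using hk
  have h1 : x ^ p ^ s ∈ A := by
    rw [pow_mul] at hxn
    have hcop : (p ^ k).Coprime n' := Nat.Coprime.pow_left _ ((Nat.Prime.coprime_iff_not_dvd hp).2 hn')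
    have h2 : (x ^ p ^ s) ^ p ^ k = 1 := by rw [← pow_mul, mul_comm, pow_mul, hk', one_pow]
    have hco : (orderOf (x ^ p ^ s)).Coprime n' :=
      Nat.Coprime.coprime_dvd_left (orderOf_dvd_of_pow_eq_one h2) hcop
    obtain ⟨m, hm⟩ := exists_pow_eq_self_of_coprime hco.symm
    rw [← hm]
    exact A.pow_mem hxn m
  obtain ⟨r, rfl⟩ := Nat.exists_eq_add_of_le hs
  rw [pow_add, pow_mul]
  exact A.pow_mem h1 _

/-- Kernel of reduction modulo `p`. -/
noncomputable def Kp (p e : ℕ) [NeZero e] : Subgroup (SL2 (ZMod (p ^ e))) :=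
  (Matrix.SpecialLinearGroup.map (n := Fin 2) (redp p e)).ker

instance (p e : ℕ) [NeZero e] : (Kp p e).Normal := by unfold Kp; infer_instance

theorem mem_Kp {p : ℕ} (hp : p.Prime) (e : ℕ) [NeZero e] (g : SL2 (ZMod (p ^ e))) :
    g ∈ Kp p e ↔ CongOne 1 g := by
  unfold Kp CongOne
  simp only [pow_one, ← redp_eq_zero_iff hp, map_sub, map_one, sub_eq_zero]
  rw [MonoidHom.mem_ker]
  constructor
  · intro h
    simp only [← sl2_map, h]
    exact ⟨rfl, rfl, rfl, rfl⟩
  · rintro ⟨h1, h2, h3, h4⟩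
    apply sl2_ext <;> assumption

/-- `CongOne k` defines a subgroup -/
def Kk (p e k : ℕ) : Subgroup (SL2 (ZMod (p ^ e))) where
  carrier := {g | CongOne k g}
  one_mem' := by
    refine ⟨?_, ?_, ?_, ?_⟩
    · simp [sl2_one_00]
    · simp [sl2_one_01]
    · simp [sl2_one_10]
    · simp [sl2_one_11]
  mul_mem' := by
    rintro g h ⟨⟨a, ha⟩, ⟨b, hb⟩, ⟨c, hc⟩, ⟨d, hd⟩⟩ ⟨⟨a', ha'⟩, ⟨b', hb'⟩, ⟨c', hc'⟩, ⟨d', hd'⟩⟩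
    rw [sub_eq_iff_eq_add] at ha hd ha' hd'
    refine ⟨?_, ?_, ?_, ?_⟩
    · rw [sl2_mul, ha, ha', hb, hc']; exact ⟨a + a' + p ^ k * a * a' + p ^ k * b * c', by ring⟩
    · rw [sl2_mul, ha, hb, hb', hd']; exact ⟨b + b' + p ^ k * a * b' + p ^ k * b * d', by ring⟩
    · rw [sl2_mul, hc, hd, hc', ha']; exact ⟨c + c' + p ^ k * c * a' + p ^ k * d * c', by ring⟩
    · rw [sl2_mul, hc, hd, hb', hd']; exact ⟨d + d' + p ^ k * c * b' + p ^ k * d * d', by ring⟩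
  inv_mem' := by
    rintro g ⟨ha, hb, hc, hd⟩
    refine ⟨?_, ?_, ?_, ?_⟩
    · rw [sl2_inv_00]; exact hd
    · rw [sl2_inv_01]; exact (dvd_neg).2 hb
    · rw [sl2_inv_10]; exact (dvd_neg).2 hc
    · rw [sl2_inv_11]; exact ha

theorem mem_Kk {p e k : ℕ} {g : SL2 (ZMod (p ^ e))} : g ∈ Kk p e k ↔ CongOne k g := Iff.rfl

theorem CongOne.pow {p e k : ℕ} {g : SL2 (ZMod (p ^ e))} (h : CongOne k g) (hk : 1 ≤ k) :
    CongOne (k + 1) (g ^ p) := by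
  -- entries of `g^n`: `1 + n(g-1)` modulo `p^(2k)`
  have key : ∀ n : ℕ, ∃ A B C D : ZMod (p ^ e),
      (g ^ n) 0 0 = 1 + n * (g 0 0 - 1) + p ^ (2 * k) * A ∧
      (g ^ n) 0 1 = n * g 0 1 + p ^ (2 * k) * B ∧
      (g ^ n) 1 0 = n * g 1 0 + p ^ (2 * k) * C ∧
      (g ^ n) 1 1 = 1 + n * (g 1 1 - 1) + p ^ (2 * k) * D := by
    obtain ⟨⟨a, ha⟩, ⟨b, hb⟩, ⟨c, hc⟩, ⟨d, hd⟩⟩ := h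
    have hg0 : g 0 0 = p ^ k * a + 1 := by rw [← ha]; ring
    have hg1 : g 1 1 = p ^ k * d + 1 := by rw [← hd]; ring
    intro n
    induction n with
    | zero =>
      refine ⟨0, 0, 0, 0, ?_, ?_, ?_, ?_⟩
      · simp [sl2_one_00]
      · simp [sl2_one_01]
      · simp [sl2_one_10]
      · simp [sl2_one_11]
    | succ n ih =>
      obtain ⟨A, B, C, D, hA, hB, hC, hD⟩ := ih
      rw [pow_succ, sl2_mul, sl2_mul, sl2_mul, sl2_mul, hA, hB, hC, hD, hg0, hg1, hb, hc]
      push_cast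
      refine ⟨n * a * a + A * (p ^ k * a + 1) + n * b * c + B * p ^ k * c,
        n * a * b + A * p ^ k * b + n * b * d + B * (p ^ k * d + 1),
        n * c * a + C * (p ^ k * a + 1) + n * d * c + D * p ^ k * c,
        n * c * b + C * p ^ k * b + n * d * d + D * (p ^ k * d + 1), ?_, ?_, ?_, ?_⟩ <;> ring
  obtain ⟨A, B, C, D, hA, hB, hC, hD⟩ := key p
  obtain ⟨⟨a, ha⟩, ⟨b, hb⟩, ⟨c, hc⟩, ⟨d, hd⟩⟩ := h
  obtain ⟨r, rfl⟩ := Nat.exists_eq_add_of_le hk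
  refine ⟨?_, ?_, ?_, ?_⟩
  · rw [hA, ha]; exact ⟨a + p ^ r * A, by ring⟩
  · rw [hB, hb]; exact ⟨b + p ^ r * B, by ring⟩
  · rw [hC, hc]; exact ⟨c + p ^ r * C, by ring⟩
  · rw [hD, hd]; exact ⟨d + p ^ r * D, by ring⟩

theorem CongOne.pow_pow {p e k : ℕ} {g : SL2 (ZMod (p ^ e))} (h : CongOne k g) (hk : 1 ≤ k) (j : ℕ) :
    CongOne (k + j) (g ^ p ^ j) := by
  induction j with
  | zero => simpa using h
  | succ j ih =>
    rw [pow_succ, pow_mul, ← add_assoc]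
    exact ih.pow (by omega)

theorem CongOne.eq_one {p e k : ℕ} {g : SL2 (ZMod (p ^ e))} (h : CongOne k g) (hk : e ≤ k) :
    g = 1 := by
  have h0 : (p : ZMod (p ^ e)) ^ k = 0 := by
    obtain ⟨r, rfl⟩ := Nat.exists_eq_add_of_le hk
    rw [pow_add, ← Nat.cast_pow, ZMod.natCast_self, zero_mul]
  unfold CongOne at h
  simp only [h0, zero_dvd_iff, sub_eq_zero] at h
  exact sl2_ext h.1 h.2.1 h.2.2.1 h.2.2.2

theorem isPGroup_Kp {p : ℕ} (hp : p.Prime) (e : ℕ) [NeZero e] : IsPGroup p (Kp p e) := by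
  rintro ⟨g, hg⟩
  refine ⟨e, ?_⟩
  rw [mem_Kp hp] at hg
  ext1
  simpa using (hg.pow_pow le_rfl e).eq_one (by omega)

instance finite_SL2 (R : Type*) [CommRing R] [Finite R] : Finite (SL2 R) :=
  Finite.of_injective (fun g : SL2 R => (g : Matrix (Fin 2) (Fin 2) R)) Subtype.val_injective

theorem level_mem {p : ℕ} (hp : p.Prime) (e : ℕ) [NeZero e] (A : Subgroup (SL2 (ZMod (p ^ e))))
    (a : ℕ) (h : A.relIndex (Kp p e) ≤ p ^ a) (g : SL2 (ZMod (p ^ e))) (hg : CongOne (2 * a + 2) g) :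
    g ∈ A := by
  have : NeZero (p ^ e) := ⟨(pow_pos hp.pos _).ne'⟩
  have hu1 : ua (p : ZMod (p ^ e)) ∈ Kp p e := by
    rw [mem_Kp hp]; refine ⟨?_, ?_, ?_, ?_⟩ <;> simp
  have hl1 : la (p : ZMod (p ^ e)) ∈ Kp p e := by
    rw [mem_Kp hp]; refine ⟨?_, ?_, ?_, ?_⟩ <;> simp
  obtain ⟨P, hP⟩ : ∃ P : ZMod (p ^ e), P = (p : ZMod (p ^ e)) ^ (a + 1) := ⟨_, rfl⟩
  have hu2 := pgroup_pow_mem hp (Kp p e) A (isPGroup_Kp hp e) a h _ hu1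
  have hl2 := pgroup_pow_mem hp (Kp p e) A (isPGroup_Kp hp e) a h _ hl1
  rw [ua_pow, Nat.cast_pow, ← pow_succ, ← hP] at hu2
  rw [la_pow, Nat.cast_pow, ← pow_succ, ← hP] at hl2
  have hu : ∀ y, ua (P * y) ∈ A := by
    intro y
    have := A.pow_mem hu2 y.val
    rwa [ua_pow, ZMod.natCast_zmod_val, mul_comm] at this
  have hl : ∀ y, la (P * y) ∈ A := by
    intro y
    have := A.pow_mem hl2 y.val
    rwa [la_pow, ZMod.natCast_zmod_val, mul_comm] at this
  have hPP : (p : ZMod (p ^ e)) ^ (2 * a + 2) = P * P := by rw [hP]; ring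
  obtain ⟨⟨y, hy⟩, ⟨b, hb⟩, ⟨c, hc⟩, -⟩ := hg
  rw [hPP] at hy hb hc
  have hy' : g 0 0 = 1 + P * (P * y) := by linear_combination hy
  have hunit : IsUnit (g 0 0) := by
    rw [isUnit_iff_redp hp, hy', map_add, map_one, map_mul]
    have : redp p e P = 0 := by
      rw [redp_eq_zero_iff hp, hP]; exact dvd_pow_self _ (by omega)
    rw [this, zero_mul, add_zero]
    have := Fact.mk hp
    exact one_ne_zero
  obtain ⟨w, hw⟩ := hunit.exists_left_inv
  rw [elem_decomp g P (P * y) w hy' (by rw [← hy', hw])]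
  refine A.mul_mem (A.mul_mem (A.mul_mem ?_ ?_) ?_) ?_
  · rw [hc, show (P * P * c - P * y) * w = P * ((P * c - y) * w) by ring]; exact hl _
  · rw [← mul_one P]; exact hu _
  · exact hl _
  · rw [hb, show (P * P * b - P) * w = P * ((P * b - 1) * w) by ring]; exact hu _

theorem rankLE_units {p : ℕ} (hp : p.Prime) (e : ℕ) : RankLE (ZMod (p ^ e))ˣ 3 := by
  have : NeZero (p ^ e) := ⟨(pow_pos hp.pos _).ne'⟩
  by_cases h2 : p = 2
  · subst h2
    by_cases he : e < 2
    · apply (rankLE_of_card (G := (ZMod (2 ^ e))ˣ) (c := 2) _).mono (by norm_num)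
      rw [Nat.card_eq_fintype_card, ZMod.card_units_eq_totient]
      interval_cases e <;> decide
    · obtain ⟨n, rfl⟩ : ∃ n, e = n + 2 := ⟨e - 2, by omega⟩
      have hu : IsUnit (5 : ZMod (2 ^ (n + 2))) := by
        have := (ZMod.isUnit_iff_coprime 5 (2 ^ (n + 2))).2 (Nat.Coprime.pow_right _ (by norm_num))
        simpa using this
      obtain ⟨f, hf⟩ := hu
      have hord : orderOf f = 2 ^ n := by
        rw [← orderOf_units, hf, ZMod.orderOf_five]
      have hcard : Nat.card (ZMod (2 ^ (n + 2)))ˣ = 2 ^ (n + 1) := by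
        rw [Nat.card_eq_fintype_card, ZMod.card_units_eq_totient,
          Nat.totient_prime_pow Nat.prime_two (by omega)]
        simp
      have hidx : (Subgroup.zpowers f).index = 2 := by
        have h1 := (Subgroup.zpowers f).card_mul_index
        rw [Nat.card_zpowers, hord, hcard, show 2 ^ (n + 1) = 2 ^ n * 2 from pow_succ 2 n] at h1
        exact Nat.eq_of_mul_eq_mul_left (by positivity) h1
      have : RankLE (ZMod (2 ^ (n + 2)))ˣ (1 + 2) := by
        apply RankLE.ext (QuotientGroup.mk' (Subgroup.zpowers f))
        · rw [QuotientGroup.ker_mk']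
          exact rankLE_of_isCyclic
        · apply rankLE_of_card
          rw [← Subgroup.index_eq_card, hidx]
      exact this
  · have := ZMod.isCyclic_units_of_prime_pow p hp h2 e
    exact rankLE_of_isCyclic.mono (by norm_num)

/-- Borel subgroup. -/
def Bor (R : Type*) [CommRing R] : Subgroup (SL2 R) where
  carrier := {g | g 1 0 = 0}
  one_mem' := sl2_one_10
  mul_mem' := by
    intro g h hg hh
    change (g * h) 1 0 = 0
    rw [sl2_mul, show g 1 0 = 0 from hg, show h 1 0 = 0 from hh]; ring
  inv_mem' := by
    intro g hg
    change g⁻¹ 1 0 = 0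
    rw [sl2_inv_10, show g 1 0 = 0 from hg, neg_zero]

theorem mem_Bor {R : Type*} [CommRing R] {g : SL2 R} : g ∈ Bor R ↔ g 1 0 = 0 := Iff.rfl

/-- Character of the Borel subgroup. -/
def borChar (R : Type*) [CommRing R] : Bor R →* Rˣ where
  toFun g := ⟨(g : SL2 R) 0 0, (g : SL2 R) 1 1, by
      have := sl2_det (g : SL2 R)
      have h := mem_Bor.1 g.2
      rw [h] at this; linear_combination this, by
      have := sl2_det (g : SL2 R)
      have h := mem_Bor.1 g.2
      rw [h] at this; linear_combination this⟩
  map_one' := by ext; exact sl2_one_00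
  map_mul' g h := by
    ext
    change ((g : SL2 R) * (h : SL2 R)) 0 0 = (g : SL2 R) 0 0 * (h : SL2 R) 0 0
    rw [sl2_mul, mem_Bor.1 h.2]; ring

theorem borChar_apply {R : Type*} [CommRing R] (g : Bor R) :
    (borChar R g : R) = (g : SL2 R) 0 0 := rfl

theorem rankLE_Bor {p : ℕ} (hp : p.Prime) (e : ℕ) : RankLE (Bor (ZMod (p ^ e))) 4 := by
  have : RankLE (Bor (ZMod (p ^ e))) (1 + 3) := by
    apply RankLE.ext (borChar _) _ (rankLE_units hp e)
    have : NeZero (p ^ e) := ⟨(pow_pos hp.pos _).ne'⟩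
    have hcyc : IsCyclic (borChar (ZMod (p ^ e))).ker := by
      refine ⟨⟨⟨ua 1, rfl⟩, ?_⟩, ?_⟩
      · rw [MonoidHom.mem_ker]; ext; rfl
      · rintro ⟨⟨g, hg⟩, hk⟩
        rw [MonoidHom.mem_ker, Units.ext_iff, borChar_apply] at hk
        change g 0 0 = 1 at hk
        refine ⟨((g 0 1).val : ℤ), ?_⟩
        ext1; ext1
        simp only [zpow_natCast, SubmonoidClass.coe_pow]
        rw [ua_pow, ZMod.natCast_zmod_val, mul_one]
        have hd := sl2_det g
        rw [mem_Bor] at hg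
        rw [hg, hk] at hd
        apply sl2_ext
        · simp [hk]
        · simp
        · simp [hg]
        · simp; linear_combination -hd
    exact rankLE_of_isCyclic
  exact this

/-- Chebyshev-type sequence. -/
def chebS {R : Type*} [CommRing R] (t : R) : ℕ → R
  | 0 => 0
  | 1 => 1
  | (k + 2) => t * chebS t (k + 1) - chebS t k

theorem pow_10_chebS {R : Type*} [CommRing R] (g : SL2 R) (k : ℕ) :
    (g ^ k) 1 0 = g 1 0 * chebS (g 0 0 + g 1 1) k := by
  induction k using Nat.twoStepInduction with
  | zero => simp [chebS, sl2_one_10]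
  | one => simp [chebS]
  | more k ih1 ih2 =>
    have hd := sl2_det g
    rw [chebS, mul_sub, ← ih1, mul_left_comm, ← ih2, pow_succ (n := k + 1), pow_succ (n := k)]
    simp only [sl2_mul]
    linear_combination - (g ^ k) 1 0 * hd

theorem chebS_mod {R : Type*} [CommRing R] (t q : R) (h : q ∣ t - 2) (k : ℕ) :
    q ∣ chebS t k - k := by
  induction k using Nat.twoStepInduction with
  | zero => simp [chebS]
  | one => simp [chebS]
  | more k ih1 ih2 =>
    obtain ⟨a, ha⟩ := ih1
    obtain ⟨b, hb⟩ := ih2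
    obtain ⟨c, hc⟩ := h
    refine ⟨t * b + c * (k + 1) - a, ?_⟩
    rw [chebS]
    push_cast at hb ⊢
    linear_combination t * hb + (k + 1) * hc - ha

theorem pow_p_10 {p e : ℕ} [NeZero e] (hp : p.Prime) (g : SL2 (ZMod (p ^ e))) (hg : CongOne 1 g) :
    ∃ w, IsUnit w ∧ (g ^ p) 1 0 = g 1 0 * (p * w) := by
  have hd := sl2_det g
  obtain ⟨⟨a, ha⟩, ⟨b, hb⟩, ⟨c, hc⟩, ⟨d, hd'⟩⟩ := hg
  have htr : (p : ZMod (p ^ e)) ^ 2 ∣ (g 0 0 + g 1 1) - 2 := by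
    refine ⟨b * c - a * d, ?_⟩
    rw [sub_eq_iff_eq_add] at ha hd'
    rw [ha, hb, hc, hd'] at hd
    rw [ha, hd']
    linear_combination hd
  obtain ⟨y, hy⟩ := chebS_mod _ _ htr p
  refine ⟨1 + p * y, ?_, ?_⟩
  · rw [isUnit_iff_redp hp, map_add, map_mul, redp_natCast]
    have := Fact.mk hp
    simp
  · rw [pow_10_chebS]; linear_combination g 1 0 * hy

theorem pow_pow_10 {p e : ℕ} [NeZero e] (hp : p.Prime) (g : SL2 (ZMod (p ^ e))) (hg : CongOne 1 g)
    (j : ℕ) : ∃ w, IsUnit w ∧ (g ^ p ^ j) 1 0 = g 1 0 * (p ^ j * w) := by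
  induction j with
  | zero => exact ⟨1, isUnit_one, by simp⟩
  | succ j ih =>
    obtain ⟨w, hw, h⟩ := ih
    have h1 : CongOne 1 (g ^ p ^ j) := by
      have := (Kk p e 1).pow_mem (mem_Kk.2 hg) (p ^ j)
      exact this
    obtain ⟨w', hw', h'⟩ := pow_p_10 hp _ h1
    refine ⟨w * w', hw.mul hw', ?_⟩
    rw [pow_succ, pow_mul, h', h]; ring

theorem ncard_multiples {p e v : ℕ} (hp : p.Prime) (hv : v ≤ e) :
    {z : ZMod (p ^ e) | (p : ZMod (p ^ e)) ^ v ∣ z}.ncard ≤ p ^ (e - v) := by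
  have : NeZero (p ^ e) := ⟨(pow_pos hp.pos _).ne'⟩
  have hsub : {z : ZMod (p ^ e) | (p : ZMod (p ^ e)) ^ v ∣ z} ⊆
      (fun k : ℕ => (p : ZMod (p ^ e)) ^ v * k) '' (Finset.range (p ^ (e - v)) : Set ℕ) := by
    rintro _ ⟨y, rfl⟩
    refine ⟨y.val % p ^ (e - v), ?_, ?_⟩
    · simp only [Finset.coe_range, Set.mem_Iio]
      exact Nat.mod_lt _ (pow_pos hp.pos _)
    · have h1 : ((y.val : ℕ) : ZMod (p ^ e)) = y := ZMod.natCast_zmod_val y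
      have h2 := Nat.mod_add_div y.val (p ^ (e - v))
      have h3 : (p : ZMod (p ^ e)) ^ v * (p : ZMod (p ^ e)) ^ (e - v) = 0 := by
        rw [← pow_add, Nat.add_sub_cancel' hv, ← Nat.cast_pow, ZMod.natCast_self]
      conv_rhs => rw [← h1, ← h2]
      push_cast
      linear_combination - ((y.val / p ^ (e - v) : ℕ) : ZMod (p ^ e)) * h3
  refine (Set.ncard_le_ncard hsub (Set.toFinite _)).trans ?_
  refine (Set.ncard_image_le (Set.toFinite _)).trans ?_
  simp

theorem exists_min_elem {p e : ℕ} [NeZero e] (hp : p.Prime) (X : Subgroup (SL2 (ZMod (p ^ e)))) :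
    ∃ x ∈ X, ∃ v ≤ e, ∃ w, IsUnit w ∧ x 1 0 = (p : ZMod (p ^ e)) ^ v * w ∧
      ∀ y ∈ X, (p : ZMod (p ^ e)) ^ v ∣ y 1 0 := by
  classical
  have hex : ∃ v, ∃ x ∈ X, v ≤ e ∧ ∃ w, IsUnit w ∧ x 1 0 = (p : ZMod (p ^ e)) ^ v * w := by
    obtain ⟨v, hv, w, hw, h⟩ := exists_val hp e ((1 : SL2 (ZMod (p ^ e))) 1 0)
    exact ⟨v, 1, X.one_mem, hv, w, hw, h⟩
  obtain ⟨x, hx, hv, w, hw, h⟩ := Nat.find_spec hex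
  refine ⟨x, hx, Nat.find hex, hv, w, hw, h, ?_⟩
  intro y hy
  obtain ⟨v', hv', w', hw', h'⟩ := exists_val hp e (y 1 0)
  have hle := Nat.find_min' hex ⟨y, hy, hv', w', hw', h'⟩
  rw [h']
  exact Dvd.dvd.mul_right (pow_dvd_pow _ hle) _

theorem exists_gen_mod_Bor {p e : ℕ} [NeZero e] (hp : p.Prime) (X : Subgroup (SL2 (ZMod (p ^ e))))
    (hX : X ≤ Kp p e) : ∃ x ∈ X, ∀ y ∈ X, ∃ k : ℕ, (x ^ k)⁻¹ * y ∈ Bor (ZMod (p ^ e)) := by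
  have : NeZero (p ^ e) := ⟨(pow_pos hp.pos _).ne'⟩
  have hfp := Fact.mk hp
  obtain ⟨x, hx, v, hv, w, hw, hxv, hmin⟩ := exists_min_elem hp X
  have hxK : CongOne 1 x := (mem_Kp hp e x).1 (hX hx)
  refine ⟨x, hx, ?_⟩
  have hunit : ∀ y ∈ X, IsUnit (y 0 0) := by
    intro y hy
    have h1 := (mem_Kp hp e y).1 (hX hy)
    have h2 := h1.1
    rw [pow_one, ← redp_eq_zero_iff hp, map_sub, map_one, sub_eq_zero] at h2
    rw [isUnit_iff_redp hp, h2]; exact one_ne_zero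
  -- the invariant
  have hphi : ∀ y ∈ X, ∀ z ∈ X, (y 1 0 * Ring.inverse (y 0 0) = z 1 0 * Ring.inverse (z 0 0)) →
      y⁻¹ * z ∈ Bor (ZMod (p ^ e)) := by
    intro y hy z hz h
    have h1 := Ring.inverse_mul_cancel _ (hunit y hy)
    have h2 := Ring.inverse_mul_cancel _ (hunit z hz)
    rw [mem_Bor, sl2_mul, sl2_inv_10, sl2_inv_11]
    linear_combination (-y 0 0 * z 0 0) * h + y 1 0 * z 0 0 * h1 - z 1 0 * y 0 0 * h2
  set Φ : ℕ → ZMod (p ^ e) := fun k => (x ^ k) 1 0 * Ring.inverse ((x ^ k) 0 0) with hΦ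
  have hinj : Set.InjOn Φ (Finset.range (p ^ (e - v)) : Set ℕ) := by
    have aux : ∀ k j : ℕ, k < j → j < p ^ (e - v) → Φ k = Φ j → False := by
      intro k j hkj hj hkjΦ
      have hB := hphi _ (X.pow_mem hx k) _ (X.pow_mem hx j) hkjΦ
      obtain ⟨n, rfl⟩ := Nat.exists_eq_add_of_lt hkj
      rw [add_assoc, pow_add, inv_mul_cancel_left] at hB
      obtain ⟨s, n', hn', hs⟩ := Nat.exists_eq_pow_mul_and_not_dvd (n := n + 1) (by omega) p hp.ne_one
      rw [hs, pow_mul] at hB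
      have hx1 : (x ^ p ^ s) ^ p ^ e = 1 := by
        rw [← pow_mul, mul_comm, pow_mul, (hxK.pow_pow le_rfl e).eq_one (by omega), one_pow]
      have hB2 := mem_of_pow_mem_coprime _ hx1
        (Nat.Coprime.pow_right _ ((Nat.Prime.coprime_iff_not_dvd hp).2 hn').symm) hB
      rw [mem_Bor] at hB2
      obtain ⟨w', hw', h'⟩ := pow_pow_10 hp x hxK s
      rw [h', hxv, show (p : ZMod (p ^ e)) ^ v * w * (p ^ s * w') = p ^ (v + s) * (w * w') by ring,
        (hw.mul hw').mul_left_eq_zero, p_pow_eq_zero_iff hp] at hB2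
      have h4 : p ^ (e - v) ≤ n + 1 := by
        rw [hs]
        refine (Nat.pow_le_pow_right hp.pos (show e - v ≤ s by omega)).trans ?_
        exact Nat.le_mul_of_pos_right _ (Nat.pos_of_ne_zero (by rintro rfl; simp at hn'))
      omega
    intro k hk j hj h
    simp only [Finset.coe_range, Set.mem_Iio] at hk hj
    rcases lt_trichotomy k j with h1 | h1 | h1
    · exact (aux k j h1 hj h).elim
    · exact h1
    · exact (aux j k h1 hk h.symm).elim
  have hsub : Φ '' (Finset.range (p ^ (e - v)) : Set ℕ) ⊆ {z | (p : ZMod (p ^ e)) ^ v ∣ z} := by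
    rintro _ ⟨k, -, rfl⟩
    exact Dvd.dvd.mul_right (hmin _ (X.pow_mem hx k)) _
  have heq := Set.eq_of_subset_of_ncard_le hsub (by
    rw [hinj.ncard_image, Set.ncard_coe_finset, Finset.card_range]
    exact ncard_multiples hp hv) (Set.toFinite _)
  intro y hy
  have hy2 : y 1 0 * Ring.inverse (y 0 0) ∈ {z | (p : ZMod (p ^ e)) ^ v ∣ z} :=
    Dvd.dvd.mul_right (hmin _ hy) _
  rw [← heq] at hy2
  obtain ⟨k, -, hk⟩ := hy2
  exact ⟨k, hphi _ (X.pow_mem hx k) _ hy hk⟩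

theorem rankLE_Kp {p : ℕ} (hp : p.Prime) (e : ℕ) [NeZero e] : RankLE (Kp p e) 5 := by
  intro X
  obtain ⟨x, hx, hX⟩ := exists_gen_mod_Bor hp (X.map (Kp p e).subtype) (by
    rintro _ ⟨y, -, rfl⟩; exact y.2)
  obtain ⟨f, hf⟩ := rankLE_Bor hp e ((X.map (Kp p e).subtype).subgroupOf (Bor _))
  have hfm : ∀ i, (f i : SL2 (ZMod (p ^ e))) ∈ X.map (Kp p e).subtype := by
    intro i
    have : f i ∈ (X.map (Kp p e).subtype).subgroupOf (Bor _) := hf ▸ Subgroup.subset_closure ⟨i, rfl⟩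
    exact this
  have hfm' : ∀ i, ∃ z ∈ X, (z : SL2 (ZMod (p ^ e))) = f i := by
    intro i; simpa using hfm i
  choose z hz hzf using hfm'
  obtain ⟨x', hx', rfl⟩ := hx
  refine ⟨Fin.cons x' z, ?_⟩
  apply le_antisymm
  · rw [Subgroup.closure_le]
    rintro _ ⟨i, rfl⟩
    induction i using Fin.cases with
    | zero => exact hx'
    | succ i => exact hz i
  · intro y hy
    obtain ⟨k, hk⟩ := hX y ⟨y, hy, rfl⟩
    set C := Subgroup.closure (Set.range (Fin.cons x' z : Fin 5 → Kp p e)) with hC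
    have hxC : x' ∈ C := Subgroup.subset_closure ⟨0, rfl⟩
    have hzC : ∀ i, z i ∈ C := fun i => Subgroup.subset_closure ⟨i.succ, rfl⟩
    have h1 : (⟨_, hk⟩ : Bor (ZMod (p ^ e))) ∈ Subgroup.closure (Set.range f) := by
      rw [hf, Subgroup.mem_subgroupOf]
      exact ⟨(x' ^ k)⁻¹ * y, X.mul_mem (X.inv_mem (X.pow_mem hx' k)) hy, rfl⟩
    have h2 : Subgroup.closure (Set.range f) ≤ (C.map (Kp p e).subtype).comap (Bor _).subtype := by
      rw [Subgroup.closure_le]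
      rintro _ ⟨i, rfl⟩
      exact ⟨z i, hzC i, hzf i⟩
    obtain ⟨c, hc, hce⟩ := h2 h1
    have h3 : c = (x' ^ k)⁻¹ * y := Subtype.ext hce
    rw [h3] at hc
    have := C.mul_mem (C.pow_mem hxC k) hc
    rwa [mul_inv_cancel_left] at this

section fieldSL
variable {k : Type*} [Field k]

/-- There is an element of `SL₂` with prescribed nonzero first column. -/
theorem exists_col (a c : k) (h : a ≠ 0 ∨ c ≠ 0) : ∃ g : SL2 k, g 0 0 = a ∧ g 1 0 = c := by
  rcases h with h | h
  · refine ⟨⟨!![a, 0; c, a⁻¹], ?_⟩, rfl, rfl⟩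
    rw [Matrix.det_fin_two_of]; field_simp; simp
  · refine ⟨⟨!![a, -c⁻¹; c, 0], ?_⟩, rfl, rfl⟩
    rw [Matrix.det_fin_two_of]; field_simp; simp

/-- If the first column of `h` is an eigenvector of `g` then the conjugate is upper triangular. -/
theorem conj_mem_Bor (g h : SL2 k) (l : k)
    (h0 : g 0 0 * h 0 0 + g 0 1 * h 1 0 = l * h 0 0)
    (h1 : g 1 0 * h 0 0 + g 1 1 * h 1 0 = l * h 1 0) :
    (h⁻¹ * g * h) 1 0 = 0 ∧ (h⁻¹ * g * h) 0 0 = l := by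
  have hd := sl2_det h
  simp only [mul_assoc, sl2_mul, sl2_inv_00, sl2_inv_01, sl2_inv_10, sl2_inv_11]
  constructor
  · linear_combination (-h 1 0) * h0 + h 0 0 * h1
  · linear_combination (h 1 1) * h0 - h 0 1 * h1 + l * hd

theorem Bor_eq_ua (g : SL2 k) (h : g 1 0 = 0) (h0 : g 0 0 = 1) : g = ua (g 0 1) := by
  have hd := sl2_det g
  rw [h, h0] at hd
  apply sl2_ext
  · simp [h0]
  · simp
  · simp [h]
  · simp; linear_combination hd

/-- trace two and nontrivial: conjugate to an upper unipotent -/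
theorem exists_conj_ua (g : SL2 k) (ht : g 0 0 + g 1 1 = 2) :
    ∃ h : SL2 k, ∃ a : k, h⁻¹ * g * h = ua a := by
  have hd := sl2_det g
  by_cases h : g 0 0 - 1 ≠ 0 ∨ g 1 0 ≠ 0
  · obtain ⟨h, h0, h1⟩ := exists_col _ _ h
    have hg11 : g 1 1 = 2 - g 0 0 := by linear_combination ht
    rw [hg11] at hd
    have := conj_mem_Bor g h 1 (by rw [h0, h1]; linear_combination -hd)
      (by rw [h0, h1]; linear_combination g 1 0 * ht)
    exact ⟨h, _, Bor_eq_ua _ this.1 this.2⟩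
  · push Not at h
    refine ⟨1, _, Bor_eq_ua _ ?_ ?_⟩
    · simpa using h.2
    · simpa [sub_eq_zero] using h.1

theorem trace_of_pow_char {p : ℕ} [Fact p.Prime] [CharP k p] (g : SL2 k) (hg : g ^ p = 1) :
    g 0 0 + g 1 1 = 2 := by
  have h1 : ((g : Matrix (Fin 2) (Fin 2) k) - 1) ^ p = 0 := by
    rw [sub_pow_char_of_commute p (Commute.one_right _), one_pow,
      ← Matrix.SpecialLinearGroup.coe_pow, hg, Matrix.SpecialLinearGroup.coe_one, sub_self]
  have h2 : ((g : Matrix (Fin 2) (Fin 2) k) - 1).det = 0 := by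
    have := congrArg Matrix.det h1
    rw [Matrix.det_pow, Matrix.det_zero] at this
    exact pow_eq_zero_iff (Fact.out (p := p.Prime)).ne_zero |>.1 this
  rw [Matrix.det_fin_two] at h2
  simp at h2
  linear_combination -h2 + sl2_det g

end fieldSL

section Fp
variable {p : ℕ} [hp : Fact p.Prime]

theorem eq_top_of_two (F : Subgroup (SL2 (ZMod p))) (a : ZMod p) (ha : a ≠ 0) (hua : ua a ∈ F)
    (f : SL2 (ZMod p)) (hf : f ∈ F) (hf0 : f 1 0 ≠ 0) : F = ⊤ := by
  have hu : ∀ y, ua y ∈ F := by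
    intro y
    have := F.pow_mem hua (y * a⁻¹).val
    rwa [ua_pow, ZMod.natCast_zmod_val, inv_mul_cancel_right₀ ha] at this
  set n := ua (- f 0 0 * (f 1 0)⁻¹) * f with hn
  have hnF : n ∈ F := F.mul_mem (hu _) hf
  have hn0 : n 0 0 = 0 := by
    rw [hn, sl2_mul]; simp; field_simp; ring
  have hn1 : n 1 0 = f 1 0 := by
    rw [hn, sl2_mul]; simp
  have hdn := sl2_det n
  have hl1 : ∀ y, n * ua y * n⁻¹ = la (-y * (n 1 0) ^ 2) := by
    intro y
    apply sl2_ext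
    · simp [sl2_mul, sl2_inv_00, sl2_inv_10, hn0]; rw [hn0] at hdn; linear_combination hdn
    · simp [sl2_mul, sl2_inv_01, sl2_inv_11, hn0]
    · simp [sl2_mul, sl2_inv_00, sl2_inv_10, hn0]; ring
    · simp [sl2_mul, sl2_inv_01, sl2_inv_11, hn0]; rw [hn0] at hdn; linear_combination hdn
  have hl : ∀ y, la y ∈ F := by
    intro y
    have h1 := hl1 (- y * ((n 1 0) ^ 2)⁻¹)
    have h2 : n 1 0 ≠ 0 := by rw [hn1]; exact hf0
    have h3 : -(-y * ((n 1 0) ^ 2)⁻¹) * (n 1 0) ^ 2 = y := by field_simp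
    rw [h3] at h1
    rw [← h1]
    exact F.mul_mem (F.mul_mem hnF (hu _)) (F.inv_mem hnF)
  exact eq_top_of_elem F hu hl

theorem borel_case (F : Subgroup (SL2 (ZMod p))) (hF : F ≠ ⊤) (hpF : p ∣ Nat.card F) :
    ∃ h : SL2 (ZMod p), ∀ f ∈ F, h⁻¹ * f * h ∈ Bor (ZMod p) := by
  obtain ⟨⟨g, hgF⟩, hg⟩ := exists_prime_orderOf_dvd_card' p hpF
  have hgp : g ^ p = 1 := by
    have := pow_orderOf_eq_one (⟨g, hgF⟩ : F)
    rw [hg] at this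
    simpa [Subtype.ext_iff] using this
  have hg1 : g ≠ 1 := by
    rintro rfl
    have : (⟨1, hgF⟩ : F) = 1 := rfl
    rw [this, orderOf_one] at hg
    exact hp.out.ne_one hg.symm
  obtain ⟨h, a, ha⟩ := exists_conj_ua g (trace_of_pow_char (p := p) g hgp)
  have ha0 : a ≠ 0 := by
    rintro rfl
    rw [ua_zero] at ha
    apply hg1
    have : g = h * (h⁻¹ * g * h) * h⁻¹ := by group
    rw [this, ha]; group
  refine ⟨h, fun f hf => ?_⟩
  by_contra hb
  rw [mem_Bor] at hb
  set F' := F.map (MulAut.conj h⁻¹).toMonoidHom with hF'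
  have hmem : ∀ f ∈ F, h⁻¹ * f * h ∈ F' := by
    intro f hf; exact ⟨f, hf, by simp⟩
  have htop := eq_top_of_two F' a ha0 (ha ▸ hmem g hgF) _ (hmem f hf) hb
  apply hF
  rw [eq_top_iff]
  intro x _
  have : h⁻¹ * x * h ∈ F' := by rw [htop]; trivial
  obtain ⟨y, hy, hye⟩ := this
  have hxy : h⁻¹ * y * h = h⁻¹ * x * h := by simpa using hye
  have : y = x := by simpa using hxy
  exact this ▸ hy

theorem card_SL2_ge : p ^ 2 * (p - 1) ≤ Nat.card (SL2 (ZMod p)) := by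
  have hinj : Function.Injective (fun x : (ZMod p)ˣ × ZMod p × ZMod p =>
      (⟨!![(x.1 : ZMod p), x.2.1; x.2.2, ((x.1⁻¹ : (ZMod p)ˣ) : ZMod p) * (1 + x.2.1 * x.2.2)], by
        rw [Matrix.det_fin_two_of, ← mul_assoc, Units.mul_inv]; ring⟩ : SL2 (ZMod p))) := by
    rintro ⟨a, b, c⟩ ⟨a', b', c'⟩ h
    have h' := congrArg (fun g : SL2 (ZMod p) => (g : Matrix (Fin 2) (Fin 2) (ZMod p))) h
    have h00 := congrFun (congrFun h' 0) 0
    have h01 := congrFun (congrFun h' 0) 1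
    have h10 := congrFun (congrFun h' 1) 0
    change (a : ZMod p) = a' at h00
    change b = b' at h01
    change c = c' at h10
    rw [← Units.ext_iff] at h00
    rw [h00, h01, h10]
  have := Nat.card_le_card_of_injective _ hinj
  rw [Nat.card_prod, Nat.card_prod, Nat.card_zmod, Nat.card_eq_fintype_card (α := (ZMod p)ˣ),
    ZMod.card_units_eq_totient, Nat.totient_prime hp.out] at this
  calc p ^ 2 * (p - 1) = (p - 1) * (p * p) := by ring
    _ ≤ _ := this

theorem card_Bor_le : Nat.card (Bor (ZMod p)) ≤ p * (p - 1) := by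
  have hinj : Function.Injective (fun g : Bor (ZMod p) => (borChar _ g, (g : SL2 (ZMod p)) 0 1)) := by
    rintro ⟨g, hg⟩ ⟨h, hh⟩ hgh
    simp only [Prod.mk.injEq, Units.ext_iff, borChar_apply] at hgh
    obtain ⟨h1, h2⟩ := hgh
    have hdg := sl2_det g
    have hdh := sl2_det h
    rw [mem_Bor] at hg hh
    rw [hg] at hdg
    rw [hh, ← h1] at hdh
    have hne : g 0 0 ≠ 0 := by intro h0; rw [h0] at hdg; simp at hdg
    ext1
    apply sl2_ext h1 h2 (hg.trans hh.symm)
    apply mul_left_cancel₀ hne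
    linear_combination hdg - hdh
  have := Nat.card_le_card_of_injective _ hinj
  rw [Nat.card_prod, Nat.card_zmod, Nat.card_eq_fintype_card (α := (ZMod p)ˣ),
    ZMod.card_units_eq_totient, Nat.totient_prime hp.out] at this
  linarith [mul_comm p (p - 1)]

end Fp

theorem klein_arith (g o1 o2 o3 e1 e2 e3 : ℕ) (h1 : o1 * e1 = g) (h2 : o2 * e2 = g)
    (h3 : o3 * e3 = g) (he1 : 2 ≤ e1) (he12 : e1 ≤ e2) (he23 : e2 ≤ e3)
    (hs : o1 + o2 + o3 = g + 2) : o3 = 2 ∨ g = 12 ∨ g = 24 ∨ g = 60 := by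
  have a1 : e1 = 2 := by
    by_contra hne
    have : 3 ≤ e1 := by omega
    have b1 : 3 * o1 ≤ g := by rw [← h1]; nlinarith
    have b2 : 3 * o2 ≤ g := by rw [← h2]; nlinarith
    have b3 : 3 * o3 ≤ g := by rw [← h3]; nlinarith
    omega
  subst a1
  have a2 : e2 < 4 := by
    by_contra hne
    have b2 : 4 * o2 ≤ g := by rw [← h2]; nlinarith
    have b3 : 4 * o3 ≤ g := by rw [← h3]; nlinarith
    omega
  interval_cases e2
  · left; omega
  · right
    have a3 : e3 < 6 := by
      by_contra hne
      have b3 : 6 * o3 ≤ g := by rw [← h3]; nlinarith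
      omega
    interval_cases e3 <;> omega

theorem klein_arith' (g : ℕ) (o e : Fin 3 → ℕ) (h : ∀ i, o i * e i = g) (he : ∀ i, 2 ≤ e i)
    (hs : ∑ i, o i = g + 2) : (∃ i, o i = 2) ∨ g = 12 ∨ g = 24 ∨ g = 60 := by
  rw [Fin.sum_univ_three] at hs
  have key : ∀ i j k : Fin 3, o i + o j + o k = g + 2 → e i ≤ e j → e j ≤ e k →
      (∃ i, o i = 2) ∨ g = 12 ∨ g = 24 ∨ g = 60 := by
    intro i j k hs h1 h2
    rcases klein_arith g _ _ _ _ _ _ (h i) (h j) (h k) (he i) h1 h2 hs with h | h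
    · exact Or.inl ⟨k, h⟩
    · exact Or.inr h
  rcases le_total (e 0) (e 1) with a | a <;> rcases le_total (e 1) (e 2) with b | b <;>
    rcases le_total (e 0) (e 2) with c | c
  · exact key 0 1 2 (by omega) a b
  · exact key 0 1 2 (by omega) a b
  · exact key 0 2 1 (by omega) c b
  · exact key 2 0 1 (by omega) c a
  · exact key 1 0 2 (by omega) a c
  · exact key 1 2 0 (by omega) b c
  · exact key 2 1 0 (by omega) b a
  · exact key 2 1 0 (by omega) b a

theorem burnside_abstract {F Ω : Type*} [Group F] [Finite F] [Finite Ω] [MulAction F Ω]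
    (Z : Subgroup F) (hZ : ∀ z ∈ Z, ∀ ω : Ω, z • ω = ω)
    (h2 : ∀ g : F, g ∉ Z → (MulAction.fixedBy Ω g).ncard = 2)
    (hΩ : ∀ ω : Ω, ∃ g : F, g ∉ Z ∧ g • ω = ω) :
    (∃ ω : Ω, MulAction.stabilizer F ω = ⊤) ∨ (∃ ω : Ω, (MulAction.stabilizer F ω).index = 2) ∨
      ∃ g ∈ ({1, 12, 24, 60} : Set ℕ), Nat.card F = Nat.card Z * g := by
  classical
  have := Fintype.ofFinite F
  have := Fintype.ofFinite Ω
  obtain ⟨g, hg⟩ : Nat.card Z ∣ Nat.card F := Subgroup.card_subgroup_dvd_card Z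
  have hzpos : 0 < Nat.card Z := Nat.card_pos
  have hgpos : 0 < g := Nat.pos_of_ne_zero (by
    rintro rfl; have := Nat.card_pos (α := F); omega)
  set Q := Quotient (MulAction.orbitRel F Ω) with hQ
  have : Fintype Q := Fintype.ofFinite Q
  set o : Q → ℕ := fun q => (MulAction.stabilizer F q.out).index with ho
  have hcardΩ : Nat.card Ω = ∑ q, o q := by
    rw [Nat.card_congr (MulAction.selfEquivSigmaOrbitsQuotientStabilizer F Ω), Nat.card_sigma]
    rfl
  have he : ∀ q, ∃ e, 2 ≤ e ∧ o q * e = g := by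
    intro q
    have hle : Z ≤ MulAction.stabilizer F q.out := fun z hz => hZ z hz _
    obtain ⟨e, he⟩ := Subgroup.card_dvd_of_le hle
    have h1 := (MulAction.stabilizer F q.out).card_mul_index
    refine ⟨e, ?_, ?_⟩
    · by_contra hlt
      have : e = 0 ∨ e = 1 := by omega
      rcases this with rfl | rfl
      · have := Nat.card_pos (α := MulAction.stabilizer F q.out)
        omega
      · have heq : Z = MulAction.stabilizer F q.out :=
          Subgroup.eq_of_le_of_card_ge hle (by rw [he, mul_one])
        obtain ⟨x, hx, hx2⟩ := hΩ q.out
        exact hx (heq ▸ hx2)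
    · rw [he, hg, mul_assoc] at h1
      have := Nat.eq_of_mul_eq_mul_left hzpos h1
      rw [mul_comm]; exact this
  choose e he2 hoe using he
  have hB := MulAction.sum_card_fixedBy_eq_card_orbits_mul_card_group F Ω
  have hsum : ∑ a : F, Fintype.card (MulAction.fixedBy Ω a) =
      Nat.card Z * Nat.card Ω + 2 * (Nat.card F - Nat.card Z) := by
    rw [← Finset.sum_filter_add_sum_filter_not Finset.univ (fun a => a ∈ Z)]
    have c1 : (Finset.univ.filter fun a : F => a ∈ Z).card = Nat.card Z := by
      rw [Nat.card_eq_fintype_card, Fintype.card_subtype]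
    have c2 : (Finset.univ.filter fun a : F => ¬ a ∈ Z).card = Nat.card F - Nat.card Z := by
      rw [Finset.filter_not, Finset.card_sdiff_of_subset (Finset.filter_subset _ _), c1,
        Finset.card_univ, Nat.card_eq_fintype_card (α := F)]
    congr 1
    · rw [Finset.sum_congr rfl (g := fun _ => Nat.card Ω), Finset.sum_const, c1, smul_eq_mul]
      intro a ha
      rw [Finset.mem_filter] at ha
      rw [← Nat.card_eq_fintype_card]
      have : MulAction.fixedBy Ω a = Set.univ := by
        ext ω; simp [hZ a ha.2 ω]
      rw [this, Nat.card_univ]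
    · rw [Finset.sum_congr rfl (g := fun _ => 2), Finset.sum_const, c2, smul_eq_mul, mul_comm]
      intro a ha
      rw [Finset.mem_filter] at ha
      rw [← Nat.card_eq_fintype_card, ← h2 a ha.2]
      rfl
  rw [hsum] at hB
  have hB2 : Nat.card Ω + 2 * (g - 1) = Fintype.card Q * g := by
    have h3 : Fintype.card (Quotient (MulAction.orbitRel F Ω)) = Fintype.card Q := by
      exact Fintype.card_congr (Equiv.refl _)
    rw [h3, ← Nat.card_eq_fintype_card (α := F), hg] at hB
    apply Nat.eq_of_mul_eq_mul_left hzpos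
    rw [mul_add]
    have h4 : Nat.card Z * g - Nat.card Z = Nat.card Z * (g - 1) := by rw [Nat.mul_sub, mul_one]
    rw [h4] at hB
    linarith
  rw [hcardΩ] at hB2
  obtain ⟨n, hn⟩ : ∃ n, Fintype.card Q = n := ⟨_, rfl⟩
  rw [hn] at hB2
  let eq := Fintype.equivFinOfCardEq hn
  have hsumF : ∑ q, o q = ∑ i, o (eq.symm i) := (Equiv.sum_comp eq.symm o).symm
  rw [hsumF] at hB2
  have hopos : ∀ q, 0 < o q := fun q => Nat.pos_of_ne_zero (by
    intro h0; have := hoe q; rw [h0] at this; omega)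
  have ho2 : ∀ q, 2 * o q ≤ g := fun q => by rw [← hoe q]; nlinarith [he2 q, hopos q]
  have hk : n < 4 := by
    have h5 : 2 * ∑ i, o (eq.symm i) ≤ n * g := by
      rw [Finset.mul_sum]
      refine (Finset.sum_le_sum fun i _ => ho2 (eq.symm i)).trans ?_
      simp
    by_contra hlt
    have : 4 * g ≤ n * g := Nat.mul_le_mul_right _ (by omega)
    omega
  have one_case : ∀ q, o q = 1 → ∃ ω : Ω, MulAction.stabilizer F ω = ⊤ := by
    intro q hq
    exact ⟨q.out, Subgroup.index_eq_one.1 hq⟩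
  interval_cases n
  · right; right
    refine ⟨1, by simp, ?_⟩
    simp at hB2
    have : g = 1 := by omega
    rw [hg, this]
  · simp at hB2
    have := hopos (eq.symm 0)
    have := ho2 (eq.symm 0)
    omega
  · rw [Fin.sum_univ_two] at hB2
    have := hopos (eq.symm 0)
    have := hopos (eq.symm 1)
    exact Or.inl (one_case (eq.symm 0) (by omega))
  · rcases klein_arith' g (fun i => o (eq.symm i)) (fun i => e (eq.symm i)) (fun i => hoe _)
      (fun i => he2 _) (by omega) with ⟨i, hi⟩ | h
    · exact Or.inr (Or.inl ⟨_, hi⟩)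
    · refine Or.inr (Or.inr ⟨g, ?_, hg⟩)
      rcases h with h | h | h <;> simp [h]

section tame
open scoped LinearAlgebra.Projectivization

variable {K : Type*} [Field K]

theorem ua_pow_eq_one (a : K) (n : ℕ) (hn : (n : K) ≠ 0) (h : ua a ^ n = 1) : a = 0 := by
  rw [ua_pow] at h
  have := congrArg (fun g : SL2 K => g 0 1) h
  simp only [ua_01, sl2_one_01, mul_eq_zero] at this
  tauto

theorem conj_pow_sl2 (g h : SL2 K) (n : ℕ) (hg : g ^ n = 1) : (h⁻¹ * g * h) ^ n = 1 := by
  have : (h⁻¹ * g * h) = h⁻¹ * g * (h⁻¹)⁻¹ := by rw [inv_inv]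
  rw [this, conj_pow, hg]; simp

theorem eq_one_of_conj (g h : SL2 K) (hg : h⁻¹ * g * h = 1) : g = 1 := by
  have : g = h * (h⁻¹ * g * h) * h⁻¹ := by group
  rw [this, hg]; simp

theorem tame_tr_two (g : SL2 K) (n : ℕ) (hn : (n : K) ≠ 0) (hg : g ^ n = 1)
    (ht : g 0 0 + g 1 1 = 2) : g = 1 := by
  obtain ⟨h, a, ha⟩ := exists_conj_ua g ht
  have h1 := conj_pow_sl2 g h n hg
  rw [ha] at h1
  have := ua_pow_eq_one a n hn h1
  rw [this, ua_zero] at ha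
  exact eq_one_of_conj g h ha

theorem tame_tr_neg_two (g : SL2 K) (n : ℕ) (hn : (n : K) ≠ 0) (h2 : (2 : K) ≠ 0) (hg : g ^ n = 1)
    (ht : g 0 0 + g 1 1 = -2) : g = -1 := by
  have : -g = 1 := by
    apply tame_tr_two (-g) (2 * n) (by push_cast; exact mul_ne_zero h2 hn)
    · rw [pow_mul, neg_sq, ← pow_mul, mul_comm, pow_mul, hg, one_pow]
    · simp only [Matrix.SpecialLinearGroup.coe_neg, Matrix.neg_apply]
      linear_combination -ht
  rw [← this, neg_neg]

theorem sl2_smul (g : SL2 K) (v : Fin 2 → K) (i : Fin 2) : (g • v) i = g i 0 * v 0 + g i 1 * v 1 := by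
  rw [Matrix.SpecialLinearGroup.smul_def]; simp [Matrix.mulVec, dotProduct, Fin.sum_univ_two]

theorem vec_ne_zero {v : Fin 2 → K} (hv : v ≠ 0) : v 0 ≠ 0 ∨ v 1 ≠ 0 := by
  by_contra h
  push Not at h
  exact hv (by ext i; fin_cases i <;> simp [h.1, h.2])

theorem mk_eq_iff_det {u v : Fin 2 → K} (hu : u ≠ 0) (hv : v ≠ 0) :
    Projectivization.mk K u hu = Projectivization.mk K v hv ↔ u 0 * v 1 - u 1 * v 0 = 0 := by
  rw [Projectivization.mk_eq_mk_iff']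
  constructor
  · rintro ⟨a, rfl⟩
    simp; ring
  · intro h
    rcases vec_ne_zero hv with h0 | h0
    · refine ⟨u 0 / v 0, ?_⟩
      ext i; fin_cases i
      · simp [h0]
      · simp; field_simp; linear_combination h
    · refine ⟨u 1 / v 1, ?_⟩
      ext i; fin_cases i
      · simp; field_simp; linear_combination -h
      · simp [h0]

theorem fixed_iff (g : SL2 K) {v : Fin 2 → K} (hv : v ≠ 0) :
    g • Projectivization.mk K v hv = Projectivization.mk K v hv ↔ ∃ l : K,
      g 0 0 * v 0 + g 0 1 * v 1 = l * v 0 ∧ g 1 0 * v 0 + g 1 1 * v 1 = l * v 1 := by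
  rw [Projectivization.smul_mk, Projectivization.mk_eq_mk_iff']
  constructor
  · rintro ⟨a, ha⟩
    refine ⟨a, ?_, ?_⟩
    · rw [← sl2_smul, ← ha]; simp
    · rw [← sl2_smul, ← ha]; simp
  · rintro ⟨l, h0, h1⟩
    refine ⟨l, ?_⟩
    ext i; fin_cases i
    · simp only [Fin.zero_eta, Pi.smul_apply, smul_eq_mul]; rw [sl2_smul, h0]
    · simp only [Fin.mk_one, Pi.smul_apply, smul_eq_mul]; rw [sl2_smul, h1]

theorem eigen_exists (g : SL2 K) (l : K) (hl : l ^ 2 - (g 0 0 + g 1 1) * l + 1 = 0) :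
    ∃ v : Fin 2 → K, v ≠ 0 ∧
      g 0 0 * v 0 + g 0 1 * v 1 = l * v 0 ∧ g 1 0 * v 0 + g 1 1 * v 1 = l * v 1 := by
  have hd := sl2_det g
  by_cases h : g 0 1 = 0 ∧ l - g 0 0 = 0
  · by_cases h' : l - g 1 1 = 0 ∧ g 1 0 = 0
    · refine ⟨![1, 0], ?_, ?_, ?_⟩
      · intro h0; have := congrFun h0 0; simp at this
      · simp; linear_combination -h.2
      · simp [h'.2]
    · refine ⟨![l - g 1 1, g 1 0], ?_, ?_, ?_⟩
      · intro h0
        exact h' ⟨by simpa using congrFun h0 0, by simpa using congrFun h0 1⟩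
      · simp; linear_combination -hl - hd
      · simp; ring
  · refine ⟨![g 0 1, l - g 0 0], ?_, ?_, ?_⟩
    · intro h0
      exact h ⟨by simpa using congrFun h0 0, by simpa using congrFun h0 1⟩
    · simp; ring
    · simp; linear_combination -hl - hd

theorem ncard_fixed [IsAlgClosed K] (g : SL2 K) (ht : (g 0 0 + g 1 1) ^ 2 ≠ 4) :
    (MulAction.fixedBy (ℙ K (Fin 2 → K)) g).ncard = 2 := by
  have hd := sl2_det g
  obtain ⟨l, hl⟩ : ∃ l : K, l ^ 2 - (g 0 0 + g 1 1) * l + 1 = 0 := by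
    obtain ⟨s, hs⟩ := IsAlgClosed.exists_pow_nat_eq ((g 0 0 + g 1 1) ^ 2 - 4) (n := 2) (by norm_num)
    by_cases h2 : (2 : K) = 0
    · obtain ⟨l, hl⟩ := IsAlgClosed.exists_root
        (Polynomial.X ^ 2 - Polynomial.C (g 0 0 + g 1 1) * Polynomial.X + Polynomial.C 1) (by
          have : (Polynomial.X ^ 2 - Polynomial.C (g 0 0 + g 1 1) * Polynomial.X
            + Polynomial.C 1 : Polynomial K).degree = 2 := by compute_degree!
          rw [this]; norm_num)
      refine ⟨l, ?_⟩
      simpa [Polynomial.IsRoot] using hl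
    · refine ⟨(g 0 0 + g 1 1 + s) / 2, ?_⟩
      field_simp
      linear_combination hs
  set t := g 0 0 + g 1 1 with htt
  obtain ⟨u, hu, hu0, hu1⟩ := eigen_exists g l hl
  obtain ⟨w, hw, hw0, hw1⟩ := eigen_exists g (t - l) (by linear_combination hl)
  have hne : l ≠ t - l := by
    intro h
    apply ht
    have : t = 2 * l := by linear_combination -h
    rw [this] at hl ⊢
    linear_combination -4 * hl
  have key : ∀ (a b : Fin 2 → K) (x y : K), g 0 0 * a 0 + g 0 1 * a 1 = x * a 0 →
      g 1 0 * a 0 + g 1 1 * a 1 = x * a 1 → g 0 0 * b 0 + g 0 1 * b 1 = y * b 0 →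
      g 1 0 * b 0 + g 1 1 * b 1 = y * b 1 → (x * y - 1) * (a 0 * b 1 - a 1 * b 0) = 0 := by
    intro a b x y h1 h2 h3 h4
    have : (x * a 0) * (y * b 1) - (x * a 1) * (y * b 0) = a 0 * b 1 - a 1 * b 0 := by
      rw [← h1, ← h2, ← h3, ← h4]
      linear_combination (a 0 * b 1 - a 1 * b 0) * hd
    linear_combination this
  rw [Set.ncard_eq_two]
  refine ⟨Projectivization.mk K u hu, Projectivization.mk K w hw, ?_, ?_⟩
  · intro h
    rw [Projectivization.mk_eq_mk_iff'] at h
    obtain ⟨a, ha⟩ := h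
    have e0 : u 0 = a * w 0 := by rw [← ha]; simp
    have e1 : u 1 = a * w 1 := by rw [← ha]; simp
    have d0 : (l - (t - l)) * u 0 = 0 := by
      have : g 0 0 * u 0 + g 0 1 * u 1 = (t - l) * u 0 := by
        rw [e0, e1]; linear_combination a * hw0
      linear_combination this - hu0
    have d1 : (l - (t - l)) * u 1 = 0 := by
      have : g 1 0 * u 0 + g 1 1 * u 1 = (t - l) * u 1 := by
        rw [e0, e1]; linear_combination a * hw1
      linear_combination this - hu1
    have hs := sub_ne_zero.2 hne
    rcases vec_ne_zero hu with h | h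
    · exact (mul_ne_zero hs h) d0
    · exact (mul_ne_zero hs h) d1
  · ext P
    induction P using Projectivization.ind with
    | h v hv =>
    rw [MulAction.mem_fixedBy, fixed_iff, Set.mem_insert_iff, Set.mem_singleton_iff, mk_eq_iff_det,
      mk_eq_iff_det]
    constructor
    · rintro ⟨x, h0, h1⟩
      have k1 := key v u x l h0 h1 hu0 hu1
      have k2 := key v w x (t - l) h0 h1 hw0 hw1
      rw [mul_eq_zero] at k1 k2
      by_contra hcon
      push Not at hcon
      have a1 := k1.resolve_right hcon.1
      have a2 := k2.resolve_right hcon.2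
      have hx : x ≠ 0 := by rintro rfl; simp at a1
      apply hne
      apply mul_left_cancel₀ hx
      linear_combination a1 - a2
    · rintro (h | h)
      · rw [← mk_eq_iff_det hv hu] at h
        rw [← fixed_iff g hv, h, fixed_iff]
        exact ⟨l, hu0, hu1⟩
      · rw [← mk_eq_iff_det hv hw] at h
        rw [← fixed_iff g hv, h, fixed_iff]
        exact ⟨_, hw0, hw1⟩

end tame

section tame
open scoped LinearAlgebra.Projectivization

variable {K : Type*} [Field K]

theorem tame_klein [IsAlgClosed K] (F : Subgroup (SL2 K)) [Finite F] (hF : (Nat.card F : K) ≠ 0)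
    (h2 : (2 : K) ≠ 0) :
    (∃ T : Subgroup (SL2 K), T ≤ F ∧ (T = F ∨ T.relIndex F = 2) ∧
      ∃ P : ℙ K (Fin 2 → K), ∀ g ∈ T, g • P = P) ∨ Nat.card F ∣ 240 := by
  classical
  have hpow : ∀ g ∈ F, g ^ Nat.card F = 1 := by
    intro g hg
    have := pow_card_eq_one' (x := (⟨g, hg⟩ : F))
    exact congrArg Subtype.val this
  let Z : Subgroup F := (Subgroup.zpowers (-1 : SL2 K)).subgroupOf F
  have hZmem : ∀ g : F, g ∈ Z ↔ (g : SL2 K) = 1 ∨ (g : SL2 K) = -1 := by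
    intro g
    rw [Subgroup.mem_subgroupOf, Subgroup.mem_zpowers_iff]
    constructor
    · rintro ⟨k, hk⟩
      rw [← hk]
      rcases Int.even_or_odd k with h | h
      · left; exact h.neg_one_zpow
      · right; exact h.neg_one_zpow
    · rintro (h | h)
      · exact ⟨0, by rw [h]; simp⟩
      · exact ⟨1, by rw [h]; simp⟩
  have hZcard : Nat.card Z ∣ 2 := by
    have h1 : Nat.card Z ∣ Nat.card (Subgroup.zpowers (-1 : SL2 K)) := by
      apply Subgroup.card_dvd_of_injective
        ((F.subtype.comp Z.subtype).codRestrict (Subgroup.zpowers (-1 : SL2 K))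
          (fun z => Subgroup.mem_subgroupOf.1 z.2))
      intro a b hab
      have := congrArg Subtype.val hab
      exact Subtype.ext (Subtype.ext this)
    refine h1.trans ?_
    rw [Nat.card_zpowers]
    exact orderOf_dvd_of_pow_eq_one (by simp)
  have htr : ∀ g : F, g ∉ Z → ((g : SL2 K) 0 0 + (g : SL2 K) 1 1) ^ 2 ≠ 4 := by
    intro g hg h4
    apply hg
    rw [hZmem]
    have : ((g : SL2 K) 0 0 + (g : SL2 K) 1 1 - 2) * ((g : SL2 K) 0 0 + (g : SL2 K) 1 1 + 2) = 0 := by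
      linear_combination h4
    rcases mul_eq_zero.1 this with h | h
    · left; exact tame_tr_two _ _ hF (hpow g g.2) (by linear_combination h)
    · right; exact tame_tr_neg_two _ _ hF h2 (hpow g g.2) (by linear_combination h)
  let Ω : SubMulAction F (ℙ K (Fin 2 → K)) :=
    { carrier := {P | ∃ g : F, g ∉ Z ∧ g • P = P}
      smul_mem' := by
        rintro x P ⟨g, hg, hgP⟩
        refine ⟨x * g * x⁻¹, ?_, ?_⟩
        · intro h
          apply hg
          rw [hZmem] at h ⊢
          simp only [Subgroup.coe_mul, Subgroup.coe_inv] at h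
          rcases h with h | h
          · left
            have : (g : SL2 K) = (x : SL2 K)⁻¹ * (x * g * (x : SL2 K)⁻¹) * x := by group
            rw [this, h]; simp
          · right
            have : (g : SL2 K) = (x : SL2 K)⁻¹ * (x * g * (x : SL2 K)⁻¹) * x := by group
            rw [this, h]; simp
        · rw [mul_smul, mul_smul, inv_smul_smul, hgP] }
  have hfixncard : ∀ g : F, g ∉ Z → (MulAction.fixedBy (ℙ K (Fin 2 → K)) (g : SL2 K)).ncard = 2 :=
    fun g hg => ncard_fixed _ (htr g hg)
  have hfin : Finite Ω := by
    have : ((Ω : Set (ℙ K (Fin 2 → K)))).Finite := by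
      have hsub : (Ω : Set (ℙ K (Fin 2 → K))) ⊆
          ⋃ g : {g : F // g ∉ Z}, MulAction.fixedBy (ℙ K (Fin 2 → K)) (g.1 : SL2 K) := by
        rintro P ⟨g, hg, hgP⟩
        exact Set.mem_iUnion.2 ⟨⟨g, hg⟩, hgP⟩
      refine Set.Finite.subset (Set.finite_iUnion fun g => ?_) hsub
      apply Set.finite_of_ncard_ne_zero
      rw [hfixncard g.1 g.2]; norm_num
    exact this
  have hb := burnside_abstract (Ω := Ω) Z ?_ ?_ ?_
  · rcases hb with ⟨ω, hω⟩ | ⟨ω, hω⟩ | ⟨g, hg, hcard⟩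
    · left
      refine ⟨F, le_rfl, Or.inl rfl, ω.1, ?_⟩
      intro g hg
      have : (⟨g, hg⟩ : F) ∈ MulAction.stabilizer F ω := by rw [hω]; trivial
      exact congrArg Subtype.val (MulAction.mem_stabilizer_iff.1 this)
    · left
      refine ⟨(MulAction.stabilizer F ω).map F.subtype, ?_, Or.inr ?_, ω.1, ?_⟩
      · exact Subgroup.map_subtype_le _
      · rw [Subgroup.relIndex, Subgroup.subgroupOf, Subgroup.comap_map_eq_self_of_injective
          F.subtype_injective, hω]
      · rintro _ ⟨g, hg, rfl⟩
        exact congrArg Subtype.val (MulAction.mem_stabilizer_iff.1 hg)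
    · right
      rw [hcard]
      have : 240 = 2 * 120 := by norm_num
      rw [this]
      refine mul_dvd_mul hZcard ?_
      simp only [Set.mem_insert_iff, Set.mem_singleton_iff] at hg
      rcases hg with rfl | rfl | rfl | rfl <;> decide
  · rintro z hz ⟨P, hP⟩
    apply Subtype.ext
    change (z : SL2 K) • P = P
    rcases (hZmem z).1 hz with h | h
    · rw [h, one_smul]
    · rw [h]
      induction P using Projectivization.ind with
      | h v hv =>
      rw [fixed_iff]
      refine ⟨-1, ?_, ?_⟩
      · simp
      · simp
  · intro g hg
    refine Eq.trans ?_ (hfixncard g hg)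
    rw [← Set.ncard_image_of_injective _ (Subtype.val_injective (p := fun x => x ∈ Ω))]
    congr 1
    ext P
    constructor
    · rintro ⟨ω, hω, rfl⟩
      exact congrArg Subtype.val hω
    · intro hP
      exact ⟨⟨P, g, hg, hP⟩, Subtype.ext hP, rfl⟩
  · rintro ⟨P, g, hg, hgP⟩
    exact ⟨g, hg, Subtype.ext hgP⟩

/-- A tame finite group fixing a line embeds in the multiplicative group. -/
theorem tame_char (T : Subgroup (SL2 K)) [Finite T] (hT : (Nat.card T : K) ≠ 0)
    (P : ℙ K (Fin 2 → K)) (hP : ∀ g ∈ T, g • P = P) :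
    ∃ φ : T →* K, Function.Injective φ ∧ ∀ g : T,
      φ g ^ 2 - ((g : SL2 K) 0 0 + (g : SL2 K) 1 1) * φ g + 1 = 0 := by
  induction P using Projectivization.ind with
  | h v hv =>
  obtain ⟨h, hh0, hh1⟩ := exists_col (v 0) (v 1) (vec_ne_zero hv)
  have hB : ∀ g ∈ T, h⁻¹ * g * h ∈ Bor K := by
    intro g hg
    obtain ⟨l, h0, h1⟩ := (fixed_iff g hv).1 (hP g hg)
    exact (conj_mem_Bor g h l (by rw [hh0, hh1]; exact h0) (by rw [hh0, hh1]; exact h1)).1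
  let ψ : T →* Bor K :=
    { toFun := fun g => ⟨h⁻¹ * g * h, hB g g.2⟩
      map_one' := by ext1; simp
      map_mul' := fun a b => by ext1; simp [mul_assoc] }
  refine ⟨(Units.coeHom K).comp ((borChar K).comp ψ), ?_, ?_⟩
  · rw [injective_iff_map_eq_one]
    rintro ⟨g, hg⟩ h1
    have h00 : (h⁻¹ * g * h) 0 0 = 1 := h1
    have h10 : (h⁻¹ * g * h) 1 0 = 0 := hB g hg
    have hua := Bor_eq_ua _ h10 h00
    have hgn : g ^ Nat.card T = 1 := by
      have := pow_card_eq_one' (x := (⟨g, hg⟩ : T))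
      exact congrArg Subtype.val this
    have hz : (h⁻¹ * g * h) 0 1 = 0 := by
      apply ua_pow_eq_one _ (Nat.card T) hT
      rw [← hua]; exact conj_pow_sl2 g h _ hgn
    rw [hz, ua_zero] at hua
    exact Subtype.ext (eq_one_of_conj g h hua)
  · rintro ⟨g, hg⟩
    change (h⁻¹ * g * h) 0 0 ^ 2 - (g 0 0 + g 1 1) * (h⁻¹ * g * h) 0 0 + 1 = 0
    have h10 : (h⁻¹ * g * h) 1 0 = 0 := hB g hg
    have hd := sl2_det (h⁻¹ * g * h)
    have hdh := sl2_det h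
    have htr : (h⁻¹ * g * h) 0 0 + (h⁻¹ * g * h) 1 1 = g 0 0 + g 1 1 := by
      simp only [mul_assoc, sl2_mul, sl2_inv_00, sl2_inv_01, sl2_inv_10, sl2_inv_11]
      linear_combination (g 0 0 + g 1 1) * hdh
    rw [h10] at hd
    rw [← htr]
    linear_combination -hd

end tame

theorem tame_class {p : ℕ} [Fact p.Prime] (hp2 : p ≠ 2) (F : Subgroup (SL2 (ZMod p)))
    (hF : ¬ p ∣ Nat.card F) :
    (∃ T : Subgroup (SL2 (ZMod p)), T ≤ F ∧ (T = F ∨ T.relIndex F = 2) ∧ IsCyclic T ∧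
      (Nat.card T ∣ p - 1 ∨ Nat.card T ∣ p + 1)) ∨ Nat.card F ∣ 240 := by
  let K := AlgebraicClosure (ZMod p)
  have hcK : CharP K p := charP_of_injective_algebraMap (algebraMap (ZMod p) K).injective p
  let j : SL2 (ZMod p) →* SL2 K := Matrix.SpecialLinearGroup.map (algebraMap (ZMod p) K)
  have hj : Function.Injective j := by
    intro a b hab
    apply sl2_ext
    all_goals
      apply (algebraMap (ZMod p) K).injective
    · exact congrArg (fun g : SL2 K => g 0 0) hab
    · exact congrArg (fun g : SL2 K => g 0 1) hab
    · exact congrArg (fun g : SL2 K => g 1 0) hab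
    · exact congrArg (fun g : SL2 K => g 1 1) hab
  have hcard : ∀ T : Subgroup (SL2 (ZMod p)), Nat.card (T.map j) = Nat.card T := fun T =>
    (Nat.card_congr (T.equivMapOfInjective j hj).toEquiv).symm
  have hfin : ∀ T : Subgroup (SL2 (ZMod p)), Finite (T.map j) := fun T =>
    Finite.of_equiv T (T.equivMapOfInjective j hj).toEquiv
  have := hfin F
  have h2 : (2 : K) ≠ 0 := by
    have : ((2 : ℕ) : K) ≠ 0 := by
      rw [Ne, CharP.cast_eq_zero_iff K p]
      intro h
      exact hp2 ((Nat.prime_dvd_prime_iff_eq Fact.out Nat.prime_two).1 h)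
    exact_mod_cast this
  rcases tame_klein (F.map j) (by rw [hcard, Ne, CharP.cast_eq_zero_iff K p]; exact hF) h2 with
    ⟨T', hT', hidx, P, hP⟩ | h
  · left
    obtain ⟨T, rfl⟩ : ∃ T : Subgroup (SL2 (ZMod p)), T' = T.map j := by
      refine ⟨T'.comap j, (Subgroup.map_comap_eq_self ?_).symm⟩
      exact hT'.trans (Subgroup.map_le_range j F)
    have hTF : T ≤ F := (Subgroup.map_le_map_iff_of_injective hj).1 hT'
    have := hfin T
    have hTp : ¬ p ∣ Nat.card T := fun h => hF (h.trans (Subgroup.card_dvd_of_le hTF))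
    obtain ⟨φ, hφ, hroot⟩ := tame_char (T.map j) (by rw [hcard, Ne, CharP.cast_eq_zero_iff K p]; exact hTp) P hP
    let φ' : T →* K := φ.comp (T.equivMapOfInjective j hj).toMonoidHom
    have hφ' : Function.Injective φ' := hφ.comp (T.equivMapOfInjective j hj).injective
    have hcyc : IsCyclic T := isCyclic_of_injective_ringHom φ' hφ'
    refine ⟨T, hTF, ?_, hcyc, ?_⟩
    · rcases hidx with h | h
      · left; exact Subgroup.map_injective hj h
      · right
        rwa [Subgroup.relIndex_map_map_of_injective _ _ hj] at h
    · obtain ⟨g, hg⟩ := hcyc.exists_ofOrder_eq_natCard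
      rw [← hg]
      set l := φ' g with hl
      have hpoly : l ^ 2 - algebraMap (ZMod p) K ((g : SL2 (ZMod p)) 0 0 + (g : SL2 (ZMod p)) 1 1) * l
          + 1 = 0 := by
        rw [map_add]
        exact hroot (T.equivMapOfInjective j hj g)
      set t := (g : SL2 (ZMod p)) 0 0 + (g : SL2 (ZMod p)) 1 1
      have hpoly2 : (l ^ p) ^ 2 - algebraMap (ZMod p) K t * l ^ p + 1 = 0 := by
        have h3 := congrArg (fun z => z ^ p) hpoly
        simp only [zero_pow (Nat.Prime.ne_zero (Fact.out : p.Prime))] at h3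
        rw [add_pow_char, sub_pow_char, mul_pow, ← map_pow (algebraMap (ZMod p) K), ZMod.pow_card, one_pow, ← pow_mul] at h3
        rw [← pow_mul, mul_comm p 2]; exact h3
      have hl0 : l ≠ 0 := by
        intro h0; rw [h0] at hpoly; simp at hpoly
      have hprod : (l ^ p - l) * (l ^ p * l - 1) = 0 := by
        linear_combination l * hpoly2 - l ^ p * hpoly
      have hp1 : 1 ≤ p := (Fact.out : p.Prime).one_le
      rcases mul_eq_zero.1 hprod with h | h
      · left
        apply orderOf_dvd_of_pow_eq_one
        apply hφ'
        rw [map_pow, map_one, ← hl]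
        apply mul_left_cancel₀ hl0
        rw [← pow_succ', Nat.sub_add_cancel hp1]
        linear_combination h
      · right
        apply orderOf_dvd_of_pow_eq_one
        apply hφ'
        rw [map_pow, map_one, ← hl, pow_succ]
        linear_combination h
  · right; rwa [hcard] at h

theorem chebS_two {R : Type*} [CommRing R] (t : R) (n : ℕ) :
    ∃ c, chebS t n = n + (n + 1).choose 3 * (t - 2) + (t - 2) ^ 2 * c := by
  induction n using Nat.twoStepInduction with
  | zero => exact ⟨0, by simp [chebS, Nat.choose]⟩
  | one => exact ⟨0, by simp [chebS, Nat.choose]⟩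
  | more n ih1 ih2 =>
    obtain ⟨a, ha⟩ := ih1
    obtain ⟨b, hb⟩ := ih2
    have e1 : (n + 2 + 1).choose 3 = (n + 1 + 1).choose 3 + (n + 2).choose 2 :=
      (Nat.choose_succ_succ (n + 2) 2).trans (add_comm _ _)
    have e2 : (n + 1 + 1).choose 3 = (n + 1).choose 3 + (n + 1).choose 2 :=
      (Nat.choose_succ_succ (n + 1) 2).trans (add_comm _ _)
    have e3 : (n + 2).choose 2 = (n + 1).choose 2 + (n + 1) := by
      rw [Nat.choose_succ_succ (n + 1) 1, Nat.choose_one_right, add_comm]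
    refine ⟨((n + 1 + 1).choose 3 : ℕ) + t * b - a, ?_⟩
    rw [chebS, ha, hb, e1]
    rw [e3]
    have e2' : (((n + 1 + 1).choose 3 : ℕ) : R) = (n + 1).choose 3 + (n + 1).choose 2 := by
      rw [e2]; push_cast; ring
    push_cast at e2' ⊢
    linear_combination (t - 2) * e2'

theorem pow_chebS {R : Type*} [CommRing R] (g : SL2 R) (n : ℕ) :
    (g ^ (n + 1)) 0 0 = chebS (g 0 0 + g 1 1) (n + 1) * g 0 0 - chebS (g 0 0 + g 1 1) n ∧
    (g ^ (n + 1)) 0 1 = chebS (g 0 0 + g 1 1) (n + 1) * g 0 1 ∧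
    (g ^ (n + 1)) 1 0 = chebS (g 0 0 + g 1 1) (n + 1) * g 1 0 ∧
    (g ^ (n + 1)) 1 1 = chebS (g 0 0 + g 1 1) (n + 1) * g 1 1 - chebS (g 0 0 + g 1 1) n := by
  have hd := sl2_det g
  induction n with
  | zero => simp [chebS]
  | succ n ih =>
    obtain ⟨h1, h2, h3, h4⟩ := ih
    set S := chebS (g 0 0 + g 1 1) (n + 1)
    set S' := chebS (g 0 0 + g 1 1) n
    have hS : chebS (g 0 0 + g 1 1) (n + 1 + 1) = (g 0 0 + g 1 1) * S - S' := by rw [chebS]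
    rw [hS, pow_succ (n := n + 1)]
    simp only [sl2_mul, h1, h2, h3, h4]
    refine ⟨?_, ?_, ?_, ?_⟩
    · linear_combination -S * hd
    · ring
    · ring
    · linear_combination -S * hd

/-- `g` is congruent to `ua (p^k)` modulo `p^(k+1)`. -/
def NearU {p e : ℕ} (k : ℕ) (g : SL2 (ZMod (p ^ e))) : Prop :=
  (p : ZMod (p ^ e)) ^ (k + 1) ∣ g 0 0 - 1 ∧ (p : ZMod (p ^ e)) ^ (k + 1) ∣ g 0 1 - p ^ k ∧
    (p : ZMod (p ^ e)) ^ (k + 1) ∣ g 1 0 ∧ (p : ZMod (p ^ e)) ^ (k + 1) ∣ g 1 1 - 1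

theorem NearU.pow {p e k : ℕ} (hp : p.Prime) (h5 : 5 ≤ p) {g : SL2 (ZMod (p ^ e))} (h : NearU k g) :
    NearU (k + 1) (g ^ p) := by
  obtain ⟨⟨a, ha⟩, ⟨b, hb⟩, ⟨c, hc⟩, ⟨d, hd⟩⟩ := h
  obtain ⟨n, rfl⟩ : ∃ n, p = n + 1 := ⟨p - 1, by omega⟩
  set P : ZMod ((n + 1) ^ e) := ((n + 1 : ℕ) : ZMod ((n + 1) ^ e)) with hP
  obtain ⟨h1, h2, h3, h4⟩ := pow_chebS g n
  obtain ⟨u, hu⟩ := chebS_two (g 0 0 + g 1 1) (n + 1)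
  obtain ⟨v, hv⟩ := chebS_two (g 0 0 + g 1 1) n
  have hx : g 0 0 + g 1 1 - 2 = P ^ (k + 1) * (a + d) := by linear_combination ha + hd
  rw [hx] at hu hv
  obtain ⟨s, hs⟩ : (n + 1) ∣ (n + 1 + 1).choose 3 := by
    rw [show (n + 1 + 1).choose 3 = (n + 1).choose 2 + (n + 1).choose 3 from
      Nat.choose_succ_succ (n + 1) 2]
    exact dvd_add (hp.dvd_choose_self (by norm_num) (by omega))
      (hp.dvd_choose_self (by norm_num) (by omega))
  obtain ⟨s', hs'⟩ : (n + 1) ∣ (n + 1).choose 3 := hp.dvd_choose_self (by norm_num) (by omega)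
  rw [hs] at hu
  rw [hs'] at hv
  push_cast at hu hv
  have hP' : (n : ZMod ((n + 1) ^ e)) = P - 1 := by rw [hP]; push_cast; ring
  rw [hP'] at hu hv
  set S := chebS (g 0 0 + g 1 1) (n + 1)
  set S' := chebS (g 0 0 + g 1 1) n
  have hS : S = P + P ^ (k + 2) * (s * (a + d) + P ^ k * (a + d) ^ 2 * u) := by
    rw [hu]; ring
  have hD : S - S' = 1 + P ^ (k + 2) * ((s - s') * (a + d) + P ^ k * (a + d) ^ 2 * (u - v)) := by
    rw [hu, hv]; ring
  set y := (s * (a + d) + P ^ k * (a + d) ^ 2 * u)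
  set z := ((s - s') * (a + d) + P ^ k * (a + d) ^ 2 * (u - v))
  refine ⟨⟨a + P ^ (k + 1) * y * a + z, ?_⟩, ⟨b + y + P * y * P ^ k * b + (P ^ k - 1) * y, ?_⟩, ⟨c + P ^ (k + 1) * y * c, ?_⟩,
    ⟨d + P ^ (k + 1) * y * d + z, ?_⟩⟩
  · rw [h1]; linear_combination S * ha + P ^ (k + 1) * a * hS + hD
  · rw [h2]; linear_combination S * hb + (P ^ (k + 1) * b + P ^ k) * hS
  · rw [h3]; linear_combination S * hc + P ^ (k + 1) * c * hS
  · rw [h4]; linear_combination S * hd + P ^ (k + 1) * d * hS + hD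

theorem close_mem {p e k : ℕ} (H : Subgroup (SL2 (ZMod (p ^ e)))) (hK : Kk p e k ≤ H)
    (g1 g2 : SL2 (ZMod (p ^ e))) (h1 : g1 ∈ H)
    (h00 : (p : ZMod (p ^ e)) ^ k ∣ g2 0 0 - g1 0 0) (h01 : (p : ZMod (p ^ e)) ^ k ∣ g2 0 1 - g1 0 1)
    (h10 : (p : ZMod (p ^ e)) ^ k ∣ g2 1 0 - g1 1 0)
    (h11 : (p : ZMod (p ^ e)) ^ k ∣ g2 1 1 - g1 1 1) : g2 ∈ H := by
  have hd := sl2_det g1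
  obtain ⟨a, ha⟩ := h00
  obtain ⟨b, hb⟩ := h01
  obtain ⟨c, hc⟩ := h10
  obtain ⟨d, hd'⟩ := h11
  have : g1⁻¹ * g2 ∈ H := by
    apply hK
    rw [mem_Kk]
    refine ⟨⟨g1 1 1 * a - g1 0 1 * c, ?_⟩, ⟨g1 1 1 * b - g1 0 1 * d, ?_⟩,
      ⟨- g1 1 0 * a + g1 0 0 * c, ?_⟩, ⟨- g1 1 0 * b + g1 0 0 * d, ?_⟩⟩ <;>
    simp only [sl2_mul, sl2_inv_00, sl2_inv_01, sl2_inv_10, sl2_inv_11]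
    · linear_combination g1 1 1 * ha - g1 0 1 * hc + hd
    · linear_combination g1 1 1 * hb - g1 0 1 * hd'
    · linear_combination - g1 1 0 * ha + g1 0 0 * hc
    · linear_combination - g1 1 0 * hb + g1 0 0 * hd' + hd
  have h2 := H.mul_mem h1 this
  rwa [mul_inv_cancel_left] at h2

/-- Serre's lemma. -/
theorem serre_lemma {p e : ℕ} [NeZero e] (hp : p.Prime) (h5 : 5 ≤ p)
    (H : Subgroup (SL2 (ZMod (p ^ e))))
    (hH : H.map (Matrix.SpecialLinearGroup.map (n := Fin 2) (redp p e)) = ⊤) : H = ⊤ := by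
  have : NeZero (p ^ e) := ⟨(pow_pos hp.pos _).ne'⟩
  have hlift : ∀ g : SL2 (ZMod p), ∃ y ∈ H, ∀ i j, redp p e (y i j) = g i j := by
    intro g
    have : g ∈ H.map (Matrix.SpecialLinearGroup.map (n := Fin 2) (redp p e)) := by rw [hH]; trivial
    obtain ⟨y, hy, rfl⟩ := this
    exact ⟨y, hy, fun i j => rfl⟩
  have hdv : ∀ a b : ZMod (p ^ e), redp p e a = redp p e b → (p : ZMod (p ^ e)) ∣ a - b := by
    intro a b hab
    rw [← redp_eq_zero_iff hp, map_sub, hab, sub_self]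
  obtain ⟨h, hhH, hh⟩ := hlift (ua 1)
  have hnear : ∀ k, NearU k (h ^ p ^ k) := by
    intro k
    induction k with
    | zero =>
      rw [pow_zero, pow_one]
      refine ⟨?_, ?_, ?_, ?_⟩ <;> rw [zero_add, pow_one]
      · exact hdv _ _ (by rw [hh, map_one]; rfl)
      · rw [pow_zero]; exact hdv _ _ (by rw [hh, map_one]; rfl)
      · rw [← redp_eq_zero_iff hp, hh]; rfl
      · exact hdv _ _ (by rw [hh, map_one]; rfl)
    | succ k ih =>
      rw [pow_succ, pow_mul]
      exact ih.pow hp h5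
  obtain ⟨y1, hy1, hy1'⟩ := hlift (⟨!![0, -1; 1, 0], by simp⟩)
  obtain ⟨y2, hy2, hy2'⟩ := hlift (la 1)
  obtain ⟨a1, ha1⟩ : (p : ZMod (p ^ e)) ∣ y1 0 0 := by
    rw [← redp_eq_zero_iff hp, hy1']; rfl
  obtain ⟨c1, hc1⟩ : (p : ZMod (p ^ e)) ∣ y1 1 0 - 1 := hdv _ _ (by rw [hy1', map_one]; rfl)
  obtain ⟨a2, ha2⟩ : (p : ZMod (p ^ e)) ∣ y2 0 0 - 1 := hdv _ _ (by rw [hy2', map_one]; rfl)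
  obtain ⟨c2, hc2⟩ : (p : ZMod (p ^ e)) ∣ y2 1 0 - 1 := hdv _ _ (by rw [hy2', map_one]; rfl)
  have hconj : ∀ (y : SL2 (ZMod (p ^ e))) (z : ZMod (p ^ e)),
      (y * ua z * y⁻¹) 0 0 = 1 - z * (y 0 0 * y 1 0) ∧ (y * ua z * y⁻¹) 0 1 = z * y 0 0 ^ 2 ∧
      (y * ua z * y⁻¹) 1 0 = - z * y 1 0 ^ 2 ∧ (y * ua z * y⁻¹) 1 1 = 1 + z * (y 0 0 * y 1 0) := by
    intro y z
    have hd := sl2_det y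
    simp only [sl2_mul, sl2_inv_00, sl2_inv_01, sl2_inv_10, sl2_inv_11, ua_00, ua_01, ua_10, ua_11]
    refine ⟨?_, ?_, ?_, ?_⟩
    · linear_combination hd
    · ring
    · ring
    · linear_combination hd
  have main : ∀ j k, 1 ≤ k → k + j = e → Kk p e k ≤ H := by
    intro j
    induction j with
    | zero =>
      intro k _ hk g hg
      have := CongOne.eq_one (mem_Kk.1 hg) (by omega)
      rw [this]; exact H.one_mem
    | succ j ih =>
      intro k hk hke
      have hK := ih (k + 1) (by omega) (by omega)
      obtain ⟨k', rfl⟩ : ∃ k', k = k' + 1 := ⟨k - 1, by omega⟩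
      set P : ZMod (p ^ e) := (p : ZMod (p ^ e)) with hP
      have hu1 : ua (P ^ (k' + 1)) ∈ H := by
        obtain ⟨⟨a, ha⟩, ⟨b, hb⟩, ⟨c, hc⟩, ⟨d, hd⟩⟩ := hnear (k' + 1)
        apply close_mem H hK (h ^ p ^ (k' + 1)) _ (H.pow_mem hhH _)
        · exact ⟨-a, by simp only [ua_00]; linear_combination -ha⟩
        · exact ⟨-b, by simp only [ua_01]; linear_combination -hb⟩
        · exact ⟨-c, by simp only [ua_10]; linear_combination -hc⟩
        · exact ⟨-d, by simp only [ua_11]; linear_combination -hd⟩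
      have hu : ∀ z, ua (P ^ (k' + 1) * z) ∈ H := by
        intro z
        have := H.pow_mem hu1 z.val
        rwa [ua_pow, ZMod.natCast_zmod_val, mul_comm] at this
      have hl : ∀ z, la (P ^ (k' + 1) * z) ∈ H := by
        intro z
        obtain ⟨e1, e2, e3, e4⟩ := hconj y1 (P ^ (k' + 1) * (-z))
        have hy00 : y1 0 0 = P * a1 := ha1
        have hy10 : y1 1 0 = 1 + P * c1 := by linear_combination hc1
        rw [hy00, hy10] at e1 e4
        rw [hy00] at e2
        rw [hy10] at e3
        apply close_mem H hK (y1 * ua (P ^ (k' + 1) * (-z)) * y1⁻¹) _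
          (H.mul_mem (H.mul_mem hy1 (hu _)) (H.inv_mem hy1))
        · exact ⟨-z * (a1 * (1 + P * c1)), by simp only [la_00]; rw [e1]; ring⟩
        · exact ⟨z * P * a1 ^ 2, by simp only [la_01]; rw [e2]; ring⟩
        · exact ⟨-z * (2 * c1 + P * c1 ^ 2), by simp only [la_10]; rw [e3]; ring⟩
        · exact ⟨z * (a1 * (1 + P * c1)), by simp only [la_11]; rw [e4]; ring⟩
      intro g hg
      obtain ⟨⟨α, hα⟩, ⟨β, hβ⟩, ⟨γ, hγ⟩, ⟨δ, hδ⟩⟩ := mem_Kk.1 hg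
      have hdg := sl2_det g
      set q := P ^ (k' + 1) with hq
      have hqq : q * q = P ^ (k' + 1 + 1) * P ^ k' := by rw [hq]; ring
      have hδ' : q * δ = - (q * α) + P ^ (k' + 1 + 1) * (P ^ k' * (β * γ - α * δ)) := by
        have g00 : g 0 0 = 1 + q * α := by linear_combination hα
        have g11 : g 1 1 = 1 + q * δ := by linear_combination hδ
        rw [g00, g11, hβ, hγ] at hdg
        linear_combination hdg + (β * γ - α * δ) * hqq
      obtain ⟨e1, e2, e3, e4⟩ := hconj y2 (q * (-α))
      have hy00 : y2 0 0 = 1 + P * a2 := by linear_combination ha2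
      have hy10 : y2 1 0 = 1 + P * c2 := by linear_combination hc2
      rw [hy00, hy10] at e1 e4
      rw [hy00] at e2
      rw [hy10] at e3
      have hx : y2 * ua (q * (-α)) * y2⁻¹ ∈ H := H.mul_mem (H.mul_mem hy2 (hu _)) (H.inv_mem hy2)
      set x := y2 * ua (q * (-α)) * y2⁻¹ with hxdef
      set s := P ^ (k' + 1 + 1) with hs
      have hqs : q * P = s := by rw [hq, hs]; ring
      have f1 : x 0 0 = 1 + q * α + s * (α * (a2 + c2 + P * a2 * c2)) := by
        rw [e1]; linear_combination α * (a2 + c2 + P * a2 * c2) * hqs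
      have f2 : x 0 1 = - q * α - s * (α * (2 * a2 + P * a2 ^ 2)) := by
        rw [e2]; linear_combination - α * (2 * a2 + P * a2 ^ 2) * hqs
      have f3 : x 1 0 = q * α + s * (α * (2 * c2 + P * c2 ^ 2)) := by
        rw [e3]; linear_combination α * (2 * c2 + P * c2 ^ 2) * hqs
      have f4 : x 1 1 = 1 - q * α - s * (α * (a2 + c2 + P * a2 * c2)) := by
        rw [e4]; linear_combination -α * (a2 + c2 + P * a2 * c2) * hqs
      set A1 := (α * (a2 + c2 + P * a2 * c2))
      set A2 := (α * (2 * a2 + P * a2 ^ 2))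
      set A3 := (α * (2 * c2 + P * c2 ^ 2))
      set r := P ^ k'
      clear_value x A1 A2 A3 r s q
      -- multiply by elementary matrices
      have hmem : x * ua (q * (β + α)) * la (q * (γ - α)) ∈ H :=
        H.mul_mem (H.mul_mem hx (hu _)) (hl _)
      apply close_mem H hK _ g hmem
      · rw [sl2_mul, sl2_mul, sl2_mul]
        simp only [ua_00, ua_01, ua_10, ua_11, la_00, la_01, la_10, la_11, f1, f2, f3, f4]
        refine ⟨-A1 - ((1 + q * α + s * A1) * (β + α) * (γ - α)) * r + (r * α + A2 * q) * (γ - α), ?_⟩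
        rw [show (p : ZMod (p ^ e)) ^ (k' + 1 + 1) = s from hs.symm]
        linear_combination hα + (-((1 + q * α + s * A1) * (β + α) * (γ - α)) + α * (γ - α)) * hqq
      · rw [sl2_mul, sl2_mul, sl2_mul]
        simp only [ua_00, ua_01, ua_10, ua_11, la_00, la_01, la_10, la_11, f1, f2, f3, f4]
        refine ⟨-(r * α * (β + α) + A1 * q * (β + α)) + A2, ?_⟩
        rw [show (p : ZMod (p ^ e)) ^ (k' + 1 + 1) = s from hs.symm]
        linear_combination hβ - α * (β + α) * hqq
      · rw [sl2_mul, sl2_mul, sl2_mul]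
        simp only [ua_00, ua_01, ua_10, ua_11, la_00, la_01, la_10, la_11, f1, f2, f3, f4]
        refine ⟨-A3 - r * (q * α + s * A3) * (β + α) * (γ - α) + (r * α + A1 * q) * (γ - α), ?_⟩
        rw [show (p : ZMod (p ^ e)) ^ (k' + 1 + 1) = s from hs.symm]
        linear_combination hγ + (-(q * α + s * A3) * (β + α) * (γ - α) + α * (γ - α)) * hqq
      · rw [sl2_mul, sl2_mul, sl2_mul]
        simp only [ua_00, ua_01, ua_10, ua_11, la_00, la_01, la_10, la_11, f1, f2, f3, f4]
        refine ⟨r * (β * γ - α * δ) + A1 - (r * α + A3 * q) * (β + α), ?_⟩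
        rw [show (p : ZMod (p ^ e)) ^ (k' + 1 + 1) = s from hs.symm]
        linear_combination hδ + hδ' - α * (β + α) * hqq
  rw [eq_top_iff]
  intro g _
  obtain ⟨y, hy, hy'⟩ := hlift (Matrix.SpecialLinearGroup.map (n := Fin 2) (redp p e) g)
  have he := NeZero.pos e
  apply close_mem H (main (e - 1) 1 le_rfl (by omega)) y g hy <;> rw [pow_one] <;>
    exact hdv _ _ (by rw [hy']; rfl)

/-- Structure data attached to a proper local subgroup. -/
structure BadData (p : ℕ) {G : Type} [Group G] (F : Subgroup G) where
  L : Type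
  [grp : Group L]
  [fin : Finite L]
  ρ : F →* L
  x : ℕ
  τ : Multiplicative (ZMod x) →* L
  w : ℕ
  surj : Function.Surjective ρ
  pker : IsPGroup p ρ.ker
  xpos : 0 < x
  xdvd : x ∣ p - 1 ∨ x ∣ p + 1
  norm : τ.range.Normal
  w2 : w ≤ 2
  case1 : w = 1 → τ.range = ⊤
  case2 : w = 2 → τ.range.index ∣ 2
  case0 : w = 0 → Nat.card L ∣ 240
  idxw : p ^ w ≤ 4 * F.index
  idx : p ≤ F.index

attribute [instance] BadData.grp BadData.fin

theorem zmod_range_of_cyclic {L : Type} [Group L] (T : Subgroup L) [IsCyclic T] :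
    ∃ τ : Multiplicative (ZMod (Nat.card T)) →* L, τ.range = T := by
  refine ⟨T.subtype.comp (zmodCyclicMulEquiv (inferInstance : IsCyclic T)).toMonoidHom, ?_⟩
  rw [MonoidHom.range_comp, MonoidHom.range_eq_top_of_surjective, ← MonoidHom.range_eq_map]
  · exact T.range_subtype
  · exact (zmodCyclicMulEquiv (inferInstance : IsCyclic T)).surjective

theorem idx_lower {p : ℕ} [Fact p.Prime] (F : Subgroup (SL2 (ZMod p))) (c : ℕ) (hc : Nat.card F ≤ c) :
    p ^ 2 * (p - 1) ≤ c * F.index := by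
  have h1 := F.card_mul_index
  have h2 := card_SL2_ge (p := p)
  rw [← h1] at h2
  exact h2.trans (Nat.mul_le_mul_right _ hc)

theorem classify0 {p : ℕ} [Fact p.Prime] (h17 : 17 ≤ p) (F : Subgroup (SL2 (ZMod p))) (hF : F ≠ ⊤) :
    Nonempty (BadData p F) := by
  have hp : p.Prime := Fact.out
  obtain ⟨r, rfl⟩ : ∃ r, p = r + 1 := ⟨p - 1, by omega⟩
  by_cases hpF : (r + 1) ∣ Nat.card F
  · obtain ⟨h, hh⟩ := borel_case F hF hpF
    let ψ : F →* Bor (ZMod (r + 1)) :=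
      { toFun := fun g => ⟨h⁻¹ * g * h, hh g g.2⟩
        map_one' := by ext1; simp
        map_mul' := fun a b => by ext1; simp [mul_assoc] }
    have hψ : Function.Injective ψ := by
      intro a b hab
      have h1 : h⁻¹ * (a : SL2 (ZMod (r + 1))) * h = h⁻¹ * b * h := congrArg Subtype.val hab
      exact Subtype.ext (mul_left_cancel (mul_right_cancel h1))
    let χ : F →* (ZMod (r + 1))ˣ := (borChar _).comp ψ
    have hcyc : IsCyclic χ.range := inferInstance
    obtain ⟨τ, hτ⟩ := zmod_range_of_cyclic (⊤ : Subgroup χ.range)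
    have hcard : Nat.card F ≤ (r + 1) * ((r + 1) - 1) :=
      (Nat.card_le_card_of_injective ψ hψ).trans card_Bor_le
    have hlow := idx_lower F _ hcard
    have hidx : r + 1 ≤ F.index := by
      have : (r + 1) * ((r + 1) - 1) * (r + 1) ≤ (r + 1) * ((r + 1) - 1) * F.index := by
        refine le_trans (le_of_eq ?_) hlow; ring
      exact Nat.le_of_mul_le_mul_left this (by simp; omega)
    refine ⟨{ L := χ.range
              ρ := χ.rangeRestrict
              x := _
              τ := τ
              w := 1
              surj := χ.rangeRestrict_surjective
              pker := ?_
              xpos := Nat.card_pos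
              xdvd := ?_
              norm := by rw [hτ]; infer_instance
              w2 := by norm_num
              case1 := fun _ => hτ
              case2 := by simp
              case0 := by simp
              idxw := by rw [pow_one]; omega
              idx := hidx }⟩
    · rintro ⟨g, hg⟩
      refine ⟨1, ?_⟩
      apply Subtype.ext
      apply hψ
      rw [MonoidHom.mem_ker] at hg
      have h1 : χ g = 1 := congrArg Subtype.val hg
      have h00 : ((ψ g : Bor _) : SL2 (ZMod (r + 1))) 0 0 = 1 := congrArg Units.val h1
      have h10 := mem_Bor.1 (ψ g).2
      have hua := Bor_eq_ua _ h10 h00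
      rw [pow_one]
      change ψ (g ^ (r + 1)) = ψ 1
      rw [map_pow, map_one]
      apply Subtype.ext
      change ((ψ g : Bor _) : SL2 (ZMod (r + 1))) ^ (r + 1) = 1
      rw [hua, ua_pow, CharP.cast_eq_zero, zero_mul, ua_zero]
    · left
      rw [Subgroup.card_top]
      have := Subgroup.card_subgroup_dvd_card χ.range
      rwa [Nat.card_eq_fintype_card (α := (ZMod (r + 1))ˣ), ZMod.card_units_eq_totient,
        Nat.totient_prime hp] at this
  · have hid : Function.Surjective (MonoidHom.id F) := fun x => ⟨x, rfl⟩
    have hkid : IsPGroup (r + 1) (MonoidHom.id F).ker := by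
      rintro ⟨g, hg⟩
      refine ⟨0, ?_⟩
      rw [MonoidHom.mem_ker] at hg
      apply Subtype.ext
      rw [pow_zero, pow_one]
      exact hg
    rcases tame_class (by omega) F hpF with ⟨T, hTF, hidx, hcyc, hdvd⟩ | h240
    · have hTle : Nat.card T ≤ r + 2 := by
        rcases hdvd with h | h
        · exact (Nat.le_of_dvd (by omega) h).trans (by omega)
        · exact (Nat.le_of_dvd (by omega) h)
      have hcyc' : IsCyclic (T.subgroupOf F) :=
        isCyclic_of_surjective _ (Subgroup.subgroupOfEquivOfLe hTF).symm.surjective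
      have hcc : Nat.card (T.subgroupOf F) = Nat.card T :=
        Nat.card_congr (Subgroup.subgroupOfEquivOfLe hTF).toEquiv
      obtain ⟨τ, hτ⟩ := zmod_range_of_cyclic (T.subgroupOf F)
      rcases hidx with rfl | hidx
      · have hlow := idx_lower T _ hTle
        have hidx : r + 1 ≤ T.index := by
          by_contra hlt
          push Not at hlt
          have : (r + 2) * T.index ≤ (r + 2) * r := Nat.mul_le_mul_left _ (by omega)
          have e : (r + 1) - 1 = r := by omega
          rw [e] at hlow
          nlinarith
        refine ⟨{ L := T
                  ρ := MonoidHom.id T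
                  x := _
                  τ := τ
                  w := 1
                  surj := hid
                  pker := hkid
                  xpos := Nat.card_pos
                  xdvd := by rwa [hcc]
                  norm := by rw [hτ]; simp [Subgroup.subgroupOf_self]
                  w2 := by norm_num
                  case1 := fun _ => by rw [hτ, Subgroup.subgroupOf_self]
                  case2 := by simp
                  case0 := by simp
                  idxw := by rw [pow_one]; omega
                  idx := hidx }⟩
      · have hFc : Nat.card F ≤ 2 * (r + 2) := by
          have := Subgroup.card_mul_index (T.subgroupOf F)
          rw [hcc, show (T.subgroupOf F).index = 2 from hidx] at this
          omega
        have hlow := idx_lower F _ hFc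
        have e : (r + 1) - 1 = r := by omega
        rw [e] at hlow
        have hnorm : (T.subgroupOf F).Normal := Subgroup.normal_of_index_eq_two hidx
        have hw : (r + 1) ^ 2 ≤ 4 * F.index := by
          by_contra hlt
          push Not at hlt
          nlinarith
        have hidx' : r + 1 ≤ F.index := by nlinarith
        exact ⟨{ L := F
                 ρ := MonoidHom.id F
                 x := _
                 τ := τ
                 w := 2
                 surj := hid
                 pker := hkid
                 xpos := Nat.card_pos
                 xdvd := by rwa [hcc]
                 norm := by rw [hτ]; exact hnorm
                 w2 := by norm_num
                 case1 := by simp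
                 case2 := fun _ => by rw [hτ]; exact dvd_of_eq hidx
                 case0 := by simp
                 idxw := hw
                 idx := hidx' }⟩
    · have hle : Nat.card F ≤ 240 := Nat.le_of_dvd (by norm_num) h240
      have hlow := idx_lower F _ hle
      have e : (r + 1) - 1 = r := by omega
      rw [e] at hlow
      have hidx : r + 1 ≤ F.index := by
        by_contra hlt
        push Not at hlt
        nlinarith
      exact ⟨{ L := F
               ρ := MonoidHom.id F
               x := 1
               τ := 1
               w := 0
               surj := hid
               pker := hkid
               xpos := one_pos
               xdvd := Or.inl (one_dvd _)
               norm := by rw [MonoidHom.range_one]; infer_instance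
               w2 := by norm_num
               case1 := by simp
               case2 := by simp
               case0 := fun _ => h240
               idxw := by rw [pow_zero]; omega
               idx := hidx }⟩

theorem redp_map_surjective {p : ℕ} (hp : p.Prime) (e : ℕ) [NeZero e] :
    Function.Surjective (Matrix.SpecialLinearGroup.map (n := Fin 2) (redp p e)) := by
  have := Fact.mk hp
  rw [← MonoidHom.range_eq_top]
  have hs : Function.Surjective (redp p e) := by
    intro a
    refine ⟨(a.val : ZMod (p ^ e)), ?_⟩
    rw [redp_natCast, ZMod.natCast_zmod_val]
  apply eq_top_of_elem
  · intro a
    obtain ⟨b, rfl⟩ := hs a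
    exact ⟨ua b, map_ua _ _⟩
  · intro a
    obtain ⟨b, rfl⟩ := hs a
    exact ⟨la b, map_la _ _⟩

theorem classify {p e : ℕ} [NeZero e] (hp : p.Prime) (h17 : 17 ≤ p)
    (F : Subgroup (SL2 (ZMod (p ^ e)))) (hF : F ≠ ⊤) : Nonempty (BadData p F) := by
  have := Fact.mk hp
  set R := Matrix.SpecialLinearGroup.map (n := Fin 2) (redp p e) with hR
  have hF' : F.map R ≠ ⊤ := fun h => hF (serre_lemma hp (by omega) F h)
  obtain ⟨B⟩ := classify0 h17 (F.map R) hF'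
  have hdvd : (F.map R).index ∣ F.index := F.index_map_dvd (redp_map_surjective hp e)
  have : NeZero (p ^ e) := ⟨(pow_pos hp.pos _).ne'⟩
  have hle : (F.map R).index ≤ F.index := Nat.le_of_dvd (Nat.pos_of_ne_zero F.index_ne_zero_of_finite) hdvd
  refine ⟨{ L := B.L
            ρ := B.ρ.comp (R.subgroupMap F)
            x := B.x
            τ := B.τ
            w := B.w
            surj := B.surj.comp (R.subgroupMap_surjective F)
            pker := ?_
            xpos := B.xpos
            xdvd := B.xdvd
            norm := B.norm
            w2 := B.w2
            case1 := B.case1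
            case2 := B.case2
            case0 := B.case0
            idxw := B.idxw.trans (Nat.mul_le_mul_left _ hle)
            idx := B.idx.trans hle }⟩
  rintro ⟨g, hg⟩
  rw [MonoidHom.mem_ker] at hg
  obtain ⟨k, hk⟩ := B.pker ⟨R.subgroupMap F g, hg⟩
  have hk' : R ((g : SL2 (ZMod (p ^ e))) ^ p ^ k) = 1 := by
    have := congrArg (fun z => ((z : B.ρ.ker) : F.map R).1) hk
    rw [map_pow]; exact this
  obtain ⟨k', hk''⟩ := isPGroup_Kp hp e ⟨_, hk'⟩
  refine ⟨k + k', ?_⟩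
  apply Subtype.ext
  apply Subtype.ext
  have := congrArg Subtype.val hk''
  change (g : SL2 (ZMod (p ^ e))) ^ p ^ (k + k') = 1
  rw [pow_add, pow_mul]; exact this

/-- A uniform bound for the rank of the local groups. -/
def cR : ℕ := 100000

theorem RankLE.gen {G : Type*} [Group G] {c : ℕ} (X : Subgroup G) (h : RankLE X c) :
    ∃ f : Fin c → G, Subgroup.closure (Set.range f) = X := by
  obtain ⟨f, hf⟩ := h ⊤
  refine ⟨fun i => f i, ?_⟩
  have : (Set.range fun i => (f i : G)) = X.subtype '' (Set.range f) := by
    rw [← Set.range_comp]; rfl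
  rw [this, ← MonoidHom.map_closure, hf, ← MonoidHom.range_eq_map, X.range_subtype]

theorem card_SL2_le (p : ℕ) [NeZero p] : Nat.card (SL2 (ZMod p)) ≤ p ^ 4 := by
  have h : Function.Injective (fun g : SL2 (ZMod p) => (g 0 0, g 0 1, g 1 0, g 1 1)) := by
    intro g h hgh
    simp only [Prod.mk.injEq] at hgh
    exact sl2_ext hgh.1 hgh.2.1 hgh.2.2.1 hgh.2.2.2
  refine (Nat.card_le_card_of_injective _ h).trans (le_of_eq ?_)
  simp only [Nat.card_prod, Nat.card_zmod]
  ring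

theorem rankLE_SL2_field {p : ℕ} (hp : p.Prime) : RankLE (SL2 (ZMod p)) (cR - 5) := by
  have := Fact.mk hp
  by_cases h17 : p < 17
  · apply rankLE_of_card
    refine (card_SL2_le p).trans ?_
    have : p ^ 4 ≤ 16 ^ 4 := Nat.pow_le_pow_left (by omega) 4
    exact this.trans (by norm_num [cR])
  · push Not at h17
    intro X
    by_cases hX : X = ⊤
    · have h2 : ∃ s : Set (SL2 (ZMod p)), s.Finite ∧ s.ncard ≤ cR - 5 ∧ Subgroup.closure s = X := by
        refine ⟨{ua 1, la 1}, Set.toFinite _, (Set.ncard_insert_le _ _).trans ?_, ?_⟩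
        · rw [Set.ncard_singleton]; norm_num [cR]
        · rw [hX]
          apply eq_top_of_elem
          · intro a
            have : ua a = ua 1 ^ a.val := by
              rw [ua_pow, ZMod.natCast_zmod_val, mul_one]
            rw [this]
            exact pow_mem (Subgroup.subset_closure (by simp)) _
          · intro a
            have : la a = la 1 ^ a.val := by
              rw [la_pow, ZMod.natCast_zmod_val, mul_one]
            rw [this]
            exact pow_mem (Subgroup.subset_closure (by simp)) _
      obtain ⟨s, hs, hc, h⟩ := h2
      obtain ⟨f, hf⟩ := exists_fin_range s hs hc
      exact ⟨f, hf.trans h⟩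
    · apply RankLE.gen
      by_cases hpX : p ∣ Nat.card X
      · obtain ⟨h, hh⟩ := borel_case X hX hpX
        have hB : ∀ q, q = p ^ 1 → RankLE (Bor (ZMod q)) 4 := by
          rintro q rfl; exact rankLE_Bor hp 1
        let ψ : X →* Bor (ZMod p) :=
          { toFun := fun g => ⟨h⁻¹ * g * h, hh g g.2⟩
            map_one' := by ext1; simp
            map_mul' := fun a b => by ext1; simp [mul_assoc] }
        have hψ : Function.Injective ψ := by
          intro a b hab
          have h1 : h⁻¹ * (a : SL2 (ZMod p)) * h = h⁻¹ * b * h := congrArg Subtype.val hab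
          exact Subtype.ext (mul_left_cancel (mul_right_cancel h1))
        exact (RankLE.of_injective ψ hψ (hB p (pow_one p).symm)).mono (by norm_num [cR])
      · rcases tame_class (by omega) X hpX with ⟨T, hTX, hidx, hcyc, -⟩ | h240
        · have hcyc' : IsCyclic (T.subgroupOf X) :=
            isCyclic_of_surjective _ (Subgroup.subgroupOfEquivOfLe hTX).symm.surjective
          rcases hidx with rfl | hidx
          · exact (rankLE_of_isCyclic (G := T)).mono (by norm_num [cR])
          · have hnorm : (T.subgroupOf X).Normal := Subgroup.normal_of_index_eq_two hidx
            refine (RankLE.ext (a := 1) (b := 2) (QuotientGroup.mk' (T.subgroupOf X)) ?_ ?_).mono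
              (by norm_num [cR])
            · rw [QuotientGroup.ker_mk']; exact rankLE_of_isCyclic
            · apply rankLE_of_card
              exact le_of_eq hidx
        · exact rankLE_of_card ((Nat.le_of_dvd (by norm_num) h240).trans (by norm_num [cR]))

theorem rankLE_SL2 {p : ℕ} (hp : p.Prime) (e : ℕ) [NeZero e] : RankLE (SL2 (ZMod (p ^ e))) cR := by
  have h : RankLE (SL2 (ZMod (p ^ e))) (5 + (cR - 5)) :=
    RankLE.ext (Matrix.SpecialLinearGroup.map (n := Fin 2) (redp p e)) (rankLE_Kp hp e)
      (rankLE_SL2_field hp)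
  exact h.mono (by norm_num [cR])

/-- Elements of the second derived subgroup of a bad local group have controlled order. -/
theorem BadData.derived_pow {p : ℕ} {G : Type} [Group G] {F : Subgroup G} (B : BadData p F)
    (g : F) (hg : g ∈ derivedSeries F 2) : ∃ k, g ^ (240 * p ^ k) = 1 := by
  have h240 : B.ρ (g ^ 240) = 1 := by
    by_cases hw : B.w = 0
    · obtain ⟨c, hc⟩ := B.case0 hw
      rw [map_pow, hc, pow_mul, pow_card_eq_one', one_pow]
    · have hidx : B.τ.range.index ∣ 2 := by
        have := B.w2
        have : B.w = 1 ∨ B.w = 2 := by omega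
        rcases this with h | h
        · rw [B.case1 h]; simp
        · exact B.case2 h
      have := B.norm
      have h1 : commutator B.L ≤ B.τ.range := by
        rcases (Nat.dvd_prime Nat.prime_two).1 hidx with h | h
        · rw [Subgroup.index_eq_one.1 h]; exact le_top
        · have hc : IsCyclic (B.L ⧸ B.τ.range) :=
            have := Fact.mk Nat.prime_two
            isCyclic_of_prime_card (p := 2) h
          letI := hc.commGroup
          have := Abelianization.commutator_subset_ker (QuotientGroup.mk' B.τ.range)
          rwa [QuotientGroup.ker_mk'] at this
      have h2 : derivedSeries B.L 2 = ⊥ := by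
        rw [derivedSeries_succ, derivedSeries_one, Subgroup.commutator_eq_bot_iff_le_centralizer]
        intro a ha
        rw [Subgroup.mem_centralizer_iff]
        intro b hb
        obtain ⟨a', rfl⟩ := h1 ha
        obtain ⟨b', rfl⟩ := h1 hb
        rw [← map_mul, ← map_mul, mul_comm]
      have h3 : B.ρ g ∈ derivedSeries B.L 2 :=
        map_derivedSeries_le_derivedSeries B.ρ 2 ⟨g, hg, rfl⟩
      rw [h2, Subgroup.mem_bot] at h3
      rw [map_pow, h3, one_pow]
  obtain ⟨k, hk⟩ := B.pker ⟨g ^ 240, h240⟩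
  refine ⟨k, ?_⟩
  rw [pow_mul]
  exact congrArg Subtype.val hk

/-- Large primes dividing the order of a local group at `q` divide `q^2-1`. -/
theorem prime_dvd_card {p q e : ℕ} [NeZero e] (hp : p.Prime) (hq : q.Prime) (h17 : 17 ≤ p)
    (hpq : p ≠ q) (hd : p ∣ Nat.card (SL2 (ZMod (q ^ e)))) :
    p ∣ q - 1 ∨ p ∣ q + 1 := by
  have := Fact.mk hp
  have := Fact.mk hq
  have : NeZero (q ^ e) := ⟨(pow_pos hq.pos _).ne'⟩
  obtain ⟨g, hg⟩ := exists_prime_orderOf_dvd_card' p hd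
  set R := Matrix.SpecialLinearGroup.map (n := Fin 2) (redp q e) with hR
  have hgp : g ^ p = 1 := by rw [← hg]; exact pow_orderOf_eq_one g
  have hne : R g ≠ 1 := by
    intro h1
    obtain ⟨k, hk⟩ := isPGroup_Kp hq e ⟨g, h1⟩
    have hk' : g ^ q ^ k = 1 := congrArg Subtype.val hk
    have h2 : orderOf g ∣ q ^ k := orderOf_dvd_of_pow_eq_one hk'
    rw [hg] at h2
    exact hpq ((Nat.prime_dvd_prime_iff_eq hp hq).1 (hp.dvd_of_dvd_pow h2))
  have ho : orderOf (R g) = p := orderOf_eq_prime (by rw [← map_pow, hgp, map_one]) hne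
  have hcC : Nat.card (Subgroup.zpowers (R g)) = p := by rw [Nat.card_zpowers, ho]
  by_cases hq2 : q = 2
  · exfalso
    subst hq2
    have h1 := (Subgroup.card_le_card_group (Subgroup.zpowers (R g)))
    have h2 := card_SL2_le 2
    rw [hcC] at h1
    have h3 : p ≤ 2 ^ 4 := h1.trans h2
    omega
  · rcases tame_class hq2 (Subgroup.zpowers (R g)) (by
      rw [hcC]; intro h; exact hpq ((Nat.prime_dvd_prime_iff_eq hq hp).1 h).symm) with
      ⟨T, hT, hidx, -, hdvd⟩ | h240
    · have hpT : p ∣ Nat.card T := by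
        rcases hidx with rfl | hidx
        · rw [hcC]
        · have h1 : Nat.card T * 2 = p := by
            have h2 := Subgroup.card_mul_index (T.subgroupOf (Subgroup.zpowers (R g)))
            rw [hcC, Nat.card_congr (Subgroup.subgroupOfEquivOfLe hT).toEquiv] at h2
            exact (congrArg (fun z => Nat.card T * z) hidx).symm.trans h2
          have : p ∣ Nat.card T * 2 := by rw [h1]
          rcases hp.dvd_mul.1 this with h | h
          · exact h
          · have := Nat.le_of_dvd (by norm_num) h; omega
      rcases hdvd with h | h
      · exact Or.inl (hpT.trans h)
      · exact Or.inr (hpT.trans h)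
    · exfalso
      rw [hcC] at h240
      have h3 : (240 : ℕ) = 2 ^ 4 * 3 * 5 := by norm_num
      rw [h3] at h240
      rcases hp.dvd_mul.1 h240 with h | h
      · rcases hp.dvd_mul.1 h with h | h
        · have := Nat.le_of_dvd (by norm_num) (hp.dvd_of_dvd_pow h); omega
        · have := Nat.le_of_dvd (by norm_num) h; omega
      · have := Nat.le_of_dvd (by norm_num) h; omega

theorem not_dvd_card_of_lt {p q e : ℕ} [NeZero e] (hp : p.Prime) (hq : q.Prime) (h17 : 17 ≤ p)
    (hpq : q < p) : ¬ p ∣ Nat.card (SL2 (ZMod (q ^ e))) := by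
  intro h
  rcases prime_dvd_card hp hq h17 hpq.ne' h with h | h
  · have := hq.two_le
    have := Nat.le_of_dvd (by omega) h
    omega
  · have h1 := Nat.le_of_dvd (by omega) h
    have h2 : p = q + 1 := by omega
    rcases hq.eq_two_or_odd with h3 | h3
    · omega
    · rcases hp.eq_two_or_odd with h4 | h4 <;> omega

theorem not_dvd_240 {p : ℕ} (hp : p.Prime) (h17 : 17 ≤ p) : ¬ p ∣ 240 := by
  intro h240
  have h3 : (240 : ℕ) = 2 ^ 4 * 3 * 5 := by norm_num
  rw [h3] at h240
  rcases hp.dvd_mul.1 h240 with h | h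
  · rcases hp.dvd_mul.1 h with h | h
    · have := Nat.le_of_dvd (by norm_num) (hp.dvd_of_dvd_pow h); omega
    · have := Nat.le_of_dvd (by norm_num) h; omega
  · have := Nat.le_of_dvd (by norm_num) h; omega

theorem derived_SL2_top {p : ℕ} [Fact p.Prime] (h17 : 17 ≤ p) :
    derivedSeries (SL2 (ZMod p)) 2 = ⊤ := by
  have h0 : ∀ k : ℕ, 0 < k → k < 17 → ((k : ℕ) : ZMod p) ≠ 0 := by
    intro k hk hk17 h
    rw [ZMod.natCast_eq_zero_iff] at h
    have := Nat.le_of_dvd hk h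
    omega
  have hc : commutator (SL2 (ZMod p)) = ⊤ := by
    apply Matrix.SL2.commutator_eq_top (a := (2 : ZMod p))
    · exact_mod_cast h0 2 (by norm_num) (by norm_num)
    · intro h
      apply h0 3 (by norm_num) (by norm_num)
      push_cast
      linear_combination h
  rw [derivedSeries_succ, derivedSeries_one, hc, ← commutator_def, hc]

section
variable {ι : Type} [Fintype ι] [DecidableEq ι] (p e : ι → ℕ)

/-- If a large prime has full projection, the whole factor lies in the subgroup. -/
theorem good_mem [∀ i, NeZero (e i)] (hp : ∀ i, (p i).Prime) (hinj : Function.Injective p)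
    (H : Subgroup (∀ i, SL2 (ZMod (p i ^ e i)))) (i : ι) (h17 : 17 ≤ p i)
    (hfull : H.map (Pi.evalMonoidHom _ i) = ⊤) (g : SL2 (ZMod (p i ^ e i))) :
    Pi.mulSingle i g ∈ H := by
  classical
  let good : ι → Prop := fun i => 17 ≤ p i ∧ H.map (Pi.evalMonoidHom _ i) = ⊤
  suffices hall : ∀ i, good i → ∀ g, Pi.mulSingle i g ∈ H from hall i ⟨h17, hfull⟩ g
  by_contra hcon
  push Not at hcon
  obtain ⟨i₀, hi₀, hg₀⟩ := hcon
  let V : Finset ι := Finset.univ.filter fun i => good i ∧ ∃ g, Pi.mulSingle i g ∉ H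
  have hV : V.Nonempty := ⟨i₀, by simp [V, hi₀]; exact hg₀⟩
  obtain ⟨i, hiV, hmax⟩ := V.exists_max_image p hV
  obtain ⟨hgood, g, hg⟩ : good i ∧ ∃ g, Pi.mulSingle i g ∉ H := by simpa [V] using hiV
  have hlarge : ∀ j, good j → p i < p j → ∀ g, Pi.mulSingle j g ∈ H := by
    intro j hj hij g
    by_contra hgj
    have := hmax j (by simp only [V, Finset.mem_filter, Finset.mem_univ, true_and]; exact ⟨hj, g, hgj⟩)
    omega
  clear hmax hiV hV hi₀ hg₀
  obtain ⟨h17, hfull⟩ := hgood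
  apply hg
  have := fun i => Fact.mk (hp i)
  have hNZ : ∀ i, NeZero (p i ^ e i) := fun i => ⟨(pow_pos (hp i).pos _).ne'⟩
  -- find h in second derived subgroup
  set R := Matrix.SpecialLinearGroup.map (n := Fin 2) (redp (p i) (e i)) with hR
  have hRs : Function.Surjective R := redp_map_surjective (hp i) (e i)
  have hEv : ∀ g : SL2 (ZMod (p i ^ e i)), ∃ h ∈ H, h i = g := by
    intro g
    have : g ∈ H.map (Pi.evalMonoidHom _ i) := by rw [hfull]; trivial
    obtain ⟨h, hh, hh'⟩ := this
    exact ⟨h, hh, hh'⟩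
  let φ : H →* SL2 (ZMod (p i)) := (R.comp (Pi.evalMonoidHom _ i)).comp H.subtype
  have hφ : Function.Surjective φ := by
    intro y
    obtain ⟨g, rfl⟩ := hRs y
    obtain ⟨h, hh, rfl⟩ := hEv g
    exact ⟨⟨h, hh⟩, rfl⟩
  have hder := map_derivedSeries_eq hφ 2
  rw [derived_SL2_top h17] at hder
  obtain ⟨h, hh, hhφ⟩ : ua (1 : ZMod (p i)) ∈ (derivedSeries H 2).map φ := by rw [hder]; trivial
  have hN : ∀ j, ∃ N, (p i).Coprime N ∧ (j ≠ i → ¬ (good j ∧ p i < p j) →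
      ((h : ∀ i, SL2 (ZMod (p i ^ e i))) j) ^ N = 1) := by
    intro j
    by_cases hji : j = i
    · exact ⟨1, by simp, fun h => absurd hji h⟩
    by_cases hgj : good j ∧ p i < p j
    · exact ⟨1, by simp, fun _ h => absurd hgj h⟩
    by_cases hlt : p i < p j
    · have hbad : H.map (Pi.evalMonoidHom _ j) ≠ ⊤ := fun hf => hgj ⟨⟨by omega, hf⟩, hlt⟩
      obtain ⟨B⟩ := classify (hp j) (by omega) _ hbad
      let ψ : H →* H.map (Pi.evalMonoidHom _ j) := (Pi.evalMonoidHom _ j).subgroupMap H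
      have h1 : ψ h ∈ derivedSeries _ 2 :=
        map_derivedSeries_le_derivedSeries ψ 2 ⟨h, hh, rfl⟩
      obtain ⟨k, hk⟩ := B.derived_pow _ h1
      refine ⟨240 * p j ^ k, ?_, fun _ _ => congrArg Subtype.val hk⟩
      rw [Nat.coprime_mul_iff_right]
      refine ⟨((hp i).coprime_iff_not_dvd).2 (not_dvd_240 (hp i) h17), ?_⟩
      exact Nat.Coprime.pow_right _ ((Nat.coprime_primes (hp i) (hp j)).2 (by omega))
    · have hlt' : p j < p i := by
        have : p j ≠ p i := fun h => hji (hinj h)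
        omega
      exact ⟨Nat.card (SL2 (ZMod (p j ^ e j))),
        ((hp i).coprime_iff_not_dvd).2 (not_dvd_card_of_lt (hp i) (hp j) h17 hlt'),
        fun _ _ => pow_card_eq_one'⟩
  choose N hNc hN1 using hN
  let M := ∏ j, N j
  have hMc : (p i).Coprime M := Nat.Coprime.prod_right fun j _ => hNc j
  let y : ∀ i, SL2 (ZMod (p i ^ e i)) := fun j => if good j ∧ p i < p j then ((h : ∀ i, SL2 (ZMod (p i ^ e i))) j)⁻¹ else 1
  have hy : y ∈ H := by
    apply Subgroup.pi_mem_of_mulSingle_mem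
    intro j
    by_cases hj : good j ∧ p i < p j
    · exact hlarge j hj.1 hj.2 _
    · simp only [y, if_neg hj, Pi.mulSingle_one]; exact one_mem _
  have hpow : (h * y : ∀ i, SL2 (ZMod (p i ^ e i))) ^ M =
      Pi.mulSingle i (((h : ∀ i, SL2 (ZMod (p i ^ e i))) i) ^ M) := by
    funext j
    by_cases hji : j = i
    · subst hji
      simp [y]
    · rw [Pi.mulSingle_eq_of_ne hji, Pi.pow_apply, Pi.mul_apply]
      by_cases hj : good j ∧ p i < p j
      · simp only [y, if_pos hj, mul_inv_cancel, one_pow]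
      · simp only [y, if_neg hj, mul_one]
        have : M = N j * ∏ k ∈ Finset.univ.erase j, N k :=
          (Finset.mul_prod_erase _ _ (Finset.mem_univ j)).symm
        rw [this, pow_mul, hN1 j hji hj, one_pow]
  let K : Subgroup (SL2 (ZMod (p i ^ e i))) := H.comap (MonoidHom.mulSingle (fun i => SL2 (ZMod (p i ^ e i))) i)
  have hKmem : ∀ g, g ∈ K ↔ Pi.mulSingle i g ∈ H := fun g => Iff.rfl
  have hKh : ((h : ∀ i, SL2 (ZMod (p i ^ e i))) i) ^ M ∈ K := by
    rw [hKmem, ← hpow]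
    exact pow_mem (mul_mem h.2 hy) _
  have hKn : ∀ g k, k ∈ K → g * k * g⁻¹ ∈ K := by
    intro g k hk
    obtain ⟨h, hh, rfl⟩ := hEv g
    rw [hKmem] at hk ⊢
    have : Pi.mulSingle i (h i * k * (h i)⁻¹) = h * Pi.mulSingle i k * h⁻¹ := by
      funext j
      by_cases hji : j = i
      · subst hji; simp
      · simp [Pi.mulSingle_eq_of_ne hji]
    rw [this]
    exact mul_mem (mul_mem hh hk) (inv_mem hh)
  have hM0 : ((M : ℕ) : ZMod (p i)) ≠ 0 := by
    intro h0
    rw [ZMod.natCast_eq_zero_iff] at h0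
    exact ((hp i).coprime_iff_not_dvd).1 hMc h0
  have hua : ua ((M : ℕ) : ZMod (p i)) ∈ K.map R := by
    refine ⟨_, hKh, ?_⟩
    rw [map_pow]
    have h1 : R ((h : ∀ i, SL2 (ZMod (p i ^ e i))) i) = ua 1 := hhφ
    rw [h1, ua_pow, mul_one]
  have hconj : la (1 : ZMod (p i)) * ua ((M : ℕ) : ZMod (p i)) * (la 1)⁻¹ ∈ K.map R := by
    obtain ⟨k, hk, hkk⟩ := hua
    refine ⟨la 1 * k * (la 1)⁻¹, hKn _ _ hk, ?_⟩
    rw [map_mul, map_mul, map_inv, hkk, hR, map_la, map_one]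
  have htop : K.map R = ⊤ := by
    apply eq_top_of_two _ _ hM0 hua _ hconj
    rw [la_inv]
    simp only [sl2_mul, la_00, la_01, la_10, la_11, ua_00, ua_01, ua_10, ua_11]
    intro h0
    apply hM0
    linear_combination -h0
  have hK : K = ⊤ := serre_lemma (hp i) (by omega) K htop
  have : g ∈ K := by rw [hK]; trivial
  exact this

end

/-- Subgroups of the finite product of index at most `n` with proper projections at large primes. -/
def SubM {ι : Type} (p e : ι → ℕ) (n : ℕ) : Set (Subgroup (∀ i, SL2 (ZMod (p i ^ e i)))) :=
  {H | H.index ≤ n ∧ ∀ i, 17 ≤ p i → H.map (Pi.evalMonoidHom _ i) ≠ ⊤}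

theorem CongOne.weaken {q f : ℕ} {k l : ℕ} (hkl : k ≤ l) {g : SL2 (ZMod (q ^ f))} (h : CongOne l g) :
    CongOne k g :=
  ⟨(pow_dvd_pow _ hkl).trans h.1, (pow_dvd_pow _ hkl).trans h.2.1, (pow_dvd_pow _ hkl).trans h.2.2.1,
    (pow_dvd_pow _ hkl).trans h.2.2.2⟩

theorem prod_small_le {ι : Type} [Fintype ι] (p : ι → ℕ) (hinj : Function.Injective p) :
    ∏ i, (if p i < 17 then 17 else 1) ≤ 17 ^ 17 := by
  rw [Finset.prod_ite, Finset.prod_const, Finset.prod_const, one_pow, mul_one]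
  apply Nat.pow_le_pow_right (by norm_num)
  have : (Finset.univ.filter fun i => p i < 17).card ≤ (Finset.range 17).card := by
    apply Finset.card_le_card_of_injOn p
    · intro i hi
      simp only [Finset.coe_filter, Finset.mem_univ, true_and, Set.mem_ofPred_eq] at hi
      simpa using hi
    · exact hinj.injOn
  simpa using this

theorem prod_map_index_le {ι : Type} [Fintype ι] (G : ι → Type) [∀ i, Group (G i)]
    [∀ i, Finite (G i)] (H : Subgroup (∀ i, G i)) :
    ∏ i, (H.map (Pi.evalMonoidHom _ i)).index ≤ H.index := by
  classical
  rw [← index_pi_subgroup]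
  apply Subgroup.index_antitone
  intro h hh i _
  exact ⟨h, hh, rfl⟩

theorem relIndex_normal_dvd {G : Type*} [Group G] [Finite G] (H N : Subgroup G) [N.Normal] :
    H.relIndex N ∣ H.index := by
  have h1 : H.relIndex N * N.index = (H ⊓ N).index := by
    rw [← Subgroup.inf_relIndex_right]
    exact Subgroup.relIndex_mul_index inf_le_right
  have h2 : N.relIndex H * H.index = (H ⊓ N).index := by
    rw [← Subgroup.inf_relIndex_right, inf_comm]
    exact Subgroup.relIndex_mul_index inf_le_left
  obtain ⟨z, hz⟩ := Subgroup.relIndex_dvd_index_of_normal N H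
  refine ⟨z, ?_⟩
  have h3 : 0 < N.relIndex H := Nat.pos_of_ne_zero (Subgroup.index_ne_zero_of_finite (H := N.subgroupOf H))
  apply Nat.eq_of_mul_eq_mul_left h3
  rw [h2, ← h1, hz]
  ring

theorem level_bound {ι : Type} [Fintype ι] [DecidableEq ι] (p e : ι → ℕ) [∀ i, NeZero (e i)]
    (hp : ∀ i, (p i).Prime) (hinj : Function.Injective p)
    (H : Subgroup (∀ i, SL2 (ZMod (p i ^ e i)))) (n : ℕ) (hn : H.index ≤ n)
    (hmin : ∀ i, ¬ ∀ g, CongOne (e i - 1) g → Pi.mulSingle i g ∈ H) :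
    H ∈ SubM p e n ∧ ∏ i, p i ^ e i ≤ 17 ^ 34 * n ^ 4 := by
  have hNZ : ∀ i, NeZero (p i ^ e i) := fun i => ⟨(pow_pos (hp i).pos _).ne'⟩
  have hbad : ∀ i, 17 ≤ p i → H.map (Pi.evalMonoidHom _ i) ≠ ⊤ :=
    fun i h17 hf => hmin i fun g _ => good_mem p e hp hinj H i h17 hf g
  refine ⟨⟨hn, hbad⟩, ?_⟩
  have ha : ∀ i, ∃ a, p i ^ a ∣ H.index ∧ e i ≤ 2 * a + 2 := by
    intro i
    have := Fact.mk (hp i)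
    let f := MonoidHom.mulSingle (fun i => SL2 (ZMod (p i ^ e i))) i
    let A := H.comap f
    obtain ⟨b, hb⟩ := IsPGroup.iff_card.1 (isPGroup_Kp (hp i) (e i))
    have h1 : A.relIndex (Kp (p i) (e i)) ∣ p i ^ b := by
      rw [← hb]; exact Subgroup.relIndex_dvd_card _ _
    obtain ⟨a, -, ha⟩ := (Nat.dvd_prime_pow (hp i)).1 h1
    refine ⟨a, ?_, ?_⟩
    · rw [← ha, Subgroup.relIndex_comap]
      have : ((Kp (p i) (e i)).map f).Normal := by
        constructor
        rintro _ ⟨k, hk, rfl⟩ g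
        refine ⟨g i * k * (g i)⁻¹, (inferInstance : (Kp (p i) (e i)).Normal).conj_mem _ hk _, ?_⟩
        funext j
        change (Pi.mulSingle i (g i * k * (g i)⁻¹) : ∀ i, SL2 (ZMod (p i ^ e i))) j = g j * (Pi.mulSingle i k : ∀ i, SL2 (ZMod (p i ^ e i))) j * (g j)⁻¹
        by_cases hji : j = i
        · subst hji; simp
        · simp [Pi.mulSingle_eq_of_ne hji]
      exact relIndex_normal_dvd _ _
    · by_contra hlt
      push Not at hlt
      exact hmin i fun g hg => level_mem (hp i) (e i) A a (le_of_eq ha) g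
        (hg.weaken (by omega))
  choose a had hae using ha
  have hpos : 0 < H.index := Nat.pos_of_ne_zero H.index_ne_zero_of_finite
  have h1 : ∏ i, p i ^ a i ≤ n := by
    refine (Nat.le_of_dvd hpos ?_).trans hn
    apply Finset.prod_dvd_of_isRelPrime
    · intro i _ j _ hij
      exact Nat.coprime_iff_isRelPrime.1
        (Nat.Coprime.pow _ _ ((Nat.coprime_primes (hp i) (hp j)).2 fun h => hij (hinj h)))
    · intro i _; exact had i
  have h2 : ∏ i, p i ≤ 17 ^ 17 * n := by
    calc ∏ i, p i ≤ ∏ i, (if p i < 17 then 17 else 1) * (H.map (Pi.evalMonoidHom _ i)).index := by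
          apply Finset.prod_le_prod' 
          intro i _
          split_ifs with h
          · have := Nat.pos_of_ne_zero (H.map (Pi.evalMonoidHom _ i)).index_ne_zero_of_finite
            nlinarith
          · obtain ⟨B⟩ := classify (hp i) (by omega) _ (hbad i (by omega))
            rw [one_mul]; exact B.idx
      _ ≤ 17 ^ 17 * n := by
          rw [Finset.prod_mul_distrib]
          exact Nat.mul_le_mul (prod_small_le p hinj) ((prod_map_index_le _ H).trans hn)
  calc ∏ i, p i ^ e i ≤ ∏ i, ((p i ^ a i) ^ 2 * (p i) ^ 2) := by
        apply Finset.prod_le_prod'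
        intro i _
        rw [← pow_mul, ← pow_add]
        exact Nat.pow_le_pow_right (hp i).pos (by have := hae i; omega)
    _ = (∏ i, p i ^ a i) ^ 2 * (∏ i, p i) ^ 2 := by
        rw [Finset.prod_mul_distrib, Finset.prod_pow, Finset.prod_pow]
    _ ≤ n ^ 2 * (17 ^ 17 * n) ^ 2 := Nat.mul_le_mul (Nat.pow_le_pow_left h1 2) (Nat.pow_le_pow_left h2 2)
    _ = 17 ^ 34 * n ^ 4 := by ring

/-- The primes dividing `m`. -/
abbrev pOf (m : ℕ) : m.primeFactors → ℕ := fun i => i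
/-- The exponents in `m`. -/
abbrev eOf (m : ℕ) : m.primeFactors → ℕ := fun i => m.factorization i

instance neZero_eOf (m : ℕ) (i : m.primeFactors) : NeZero (eOf m i) :=
  ⟨by
    have h : (i : ℕ) ∈ m.factorization.support := by
      rw [Nat.support_factorization]; exact i.2
    exact Finsupp.mem_support_iff.1 h⟩

theorem prod_pOf {m : ℕ} (hm : m ≠ 0) : ∏ i, pOf m i ^ eOf m i = m := by
  have := Nat.prod_factorization_pow_eq_self hm
  rw [Finsupp.prod, Nat.support_factorization] at this
  rw [← Finset.prod_attach] at this
  exact this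

theorem cong_count_le (n : ℕ) :
    Nat.card {H : Subgroup (SL2 ℤ) // (∃ m : ℕ, 1 ≤ m ∧
      (Matrix.SpecialLinearGroup.map (n := Fin 2) (Int.castRingHom (ZMod m))).ker ≤ H) ∧ H.index ≤ n} ≤
    ∑ m ∈ Finset.Icc 1 (17 ^ 34 * n ^ 4), (SubM (pOf m) (eOf m) n).ncard := by
  classical
  have hfin : ∀ m, Finite (Subgroup (∀ i : m.primeFactors, SL2 (ZMod (pOf m i ^ eOf m i)))) := by
    intro m
    have hp : ∀ i : m.primeFactors, (pOf m i).Prime := fun i => Nat.prime_of_mem_primeFactors i.2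
    have hNZ : ∀ i, NeZero (pOf m i ^ eOf m i) := fun i => ⟨(pow_pos (hp i).pos _).ne'⟩
    infer_instance
  set S := {H : Subgroup (SL2 ℤ) | (∃ m : ℕ, 1 ≤ m ∧
      (Matrix.SpecialLinearGroup.map (n := Fin 2) (Int.castRingHom (ZMod m))).ker ≤ H) ∧ H.index ≤ n} with hS
  have hsub : S ⊆ ⋃ m ∈ Finset.Icc 1 (17 ^ 34 * n ^ 4),
      (fun K => K.comap (redAll (pOf m) (eOf m))) '' (SubM (pOf m) (eOf m) n) := by
    rintro H ⟨hex, hidx⟩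
    obtain ⟨m, hmdef⟩ : ∃ m, m = Nat.find hex := ⟨_, rfl⟩
    obtain ⟨hm1, hmH⟩ : 1 ≤ m ∧
      (Matrix.SpecialLinearGroup.map (n := Fin 2) (Int.castRingHom (ZMod m))).ker ≤ H := by
      rw [hmdef]; exact Nat.find_spec hex
    have hmin : ∀ m', 0 < m' → m' < m → ¬
      (Matrix.SpecialLinearGroup.map (n := Fin 2) (Int.castRingHom (ZMod m'))).ker ≤ H :=
      fun m' h0 hlt hle => Nat.find_min hex (hmdef ▸ hlt) ⟨h0, hle⟩
    have hp : ∀ i : m.primeFactors, (pOf m i).Prime := fun i => Nat.prime_of_mem_primeFactors i.2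
    have hNZ : ∀ i, NeZero (pOf m i ^ eOf m i) := fun i => ⟨(pow_pos (hp i).pos _).ne'⟩
    have hinj : Function.Injective (pOf m) := Subtype.val_injective
    have hm := prod_pOf (m := m) (by omega)
    have hker : (redAll (pOf m) (eOf m)).ker ≤ H := by
      rw [redAll_ker hp hinj, hm]; exact hmH
    have hcm : (H.map (redAll (pOf m) (eOf m))).comap (redAll (pOf m) (eOf m)) = H :=
      Subgroup.comap_map_eq_self hker
    have hidx' : (H.map (redAll (pOf m) (eOf m))).index = H.index := by
      rw [Subgroup.index_map, sup_eq_left.2 hker, MonoidHom.range_eq_top.2 (redAll_surjective hp hinj)]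
      simp
    obtain ⟨h1, h2⟩ := level_bound (pOf m) (eOf m) hp hinj (H.map (redAll (pOf m) (eOf m))) n
      (by rw [hidx']; exact hidx) (fun i => minimal_level hp hinj H m hm.symm hmin hmH i)
    rw [hm] at h2
    simp only [Set.mem_iUnion]
    exact ⟨m, Finset.mem_Icc.2 ⟨hm1, h2⟩, _, h1, hcm⟩
  have : Nat.card S ≤ ∑ m ∈ Finset.Icc 1 (17 ^ 34 * n ^ 4),
      ((fun K => K.comap (redAll (pOf m) (eOf m))) '' (SubM (pOf m) (eOf m) n)).ncard := by
    rw [Nat.card_coe_set_eq]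
    refine (Set.ncard_le_ncard hsub ?_).trans ?_
    · exact Set.Finite.biUnion (Finset.finite_toSet _) fun m _ => (Set.toFinite _).image _
    · exact Finset.set_ncard_biUnion_le _ _
  refine this.trans (Finset.sum_le_sum fun m _ => ?_)
  have := hfin m
  exact Set.ncard_image_le (Set.toFinite _)

section
variable {ι : Type} [Fintype ι] [DecidableEq ι] (G : ι → Type) [∀ i, Group (G i)]

/-- Extension by one outside `S`. -/
def extOne (S : Finset ι) : (∀ i : {i // i ∉ S}, G i) →* ∀ i, G i where
  toFun g i := if h : i ∈ S then 1 else g ⟨i, h⟩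
  map_one' := by funext i; by_cases h : i ∈ S <;> simp [h]
  map_mul' a b := by funext i; by_cases h : i ∈ S <;> simp [h]

/-- Restriction to a set of indices. -/
def restr (P : ι → Prop) : (∀ i, G i) →* ∀ i : {i // P i}, G i :=
  MonoidHom.pi fun i => Pi.evalMonoidHom G i.1

theorem restr_surjective (P : ι → Prop) : Function.Surjective (restr G P) := by
  classical
  intro g
  refine ⟨fun i => if h : P i then g ⟨i, h⟩ else 1, ?_⟩
  funext i
  change (if h : P i.1 then g ⟨i.1, h⟩ else 1) = g i
  rw [dif_pos i.2]

theorem extOne_range (S : Finset ι) : (extOne G S).range = (restr G (fun i => i ∈ S)).ker := by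
  ext g
  rw [MonoidHom.mem_range, MonoidHom.mem_ker]
  constructor
  · rintro ⟨h, rfl⟩
    funext i
    change (if h' : i.1 ∈ S then (1 : G i.1) else h ⟨i.1, h'⟩) = 1
    rw [dif_pos i.2]
  · intro h
    refine ⟨fun i => g i, ?_⟩
    funext i
    change (if h' : i ∈ S then 1 else g i) = g i
    split_ifs with h'
    · exact (congrFun h ⟨i, h'⟩).symm
    · rfl

theorem stepA [∀ i, Finite (G i)] {c : ℕ} (hr : ∀ i, RankLE (G i) c) (S : Finset ι)
    (Φ : Set (Subgroup (∀ i, G i))) (Ψ : Set (Subgroup (∀ i : {i // i ∉ S}, G i)))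
    (h : ∀ H ∈ Φ, H.comap (extOne G S) ∈ Ψ) :
    Φ.ncard ≤ Ψ.ncard * (Nat.card (∀ i, G i)) ^ (c * S.card) := by
  classical
  refine ncard_le_mul Φ (fun H => H.comap (extOne G S)) Ψ (Set.toFinite _) (Set.toFinite _) h _ ?_
  intro N _
  have hr' : RankLE (∀ i : {i // i ∈ S}, G i) (c * S.card) := by
    have := RankLE.pi (fun i : {i // i ∈ S} => G i) (fun i => hr i)
    rwa [Fintype.card_coe] at this
  refine le_trans (Set.ncard_le_ncard ?_ (Set.toFinite _))
    (lemmaI (restr G (fun i => i ∈ S)) hr' (N.map (extOne G S)))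
  rintro H ⟨-, hH⟩
  change H ⊓ _ = _
  rw [← hH, Subgroup.map_comap_eq, ← extOne_range, inf_comm]

theorem stepA_index [∀ i, Finite (G i)] (S : Finset ι) (H : Subgroup (∀ i, G i)) :
    (H.comap (extOne G S)).index ≤ H.index := by
  rw [Subgroup.index_comap]
  have : (extOne G S).range.Normal := by rw [extOne_range]; infer_instance
  exact Nat.le_of_dvd (Nat.pos_of_ne_zero H.index_ne_zero_of_finite) (relIndex_normal_dvd _ _)

theorem stepC [∀ i, Finite (G i)] {c : ℕ} (hr : ∀ i, RankLE (G i) c) (P : ι → Prop) [DecidablePred P]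
    (I : ℕ) :
    {Λ : Subgroup (∀ i, G i) | Λ.index ≤ I}.ncard ≤
      {Λ : Subgroup (∀ i : {i // P i}, G i) | Λ.index ≤ I}.ncard *
      (∏ i, if P i then 1 else Nat.card (G i)) ^ (2 * c * Fintype.card ι) := by
  classical
  set r := restr G P with hrdef
  have hrs := restr_surjective G P
  have hG : RankLE (∀ i, G i) (c * Fintype.card ι) := RankLE.pi G hr
  have hU : Nat.card r.ker ≤ ∏ i, if P i then 1 else Nat.card (G i) := by
    let f : r.ker → ∀ i, (if P i then Unit else G i) := fun g i =>
      if h : P i then cast (by simp [h]) () else cast (by simp [h]) ((g : ∀ i, G i) i)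
    have hf : Function.Injective f := by
      rintro ⟨a, ha⟩ ⟨b, hb⟩ hab
      apply Subtype.ext
      funext i
      change a i = b i
      by_cases h : P i
      · have h1 : a i = 1 := congrFun (MonoidHom.mem_ker.1 ha) ⟨i, h⟩
        have h2 : b i = 1 := congrFun (MonoidHom.mem_ker.1 hb) ⟨i, h⟩
        rw [h1, h2]
      · have h1 := congrFun hab i
        simp only [f, dif_neg h] at h1
        exact cast_inj _ |>.1 h1
    have hfin : ∀ i, Finite (if P i then Unit else G i) := by
      intro i; split_ifs <;> infer_instance
    refine (Nat.card_le_card_of_injective f hf).trans (le_of_eq ?_)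
    rw [Nat.card_pi]
    apply Finset.prod_congr rfl
    intro i _
    split_ifs <;> simp
  refine ncard_le_mul _ (fun H => H.map r) _ (Set.toFinite _) (Set.toFinite _) ?_ _ ?_
  · intro H hH
    exact (Nat.le_of_dvd (Nat.pos_of_ne_zero H.index_ne_zero_of_finite)
      (H.index_map_dvd hrs)).trans hH
  · intro N _
    obtain ⟨g, hg⟩ := hG (N.comap r)
    refine le_trans (Set.ncard_le_ncard ?_ (Set.toFinite _)) ((lemmaS r.ker (hG.subgroup _) ⊥
      (N.comap r) g (by rw [hg]; exact le_sup_right)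
      (fun i => by rw [← hg]; exact Subgroup.subset_closure ⟨i, rfl⟩)).trans ?_)
    · rintro H ⟨-, hH⟩
      refine ⟨bot_le, ?_⟩
      rw [← hH]
      exact (Subgroup.comap_map_eq _ _).symm
    · rw [← two_mul, mul_assoc]
      exact Nat.pow_le_pow_left hU _

end

section
variable {ι : Type} [Fintype ι] [DecidableEq ι] (G : ι → Type) [∀ i, Group (G i)] [∀ i, Finite (G i)]

/-- Counting by projections. -/
theorem stepB1 {c : ℕ} (hr : ∀ i, RankLE (G i) c) (Φ : Set (Subgroup (∀ i, G i))) (n k : ℕ)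
    (hn : ∀ H ∈ Φ, H.index ≤ n)
    (hk : ∀ F : ∀ i, Subgroup (G i), (∃ H ∈ Φ, ∀ i, F i = H.map (Pi.evalMonoidHom _ i)) →
      {X : Subgroup (∀ i, F i) | X.index * ∏ i, (F i).index ≤ n}.ncard ≤ k) :
    Φ.ncard ≤ (Nat.card (∀ i, G i)) ^ c * k := by
  classical
  have h1 : Nat.card (∀ i, Subgroup (G i)) ≤ (Nat.card (∀ i, G i)) ^ c := by
    rw [Nat.card_pi, Nat.card_pi, ← Finset.prod_pow]
    exact Finset.prod_le_prod' fun i _ => card_subgroups_le (hr i)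
  let f : Subgroup (∀ i, G i) → ∀ i, Subgroup (G i) := fun H i => H.map (Pi.evalMonoidHom _ i)
  refine (ncard_le_mul Φ f (f '' Φ) (Set.toFinite _) (Set.toFinite _) (fun H hH => ⟨H, hH, rfl⟩) k
    ?_).trans (Nat.mul_le_mul_right _ ((Set.ncard_le_card _).trans h1))
  rintro F ⟨H₀, hH₀, rfl⟩
  refine le_trans ?_ (hk (f H₀) ⟨H₀, hH₀, fun i => rfl⟩)
  set F := f H₀
  let j : (∀ i, F i) →* ∀ i, G i := MonoidHom.pi fun i => (F i).subtype.comp (Pi.evalMonoidHom _ i)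
  have hj : j.range = Subgroup.pi Set.univ F := by
    ext g
    rw [Subgroup.mem_pi]
    constructor
    · rintro ⟨h, rfl⟩ i -; exact (h i).2
    · intro hg; exact ⟨fun i => ⟨g i, hg i trivial⟩, rfl⟩
  have hle : ∀ H : Subgroup (∀ i, G i), f H = F → H ≤ j.range := by
    intro H hH h hh
    rw [hj]
    intro i _
    rw [← hH]
    exact ⟨h, hh, rfl⟩
  apply Set.ncard_le_ncard_of_injOn (fun H => H.comap j)
  · rintro H ⟨hH, hfH⟩
    change (H.comap j).index * _ ≤ n
    rw [Subgroup.index_comap, ← index_pi_subgroup, ← hj, Subgroup.relIndex_mul_index (hle H hfH)]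
    exact hn H hH
  · rintro H ⟨-, hH⟩ H' ⟨-, hH'⟩ heq
    have h1 := congrArg (fun X => X.map j) heq
    simp only [Subgroup.map_comap_eq] at h1
    rwa [inf_eq_right.2 (hle H hH), inf_eq_right.2 (hle H' hH')] at h1

/-- Removing normal `p`-subgroups, the quotients being given by surjections. -/
theorem stepB2 (L : ι → Type) [∀ i, Group (L i)] (ρ : ∀ i, G i →* L i)
    (hs : ∀ i, Function.Surjective (ρ i)) (p : ι → ℕ)
    (hp : ∀ i, (p i).Prime) (hinj : Function.Injective p) (hU : ∀ i, IsPGroup (p i) (ρ i).ker)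
    (c d : ℕ) (hr : ∀ i, RankLE (G i) c)
    (hd : ∀ i, (Finset.univ.filter fun j => j ≠ i ∧ p i ∣ (ρ j).ker.index).card ≤ d) (I : ℕ) :
    {X : Subgroup (∀ i, G i) | X.index ≤ I}.ncard ≤ {Λ : Subgroup (∀ i, L i) | Λ.index ≤ I}.ncard *
      (Nat.card (∀ i, G i)) ^ (c + (c * d + c)) := by
  classical
  let P : (∀ i, G i) →* ∀ i, L i := MonoidHom.pi fun i => (ρ i).comp (Pi.evalMonoidHom _ i)
  have hPs : Function.Surjective P := by
    intro y
    choose x hx using fun i => hs i (y i)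
    exact ⟨x, funext hx⟩
  have hfin : Finite (∀ i, L i) := Finite.of_surjective _ hPs
  have hker : P.ker = Subgroup.pi Set.univ fun i => (ρ i).ker := by
    ext g
    rw [Subgroup.mem_pi, MonoidHom.mem_ker]
    constructor
    · intro h i _; exact congrFun h i
    · intro h; exact funext fun i => h i trivial
  refine ncard_le_mul _ (fun H => H.map P) _ (Set.toFinite _) (Set.toFinite _) ?_ _ ?_
  · intro H hH
    exact (Nat.le_of_dvd (Nat.pos_of_ne_zero H.index_ne_zero_of_finite)
      (H.index_map_dvd hPs)).trans hH
  · intro N _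
    refine le_trans (Set.ncard_le_ncard ?_ (Set.toFinite _)) ((stepU G (fun i => (ρ i).ker) p hp hinj
      hU c d hr hd (N.comap P)).trans ?_)
    · rintro H ⟨-, hH⟩
      change H ⊔ _ = _
      rw [← hH, ← hker]
      exact (Subgroup.comap_map_eq _ _).symm
    · rw [Nat.card_pi, ← Finset.prod_pow]
      exact Finset.prod_le_prod' fun i _ =>
        Nat.pow_le_pow_left (Subgroup.card_le_card_group _) _

end

section
variable {ι : Type} [Fintype ι] [DecidableEq ι] (p e : ι → ℕ)

/-- The extremal quantity is bounded by `T`. -/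
def TBound (p : ι → ℕ) (Q : Set ℕ) (n d : ℕ) (T : ℝ) : Prop :=
  ∀ (κ : Type) [Fintype κ] (f : κ → ι), Function.Injective f → ∀ (w x : κ → ℕ) (I : ℕ),
    (∀ i, 17 ≤ p (f i)) → (∀ i, w i = 1 ∨ w i = 2) →
    (∀ i, 0 < x i ∧ (x i ∣ p (f i) - 1 ∨ x i ∣ p (f i) + 1)) → 1 ≤ I →
    I * ∏ i, p (f i) ^ w i ≤ n * 4 ^ Fintype.card ι →
    (I : ℝ) ^ (⌈KK * ((∑ i, w i : ℕ) : ℝ)⌉₊ + 2 * d) *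
      ∏ i, (Qp Q (x i) : ℝ) ^ (KK * ((∑ i, w i : ℕ) : ℝ) * w i) ≤ T

theorem core_arith {a0 a1 a2 a3 c1 C P K t s k : ℕ} {cL Ib Sg X R T Z : ℝ}
    (h0 : a0 ≤ a1) (h1 : a1 ≤ a2 * c1 ^ k) (hc : c1 ≤ C) (h2 : a2 ≤ a3 * P ^ s) (hP : P ≤ 240 ^ t)
    {N : ℕ} (h3 : (a3 : ℝ) ≤ cL * 2 ^ N * Ib * Sg) (hN : N ≤ K) (hcL0 : 0 ≤ cL) (hcL : cL ≤ C)
    (hIb : 0 ≤ Ib) (h4 : Sg ≤ X ^ 2 * R) (hX0 : 0 ≤ X) (hX : X ≤ Z ^ 2) (hR : 0 ≤ R)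
    (h5 : Ib * R ≤ T) (hT : 0 ≤ T) :
    (a0 : ℝ) ≤ (C : ℝ) ^ k * ((240 : ℝ) ^ t) ^ s * C * 2 ^ K * Z ^ 4 * T := by
  have e1 : (a0 : ℝ) ≤ a3 * ((240 : ℝ) ^ t) ^ s * (C : ℝ) ^ k := by
    have : a0 ≤ a3 * (240 ^ t) ^ s * C ^ k := by
      refine h0.trans (h1.trans ?_)
      refine Nat.mul_le_mul (h2.trans ?_) (Nat.pow_le_pow_left hc k)
      exact Nat.mul_le_mul le_rfl (Nat.pow_le_pow_left hP s)
    exact_mod_cast this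
  have e2 : (a3 : ℝ) ≤ C * 2 ^ K * (Z ^ 4 * T) := by
    have f1 : cL * 2 ^ N ≤ (C : ℝ) * 2 ^ K := by
      apply mul_le_mul hcL (pow_le_pow_right₀ (by norm_num) hN) (by positivity) (by positivity)
    have f2 : Ib * Sg ≤ Z ^ 4 * T := by
      have g1 : X ^ 2 ≤ Z ^ 4 := by
        calc X ^ 2 ≤ (Z ^ 2) ^ 2 := by gcongr
          _ = Z ^ 4 := by ring
      calc Ib * Sg ≤ Ib * (X ^ 2 * R) := by gcongr
        _ = X ^ 2 * (Ib * R) := by ring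
        _ ≤ Z ^ 4 * T := mul_le_mul g1 h5 (by positivity) (by positivity)
    calc (a3 : ℝ) ≤ cL * 2 ^ N * Ib * Sg := h3
      _ = (cL * 2 ^ N) * (Ib * Sg) := by ring
      _ ≤ (cL * 2 ^ N) * (Z ^ 4 * T) := by
        apply mul_le_mul_of_nonneg_left f2 (by positivity)
      _ ≤ _ := mul_le_mul_of_nonneg_right f1 (by positivity)
  calc (a0 : ℝ) ≤ a3 * ((240 : ℝ) ^ t) ^ s * (C : ℝ) ^ k := e1
    _ ≤ (C * 2 ^ K * (Z ^ 4 * T)) * ((240 : ℝ) ^ t) ^ s * (C : ℝ) ^ k := by gcongr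
    _ = _ := by ring

theorem core_F [∀ i, NeZero (e i)] (hp : ∀ i, (p i).Prime) (hinj : Function.Injective p)
    (h17 : ∀ i, 17 ≤ p i) (n d : ℕ) (Q : Set ℕ)
    (hQ : ∀ q : ℕ, q.Prime → q ∉ Q →
      (Finset.univ.filter fun i => q ∣ p i - 1 ∨ q ∣ p i + 1).card ≤ d)
    (hpQ : ∀ i, p i ∉ Q) (T : ℝ) (hT0 : 0 ≤ T) (hT : TBound p Q n d T)
    (F : ∀ i, Subgroup (SL2 (ZMod (p i ^ e i)))) (B : ∀ i, BadData (p i) (F i)) :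
    ({X : Subgroup (∀ i, F i) | X.index * ∏ i, (F i).index ≤ n}.ncard : ℝ) ≤
      (Nat.card (∀ i, SL2 (ZMod (p i ^ e i))) : ℝ) ^ (cR * (d + 2)) *
      ((240 : ℝ) ^ Fintype.card ι) ^ (2 * cR * Fintype.card ι) *
      (Nat.card (∀ i, SL2 (ZMod (p i ^ e i))) : ℝ) *
      2 ^ ((2 * Fintype.card ι + 1) * Fintype.card ι) * (∏ i, (p i : ℝ)) ^ 4 * T := by
  classical
  have hNZ : ∀ i, NeZero (p i ^ e i) := fun i => ⟨(pow_pos (hp i).pos _).ne'⟩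
  have hFpos : 0 < ∏ i, (F i).index :=
    Finset.prod_pos fun i _ => Nat.pos_of_ne_zero (F i).index_ne_zero_of_finite
  obtain ⟨I, hI⟩ : ∃ I, I = n / ∏ i, (F i).index := ⟨_, rfl⟩
  have hset : {X : Subgroup (∀ i, F i) | X.index * ∏ i, (F i).index ≤ n} ⊆
      {X : Subgroup (∀ i, F i) | X.index ≤ I} := by
    intro X hX
    change X.index ≤ I
    rw [hI, Nat.le_div_iff_mul_le hFpos]
    exact hX
  have hle0 := Set.ncard_le_ncard hset (Set.toFinite _)
  by_cases hI0 : I = 0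
  · have h0 : {X : Subgroup (∀ i, F i) | X.index ≤ I} = ∅ := by
      ext X
      simp only [Set.mem_ofPred_eq, Set.mem_empty_iff_false, iff_false, hI0]
      have := Nat.pos_of_ne_zero X.index_ne_zero_of_finite
      omega
    rw [h0, Set.ncard_empty] at hle0
    have h1 : {X : Subgroup (∀ i, F i) | X.index * ∏ i, (F i).index ≤ n}.ncard = 0 := by omega
    rw [h1]
    simp only [Nat.cast_zero]
    positivity
  have hI1 : 1 ≤ I := by omega
  have hIn : I * ∏ i, (F i).index ≤ n := by rw [hI]; exact Nat.div_mul_le_self _ _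
  -- the cardinality of L
  have hLdvd : ∀ i, Nat.card (B i).L ∣ Nat.card (SL2 (ZMod (p i ^ e i))) := fun i =>
    (Subgroup.card_dvd_of_surjective (B i).ρ (B i).surj).trans (Subgroup.card_subgroup_dvd_card (F i))
  have hd : ∀ i, (Finset.univ.filter fun j => j ≠ i ∧ p i ∣ (B j).ρ.ker.index).card ≤ d := by
    intro i
    refine (Finset.card_le_card ?_).trans (hQ (p i) (hp i) (hpQ i))
    intro j hj
    simp only [Finset.mem_filter, Finset.mem_univ, true_and] at hj ⊢
    apply prime_dvd_card (e := e j) (hp i) (hp j) (h17 i) (fun h => hj.1 (hinj h.symm))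
    refine (hj.2.trans (dvd_of_eq ?_)).trans (hLdvd j)
    rw [Subgroup.index_ker, MonoidHom.range_eq_top.2 (B j).surj, Subgroup.card_top]
  have hB2 := stepB2 (fun i => F i) (fun i => (B i).L) (fun i => (B i).ρ) (fun i => (B i).surj) p hp
    hinj (fun i => (B i).pker) cR d (fun i => (rankLE_SL2 (hp i) (e i)).subgroup (F i)) hd I
  have hrL : ∀ i, RankLE (B i).L cR := fun i =>
    ((rankLE_SL2 (hp i) (e i)).subgroup (F i)).of_surjective (B i).ρ (B i).surj
  have hC := stepC (fun i => (B i).L) hrL (fun i => (B i).w ≠ 0) I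
  have h240 : (∏ i, if (B i).w ≠ 0 then 1 else Nat.card (B i).L) ≤ 240 ^ Fintype.card ι := by
    rw [← Finset.card_univ]
    apply Finset.prod_le_pow_card
    intro i _
    split_ifs with h
    · norm_num
    · push Not at h
      exact Nat.le_of_dvd (by norm_num) ((B i).case0 h)
  let κ := {i // (B i).w ≠ 0}
  have hw12 : ∀ i : κ, (B i).w = 1 ∨ (B i).w = 2 := by
    intro i
    have h1 := i.2
    have h2 := (B i.1).w2
    omega
  let D : Finset κ := Finset.univ.filter fun i => (B i).w = 2
  have hNZx : ∀ i : κ, NeZero (B i).x := fun i => ⟨(B i).xpos.ne'⟩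
  let inst : Fintype (AddSubgroup (∀ i : κ, ZMod (B i).x)) := Fintype.ofFinite _
  obtain ⟨W, hW⟩ : ∃ W : ℕ, W = ∑ i : κ, (B i).w := ⟨_, rfl⟩
  have hth := theta_total (fun i : κ => (B i).L) (fun i => (B i).x) (fun i => (B i).τ)
    (fun i => (B i).xpos) (fun i => (B i).norm) D
    (by
      intro i hi
      apply (B i).case1
      have h2 := hw12 i
      have : (B i).w ≠ 2 := fun h => hi (by simp [D, h])
      omega)
    (by
      intro i
      rcases hw12 i with h | h
      · rw [(B i).case1 h]; simp
      · exact (B i).case2 h) I (⌈KK * (W : ℝ)⌉₊ + 2 * d)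
  have hab := abelian_sum D (fun i : κ => (B i).w)
    (by
      intro i
      rcases hw12 i with h | h <;> simp [D, h]) Q W (⌈KK * (W : ℝ)⌉₊ + 2 * d) hW.ge
    (by
      push_cast
      have := Nat.le_ceil (KK * (W : ℝ))
      have : (0 : ℝ) ≤ 2 * d := by positivity
      linarith) (∏ i : κ, (B i).x) (∀ i : κ, ZMod (B i).x) (fun i => (B i).x) le_rfl
    (fun i => (B i).xpos) (idxP_pi _ (fun i => (B i).xpos))
    (by
      intro q hq hqQ
      have h1 := hQ q hq hqQ
      have h2 : (Finset.univ.filter fun i : κ => q ∣ (B i).x).card ≤ d := by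
        refine (Finset.card_le_card_of_injOn Subtype.val ?_ Subtype.val_injective.injOn).trans h1
        intro i hi
        simp only [Finset.coe_filter, Finset.mem_univ, true_and, Set.mem_ofPred_eq] at hi ⊢
        rcases (B i).xdvd with h | h
        · exact Or.inl (hi.trans h)
        · exact Or.inr (hi.trans h)
      have h3 : ∑ i ∈ Finset.univ.filter (fun i : κ => q ∣ (B i).x), (B i).w ≤
          (Finset.univ.filter (fun i : κ => q ∣ (B i).x)).card • 2 :=
        Finset.sum_le_card_nsmul _ _ _ fun i _ => (B i).w2
      rw [smul_eq_mul] at h3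
      omega)
  have hTI := hT κ Subtype.val Subtype.val_injective (fun i => (B i).w) (fun i => (B i).x) I
    (fun i => h17 i) hw12 (fun i => ⟨(B i).xpos, (B i).xdvd⟩) hI1
    (by
      have h1 : ∏ i : κ, p i ^ (B i).w = ∏ i, p i ^ (B i).w := by
        rw [← Finset.prod_subtype (p := fun i => (B i).w ≠ 0)
          (Finset.univ.filter fun i => (B i).w ≠ 0) (by simp) (fun i => p i ^ (B i).w)]
        apply Finset.prod_filter_of_ne
        intro i _ h1 h2
        exact h1 (by rw [h2, pow_zero])
      have h2 : ∏ i, p i ^ (B i).w ≤ 4 ^ Fintype.card ι * ∏ i, (F i).index := by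
        rw [← Finset.card_univ, ← Finset.prod_const, ← Finset.prod_mul_distrib]
        exact Finset.prod_le_prod' fun i _ => (B i).idxw
      rw [h1]
      calc I * ∏ i, p i ^ (B i).w ≤ I * (4 ^ Fintype.card ι * ∏ i, (F i).index) :=
            Nat.mul_le_mul_left _ h2
        _ = (I * ∏ i, (F i).index) * 4 ^ Fintype.card ι := by ring
        _ ≤ n * 4 ^ Fintype.card ι := Nat.mul_le_mul_right _ hIn)
  rw [← hW] at hTI
  have hcF : Nat.card (∀ i, F i) ≤ Nat.card (∀ i, SL2 (ZMod (p i ^ e i))) := by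
    rw [Nat.card_pi, Nat.card_pi]
    exact Finset.prod_le_prod' fun i _ => Subgroup.card_le_card_group (F i)
  have hcL : Nat.card (∀ i : κ, (B i).L) ≤ Nat.card (∀ i, SL2 (ZMod (p i ^ e i))) := by
    rw [Nat.card_pi, Nat.card_pi]
    calc ∏ i : κ, Nat.card (B i).L ≤ ∏ i : κ, Nat.card (SL2 (ZMod (p i ^ e i))) :=
          Finset.prod_le_prod' fun i _ => Nat.le_of_dvd Nat.card_pos (hLdvd i)
      _ = ∏ i ∈ Finset.univ.filter (fun i => (B i).w ≠ 0), Nat.card (SL2 (ZMod (p i ^ e i))) :=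
          (Finset.prod_subtype _ (by simp) (fun i => Nat.card (SL2 (ZMod (p i ^ e i))))).symm
      _ ≤ ∏ i, Nat.card (SL2 (ZMod (p i ^ e i))) :=
          Finset.prod_le_prod_of_subset_of_one_le' (Finset.filter_subset _ _)
            fun i _ _ => Nat.card_pos
  have hX : ∏ i : κ, (B i).x ≤ (∏ i, p i) ^ 2 := by
    rw [← Finset.prod_pow]
    calc ∏ i : κ, (B i).x ≤ ∏ i : κ, p i ^ 2 := by
          refine Finset.prod_le_prod' fun i _ => ?_
          have h1 := h17 i
          have h2 : (B i).x ≤ p i + 1 := by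
            rcases (B i).xdvd with h | h
            · have := Nat.le_of_dvd (by omega) h
              omega
            · exact Nat.le_of_dvd (by omega) h
          nlinarith
      _ = ∏ i ∈ Finset.univ.filter (fun i => (B i).w ≠ 0), p i ^ 2 :=
          (Finset.prod_subtype _ (by simp) (fun i => p i ^ 2)).symm
      _ ≤ ∏ i, p i ^ 2 :=
          Finset.prod_le_prod_of_subset_of_one_le' (Finset.filter_subset _ _)
            fun i _ _ => Nat.one_le_pow _ _ (hp i).pos
  have hκ : Fintype.card κ ≤ Fintype.card ι := Fintype.card_subtype_le _
  have hk : cR + (cR * d + cR) = cR * (d + 2) := by ring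
  rw [hk] at hB2
  refine core_arith (X := ∏ i : κ, ((B i).x : ℝ)) hle0 hB2 hcF hC h240 hth ?_ (Nat.cast_nonneg _) (by exact_mod_cast hcL)
    (by positivity) hab (by positivity) (by exact_mod_cast hX) ?_ hTI hT0
  · exact Nat.mul_le_mul (by omega) hκ
  · exact Finset.prod_nonneg fun i _ => Real.rpow_nonneg (Nat.cast_nonneg _) _

end

theorem finite_main {ι : Type} [Fintype ι] [DecidableEq ι] (p e : ι → ℕ)
    [∀ i, NeZero (e i)] (hp : ∀ i, (p i).Prime) (hinj : Function.Injective p)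
    (n d : ℕ) (Q : Set ℕ)
    (hQ : ∀ q : ℕ, q.Prime → q ∉ Q →
      (Finset.univ.filter fun i => q ∣ p i - 1 ∨ q ∣ p i + 1).card ≤ d)
    (S : Finset ι) (hS : ∀ i, i ∉ S → 17 ≤ p i ∧ p i ∉ Q)
    (T : ℝ) (hT0 : 0 ≤ T) (hT : TBound p Q n d T) (m : ℕ) (hm : ∏ i, p i ^ e i = m) :
    ((SubM p e n).ncard : ℝ) ≤
      (m : ℝ) ^ (4 * cR * (S.card + d + 3) + 8) *
      (((240 : ℝ) ^ Fintype.card ι) ^ (2 * cR * Fintype.card ι) *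
      2 ^ ((2 * Fintype.card ι + 1) * Fintype.card ι)) * T := by
  classical
  have hNZ : ∀ i, NeZero (p i ^ e i) := fun i => ⟨(pow_pos (hp i).pos _).ne'⟩
  have hNZ' : ∀ i : {i // i ∉ S}, NeZero (e i) := fun i => inferInstance
  have hm1 : 1 ≤ m := by
    rw [← hm]; exact Nat.one_le_iff_ne_zero.2 (Finset.prod_ne_zero_iff.2 fun i _ => (hNZ i).out)
  have hm1' : (1 : ℝ) ≤ m := by exact_mod_cast hm1
  have hsub : ∀ g : ι → ℕ, (∀ i, 1 ≤ g i) → ∏ i : {i // i ∉ S}, g i ≤ ∏ i, g i := by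
    intro g hg
    calc ∏ i : {i // i ∉ S}, g i = ∏ i ∈ Finset.univ.filter (fun i => i ∉ S), g i :=
          (Finset.prod_subtype _ (by simp) g).symm
      _ ≤ _ := Finset.prod_le_prod_of_subset_of_one_le' (Finset.filter_subset _ _)
            fun i _ _ => hg i
  have hC : Nat.card (∀ i, SL2 (ZMod (p i ^ e i))) ≤ m ^ 4 := by
    rw [Nat.card_pi, ← hm, ← Finset.prod_pow]
    exact Finset.prod_le_prod' fun i _ => card_SL2_le _
  have hC' : Nat.card (∀ i : {i // i ∉ S}, SL2 (ZMod (p i ^ e i))) ≤ m ^ 4 := by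
    refine le_trans ?_ hC
    rw [Nat.card_pi, Nat.card_pi]
    exact hsub (fun i => Nat.card (SL2 (ZMod (p i ^ e i)))) fun i => Nat.card_pos
  have hP : ∏ i : {i // i ∉ S}, p i ≤ m := by
    refine (hsub p fun i => (hp i).pos).trans ?_
    rw [← hm]
    exact Finset.prod_le_prod' fun i _ => Nat.le_self_pow (NeZero.ne _) _
  have ht : Fintype.card {i // i ∉ S} ≤ Fintype.card ι := Fintype.card_subtype_le _
  have hA := stepA (fun i => SL2 (ZMod (p i ^ e i))) (fun i => rankLE_SL2 (hp i) (e i)) S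
    (SubM p e n) (SubM (fun i : {i // i ∉ S} => p i) (fun i => e i) n)
    (by
      intro H hH
      refine ⟨(stepA_index _ S H).trans hH.1, ?_⟩
      intro i h17 htop
      apply hH.2 i h17
      rw [eq_top_iff] at htop ⊢
      intro x hx
      obtain ⟨g, hg, rfl⟩ := htop (Subgroup.mem_top x)
      refine ⟨extOne _ S g, hg, ?_⟩
      simp [extOne, i.2])
  have hTB : TBound (fun i : {i // i ∉ S} => p i) Q n d T := by
    intro κ _ f hf w x I h17 hw hx hI hle
    refine hT κ (fun i => (f i).1) (Subtype.val_injective.comp hf) w x I h17 hw hx hI (hle.trans ?_)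
    exact Nat.mul_le_mul_left _ (Nat.pow_le_pow_right (by norm_num) ht)
  obtain ⟨E, hE⟩ : ∃ E : ℝ, E = ((240 : ℝ) ^ Fintype.card ι) ^ (2 * cR * Fintype.card ι) *
      2 ^ ((2 * Fintype.card ι + 1) * Fintype.card ι) := ⟨_, rfl⟩
  have hE0 : 0 ≤ E := by rw [hE]; positivity
  have hB := stepB1 (fun i : {i // i ∉ S} => SL2 (ZMod (p i ^ e i)))
    (fun i => rankLE_SL2 (hp i) (e i)) (SubM (fun i : {i // i ∉ S} => p i) (fun i => e i) n) n
    ⌊(m : ℝ) ^ (4 * cR * (d + 2) + 8) * E * T⌋₊ (fun H hH => hH.1)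
    (by
      rintro F ⟨H, hH, hF⟩
      have hBd : ∀ i : {i // i ∉ S}, Nonempty (BadData (p i) (F i)) := by
        intro i
        apply classify (hp i) (hS i i.2).1
        rw [hF i]
        exact hH.2 i (hS i i.2).1
      have := core_F (fun i : {i // i ∉ S} => p i) (fun i => e i) (fun i => hp i)
        (hinj.comp Subtype.val_injective) (fun i => (hS i i.2).1) n d Q
        (by
          intro q hq hqQ
          refine le_trans ?_ (hQ q hq hqQ)
          refine Finset.card_le_card_of_injOn Subtype.val ?_ Subtype.val_injective.injOn
          intro i hi
          simpa using hi)
        (fun i => (hS i i.2).2) T hT0 hTB F (fun i => (hBd i).some)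
      apply Nat.le_floor
      refine this.trans ?_
      have f1 : (Nat.card (∀ i : {i // i ∉ S}, SL2 (ZMod (p i ^ e i))) : ℝ) ≤ (m : ℝ) ^ 4 := by
        exact_mod_cast hC'
      have f2 : (∏ i : {i // i ∉ S}, (p i : ℝ)) ≤ m := by exact_mod_cast hP
      have f3 : (∏ i : {i // i ∉ S}, (p i : ℝ)) ^ 4 ≤ (m : ℝ) ^ 4 :=
        pow_le_pow_left₀ (by positivity) f2 4
      have f4 : ((240 : ℝ) ^ Fintype.card {i // i ∉ S}) ^ (2 * cR * Fintype.card {i // i ∉ S}) ≤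
          ((240 : ℝ) ^ Fintype.card ι) ^ (2 * cR * Fintype.card ι) := by
        rw [← pow_mul, ← pow_mul]
        exact pow_le_pow_right₀ (by norm_num) (Nat.mul_le_mul ht (Nat.mul_le_mul_left _ ht))
      have f5 : (2 : ℝ) ^ ((2 * Fintype.card {i // i ∉ S} + 1) * Fintype.card {i // i ∉ S}) ≤
          2 ^ ((2 * Fintype.card ι + 1) * Fintype.card ι) :=
        pow_le_pow_right₀ (by norm_num) (Nat.mul_le_mul (by omega) ht)
      have f6 := pow_le_pow_left₀ (Nat.cast_nonneg _) f1 (cR * (d + 2))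
      refine (mul_le_mul_of_nonneg_right (mul_le_mul (mul_le_mul (mul_le_mul (mul_le_mul f6 f4
        (by positivity) (by positivity)) f1 (by positivity) (by positivity)) f5 (by positivity)
        (by positivity)) f3 (by positivity) (by positivity)) hT0).trans (le_of_eq ?_)
      rw [hE]
      ring)
  rw [← hE]
  have hk := Nat.floor_le (show 0 ≤ (m : ℝ) ^ (4 * cR * (d + 2) + 8) * E * T by positivity)
  obtain ⟨k, hk'⟩ : ∃ k, k = ⌊(m : ℝ) ^ (4 * cR * (d + 2) + 8) * E * T⌋₊ := ⟨_, rfl⟩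
  rw [← hk'] at hB hk
  have h1 : (SubM p e n).ncard ≤ ((m ^ 4) ^ cR * k) * (m ^ 4) ^ (cR * S.card) :=
    hA.trans (Nat.mul_le_mul (hB.trans (Nat.mul_le_mul_right _ (Nat.pow_le_pow_left hC' _)))
      (Nat.pow_le_pow_left hC _))
  have h2 : ((SubM p e n).ncard : ℝ) ≤ (((m : ℝ) ^ 4) ^ cR * k) * ((m : ℝ) ^ 4) ^ (cR * S.card) := by
    exact_mod_cast h1
  refine h2.trans ?_
  calc (((m : ℝ) ^ 4) ^ cR * k) * ((m : ℝ) ^ 4) ^ (cR * S.card) ≤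
      (((m : ℝ) ^ 4) ^ cR * ((m : ℝ) ^ (4 * cR * (d + 2) + 8) * E * T)) *
        ((m : ℝ) ^ 4) ^ (cR * S.card) := by gcongr
    _ = _ := by ring

theorem Qp_dvd (Q : Set ℕ) {x : ℕ} (hx : x ≠ 0) : Qp Q x ∣ x := by
  classical
  unfold Qp
  conv_rhs => rw [← Nat.prod_factorization_pow_eq_self hx]
  apply Finset.prod_dvd_prod_of_dvd
  intro q _
  dsimp only
  split_ifs
  · exact dvd_rfl
  · exact one_dvd _

theorem Qp_prime_dvd (Q : Set ℕ) {x r : ℕ} (hr : r.Prime) (h : r ∣ Qp Q x) : r ∈ Q := by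
  classical
  unfold Qp at h
  obtain ⟨q, hq, h1⟩ := (hr.prime.dvd_finset_prod_iff _).1 h
  dsimp only at h1
  split_ifs at h1 with h2
  · have h3 := hr.dvd_of_dvd_pow h1
    have h4 : q.Prime := Nat.prime_of_mem_primeFactors (by simpa using hq)
    rw [(Nat.prime_dvd_prime_iff_eq hr h4).1 h3]
    exact h2
  · exact absurd (Nat.dvd_one.1 h1) hr.one_lt.ne'

theorem Qp_le_of_dvd (Q : Set ℕ) {x y : ℕ} (hy : y ≠ 0) (h : x ∣ y) : Qp Q x ≤ Qp Q y := by
  obtain ⟨z, rfl⟩ := h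
  rw [Qp_mul Q (left_ne_zero_of_mul hy) (right_ne_zero_of_mul hy)]
  exact Nat.le_mul_of_pos_right _ (Qp_pos _ _)

noncomputable def rpowHom (σ : ℝ) : ℕ →* ℝ where
  toFun n := (n : ℝ) ^ (-σ)
  map_one' := by simp
  map_mul' a b := by
    push_cast
    exact Real.mul_rpow (Nat.cast_nonneg _) (Nat.cast_nonneg _)

theorem rpow_lt_one' {σ : ℝ} (hσ : 0 < σ) {q : ℕ} (hq : q.Prime) : (q : ℝ) ^ (-σ) < 1 := by
  apply Real.rpow_lt_one_of_one_lt_of_neg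
  · exact_mod_cast hq.one_lt
  · linarith

theorem rankin_sum {σ : ℝ} (hσ : 0 < σ) (Q : Finset ℕ) (hQ : ∀ q ∈ Q, q.Prime) (U : Finset ℕ)
    (hU : 0 ∉ U) :
    ∑ u ∈ U, ((u / Qp Q u : ℕ) : ℝ) ^ (-(1 + σ)) * (Qp Q u : ℝ) ^ (-σ) ≤
      (∑' k : ℕ, (k : ℝ) ^ (-(1 + σ))) * ∏ q ∈ Q, (1 - (q : ℝ) ^ (-σ))⁻¹ := by
  classical
  have hmem : ∀ u, Qp Q u ∈ Nat.factoredNumbers Q := by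
    intro u
    rw [Nat.mem_factoredNumbers']
    intro r hr h
    exact_mod_cast Qp_prime_dvd (Q : Set ℕ) hr h
  let f : ℕ → ℕ × Nat.factoredNumbers Q := fun u => (u / Qp Q u, ⟨Qp Q u, hmem u⟩)
  have hf : Set.InjOn f U := by
    intro u hu v hv huv
    simp only [f, Prod.mk.injEq, Subtype.mk.injEq] at huv
    have hu0 : u ≠ 0 := fun h => hU (h ▸ hu)
    have hv0 : v ≠ 0 := fun h => hU (h ▸ hv)
    rw [← Nat.div_mul_cancel (Qp_dvd (Q : Set ℕ) hu0), ← Nat.div_mul_cancel (Qp_dvd (Q : Set ℕ) hv0),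
      huv.1, huv.2]
  let g : ℕ × Nat.factoredNumbers Q → ℝ := fun z => (z.1 : ℝ) ^ (-(1 + σ)) * ((z.2 : ℕ) : ℝ) ^ (-σ)
  have h1 : ∑ u ∈ U, ((u / Qp Q u : ℕ) : ℝ) ^ (-(1 + σ)) * (Qp Q u : ℝ) ^ (-σ) =
      ∑ z ∈ U.image f, g z := by
    rw [Finset.sum_image hf]
  have hS := EulerProduct.summable_and_hasSum_factoredNumbers_prod_filter_prime_geometric
    (f := rpowHom σ) (by
      intro q hq
      change ‖(q : ℝ) ^ (-σ)‖ < 1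
      rw [Real.norm_of_nonneg (Real.rpow_nonneg (Nat.cast_nonneg _) _)]
      exact rpow_lt_one' hσ hq) Q
  have hS2 := hS.2
  rw [Finset.filter_true_of_mem hQ] at hS2
  have hsum : Summable fun k : ℕ => (k : ℝ) ^ (-(1 + σ)) :=
    Real.summable_nat_rpow.2 (by linarith)
  rw [h1]
  calc ∑ z ∈ U.image f, g z ≤
      ∑ z ∈ (U.image f).image Prod.fst ×ˢ (U.image f).image Prod.snd, g z := by
        apply Finset.sum_le_sum_of_subset_of_nonneg
        · intro z hz
          rw [Finset.mem_product]
          exact ⟨Finset.mem_image_of_mem _ hz, Finset.mem_image_of_mem _ hz⟩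
        · intro z _ _
          positivity
    _ = (∑ k ∈ (U.image f).image Prod.fst, (k : ℝ) ^ (-(1 + σ))) *
        ∑ y ∈ (U.image f).image Prod.snd, ((y : ℕ) : ℝ) ^ (-σ) := by
        rw [Finset.sum_product, Finset.sum_mul_sum]
    _ ≤ _ := by
        apply mul_le_mul
        · exact hsum.sum_le_tsum _ fun k _ => by positivity
        · exact sum_le_hasSum _ (fun y _ => by change (0 : ℝ) ≤ ((y : ℕ) : ℝ) ^ (-σ); positivity) hS2
        · positivity
        · exact tsum_nonneg fun k => by positivity

theorem prod_Q_bound {σ δ : ℝ} (hσ : 0 < σ) (hδ : 0 < δ) :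
    ∃ C : ℝ, 1 ≤ C ∧ ∀ Q : Finset ℕ, (∀ q ∈ Q, q.Prime) →
      ∏ q ∈ Q, (1 - (q : ℝ) ^ (-σ))⁻¹ ≤ C * Real.exp (δ * Q.card) := by
  have hlim : Filter.Tendsto (fun q : ℕ => (1 - (q : ℝ) ^ (-σ))⁻¹) Filter.atTop (nhds 1) := by
    have h1 : Filter.Tendsto (fun q : ℕ => (q : ℝ) ^ (-σ)) Filter.atTop (nhds 0) :=
      (tendsto_rpow_neg_atTop hσ).comp tendsto_natCast_atTop_atTop
    have h2 := (tendsto_const_nhds (x := (1 : ℝ))).sub h1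
    simpa using h2.inv₀ (by norm_num)
  have h3 : ∀ᶠ q : ℕ in Filter.atTop, (1 - (q : ℝ) ^ (-σ))⁻¹ < Real.exp δ :=
    hlim.eventually_lt_const (by simpa using hδ)
  obtain ⟨y, hy⟩ := Filter.eventually_atTop.1 h3
  have h2lt : (2 : ℝ) ^ (-σ) < 1 := by exact_mod_cast rpow_lt_one' hσ Nat.prime_two
  have hD : (1 : ℝ) ≤ (1 - (2 : ℝ) ^ (-σ))⁻¹ := by
    apply (one_le_inv₀ (by linarith)).2
    have : (0 : ℝ) ≤ (2 : ℝ) ^ (-σ) := by positivity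
    linarith
  refine ⟨(1 - (2 : ℝ) ^ (-σ))⁻¹ ^ y, one_le_pow₀ hD, ?_⟩
  intro Q hQ
  have h0 : ∀ q ∈ Q, 0 ≤ (1 - (q : ℝ) ^ (-σ))⁻¹ := fun q hq => by
    have := rpow_lt_one' hσ (hQ q hq)
    exact inv_nonneg.2 (by linarith)
  rw [← Finset.prod_filter_mul_prod_filter_not Q (fun q => q < y)]
  apply mul_le_mul
  · calc ∏ q ∈ Q with q < y, (1 - (q : ℝ) ^ (-σ))⁻¹ ≤ ∏ q ∈ Q with q < y, (1 - (2 : ℝ) ^ (-σ))⁻¹ := by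
          apply Finset.prod_le_prod
          · intro q hq
            exact h0 q (Finset.mem_filter.1 hq).1
          · intro q hq
            have hq' := hQ q (Finset.mem_filter.1 hq).1
            have h5 : (q : ℝ) ^ (-σ) ≤ (2 : ℝ) ^ (-σ) :=
              Real.rpow_le_rpow_of_nonpos (by norm_num) (by exact_mod_cast hq'.two_le) (by linarith)
            apply inv_anti₀ <;> linarith
      _ ≤ _ := by
          rw [Finset.prod_const]
          apply pow_le_pow_right₀ hD
          calc _ ≤ (Finset.range y).card := Finset.card_le_card fun q hq => by
                simpa using (Finset.mem_filter.1 hq).2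
            _ = y := Finset.card_range y
  · calc ∏ q ∈ Q with ¬ q < y, (1 - (q : ℝ) ^ (-σ))⁻¹ ≤ ∏ q ∈ Q with ¬ q < y, Real.exp δ := by
          apply Finset.prod_le_prod
          · intro q hq
            exact h0 q (Finset.mem_filter.1 hq).1
          · intro q hq
            exact (hy q (not_lt.1 (Finset.mem_filter.1 hq).2)).le
      _ ≤ _ := by
          rw [Finset.prod_const, ← Real.exp_nat_mul, mul_comm]
          apply Real.exp_le_exp.2
          apply mul_le_mul_of_nonneg_left _ hδ.le
          exact_mod_cast Finset.card_filter_le _ _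
  · apply Finset.prod_nonneg
    intro q hq
    exact h0 q (Finset.mem_filter.1 hq).1
  · positivity

theorem rankin_bound {σ δ : ℝ} (hσ : 0 < σ) (hδ : 0 < δ) :
    ∃ C : ℝ, 1 ≤ C ∧ ∀ Q : Finset ℕ, (∀ q ∈ Q, q.Prime) → ∀ U : Finset ℕ, 0 ∉ U →
      ∑ u ∈ U, ((u / Qp Q u : ℕ) : ℝ) ^ (-(1 + σ)) * (Qp Q u : ℝ) ^ (-σ) ≤
        C * Real.exp (δ * Q.card) := by
  obtain ⟨C, hC, h⟩ := prod_Q_bound hσ hδ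
  have hz : 0 ≤ (∑' k : ℕ, (k : ℝ) ^ (-(1 + σ))) := tsum_nonneg fun k => by positivity
  refine ⟨(∑' k : ℕ, (k : ℝ) ^ (-(1 + σ)) + 1) * C, ?_, ?_⟩
  · nlinarith
  · intro Q hQ U hU
    refine (rankin_sum hσ Q hQ U hU).trans ?_
    rw [mul_assoc]
    refine (mul_le_mul_of_nonneg_left (h Q hQ) hz).trans ?_
    apply mul_le_mul_of_nonneg_right (by linarith)
    positivity

theorem quad_max {W Y b : ℝ} (hb : 0 < b) : W * (Y - W * b) ≤ Y ^ 2 / (4 * b) := by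
  rw [le_div_iff₀ (by positivity)]
  nlinarith [sq_nonneg (Y - 2 * W * b)]

theorem tbound {ι : Type} [Fintype ι] (p : ι → ℕ) (hinj : Function.Injective p)
    (Q : Finset ℕ) (n d : ℕ) (hn : 1 ≤ n) (A σ b : ℝ) (hσ : 0 < σ) (hb : 0 < b) (hA0 : 0 ≤ A)
    (hA : ∀ U : Finset ℕ, 0 ∉ U →
      ∑ u ∈ U, ((u / Qp Q u : ℕ) : ℝ) ^ (-(1 + σ)) * (Qp Q u : ℝ) ^ (-σ) ≤ A) (R Y : ℝ)
    (hR : R = Real.log n + Fintype.card ι * Real.log 4)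
    (hY : Y = R * (1 + σ) + 4 * A * Real.exp b + (1 + σ) * (2 * Fintype.card ι * Real.log 2)) :
    TBound p Q n d (Real.exp (KK * (Y ^ 2 / (4 * b)) + (1 + 2 * d) * R)) := by
  classical
  intro κ _ f hf w x I h17 hw hx hI hle
  have hw2 : ∀ i, (w i : ℝ) ≤ 2 := fun i => by
    rcases hw i with h | h <;> rw [h] <;> norm_num
  have hw0 : ∀ i, (0 : ℝ) ≤ w i := fun i => Nat.cast_nonneg _
  -- the numbers u
  obtain ⟨P, hP⟩ : ∃ P : κ → Prop, ∀ i, P i ↔ x i ∣ p (f i) - 1 := ⟨_, fun i => Iff.rfl⟩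
  obtain ⟨u, hu⟩ : ∃ u : κ → ℕ, ∀ i, u i = if P i then p (f i) - 1 else p (f i) + 1 :=
    ⟨_, fun i => rfl⟩
  have hxu : ∀ i, x i ∣ u i := by
    intro i
    rw [hu i]
    split_ifs with h
    · exact (hP i).1 h
    · exact (hx i).2.resolve_left fun h' => h ((hP i).2 h')
  have hu0 : ∀ i, 0 < u i := by
    intro i
    have := h17 i
    rw [hu i]
    split_ifs <;> omega
  have hu2 : ∀ i, u i ≤ 2 * p (f i) := by
    intro i
    have := h17 i
    rw [hu i]
    split_ifs <;> omega
  obtain ⟨y, hy⟩ : ∃ y : κ → ℕ, ∀ i, y i = Qp Q (u i) := ⟨_, fun i => rfl⟩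
  obtain ⟨k, hk⟩ : ∃ k : κ → ℕ, ∀ i, k i = u i / Qp Q (u i) := ⟨_, fun i => rfl⟩
  have hky : ∀ i, k i * y i = u i := fun i => by
    rw [hk, hy]; exact Nat.div_mul_cancel (Qp_dvd _ (hu0 i).ne')
  have hy0 : ∀ i, 0 < y i := fun i => by rw [hy]; exact Qp_pos _ _
  have hk0 : ∀ i, 0 < k i := fun i => Nat.pos_of_ne_zero fun h => by
    have := hky i
    rw [h, zero_mul] at this
    have := hu0 i
    omega
  have hlogu : ∀ i, Real.log (u i) = Real.log (k i) + Real.log (y i) := by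
    intro i
    rw [← hky i, Nat.cast_mul, Real.log_mul]
    · exact_mod_cast (hk0 i).ne'
    · exact_mod_cast (hy0 i).ne'
  have hp0 : ∀ i, (0 : ℝ) < p (f i) := fun i => by
    have := h17 i
    exact_mod_cast (by omega : 0 < p (f i))
  have hlogu2 : ∀ i, Real.log (u i) ≤ Real.log 2 + Real.log (p (f i)) := by
    intro i
    rw [← Real.log_mul (by norm_num) (hp0 i).ne']
    apply Real.log_le_log
    · exact_mod_cast hu0 i
    · exact_mod_cast hu2 i
  -- the sum
  have hsumA : ∑ i, (k i : ℝ) ^ (-(1 + σ)) * (y i : ℝ) ^ (-σ) ≤ 2 * A := by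
    have key : ∀ s : Finset κ, Set.InjOn u s →
        ∑ i ∈ s, (k i : ℝ) ^ (-(1 + σ)) * (y i : ℝ) ^ (-σ) ≤ A := by
      intro s hs
      have h1 := hA (s.image u) (by
        intro h
        obtain ⟨i, -, h⟩ := Finset.mem_image.1 h
        have := hu0 i
        omega)
      rw [Finset.sum_image hs] at h1
      refine le_trans (le_of_eq ?_) h1
      exact Finset.sum_congr rfl fun i _ => by rw [hk, hy]
    rw [← Finset.sum_filter_add_sum_filter_not Finset.univ P]
    have h1 := key (Finset.univ.filter P) (by
      intro i hi j hj hij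
      simp only [Finset.coe_filter, Finset.mem_univ, true_and, Set.mem_ofPred_eq] at hi hj
      rw [hu i, hu j, if_pos hi, if_pos hj] at hij
      have := h17 i
      have := h17 j
      exact hf (hinj (by omega)))
    have h2 := key (Finset.univ.filter fun i => ¬ P i) (by
      intro i hi j hj hij
      simp only [Finset.coe_filter, Finset.mem_univ, true_and, Set.mem_ofPred_eq] at hi hj
      rw [hu i, hu j, if_neg hi, if_neg hj] at hij
      exact hf (hinj (by omega)))
    linarith
  obtain ⟨W, hW⟩ : ∃ W : ℕ, W = ∑ i, w i := ⟨_, rfl⟩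
  have hWr : (W : ℝ) = ∑ i, (w i : ℝ) := by rw [hW]; push_cast; rfl
  have hW2 : (W : ℝ) ≤ 2 * Fintype.card ι := by
    have h1 : (W : ℝ) ≤ ∑ i : κ, (2 : ℝ) := by rw [hWr]; exact Finset.sum_le_sum fun i _ => hw2 i
    have h2 : (Fintype.card κ : ℝ) ≤ Fintype.card ι := by
      exact_mod_cast Fintype.card_le_of_injective f hf
    rw [Finset.sum_const, Finset.card_univ, nsmul_eq_mul] at h1
    linarith
  have htan : ∀ i, 1 + b - ((1 + σ) * Real.log (k i) + σ * Real.log (y i)) ≤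
      Real.exp b * ((k i : ℝ) ^ (-(1 + σ)) * (y i : ℝ) ^ (-σ)) := by
    intro i
    have h1 := Real.add_one_le_exp (b - ((1 + σ) * Real.log (k i) + σ * Real.log (y i)))
    have h2 : Real.exp (b - ((1 + σ) * Real.log (k i) + σ * Real.log (y i))) =
        Real.exp b * ((k i : ℝ) ^ (-(1 + σ)) * (y i : ℝ) ^ (-σ)) := by
      rw [Real.rpow_def_of_pos (by exact_mod_cast hk0 i), Real.rpow_def_of_pos (by exact_mod_cast hy0 i),
        ← Real.exp_add, ← Real.exp_add]
      congr 1
      ring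
    linarith
  have hS1 : ∑ i, w i * (b - (Real.log (u i) - Real.log (y i) + σ * Real.log (u i))) ≤
      4 * A * Real.exp b := by
    calc ∑ i, w i * (b - (Real.log (u i) - Real.log (y i) + σ * Real.log (u i))) ≤
        ∑ i, 2 * (Real.exp b * ((k i : ℝ) ^ (-(1 + σ)) * (y i : ℝ) ^ (-σ))) := by
          apply Finset.sum_le_sum
          intro i _
          have h1 := htan i
          have h2 := hlogu i
          have h3 : 0 ≤ Real.exp b * ((k i : ℝ) ^ (-(1 + σ)) * (y i : ℝ) ^ (-σ)) := by positivity
          have h4 : b - (Real.log (u i) - Real.log (y i) + σ * Real.log (u i)) ≤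
              Real.exp b * ((k i : ℝ) ^ (-(1 + σ)) * (y i : ℝ) ^ (-σ)) := by
            rw [h2]; linarith
          exact (mul_le_mul_of_nonneg_left h4 (hw0 i)).trans (mul_le_mul_of_nonneg_right (hw2 i) h3)
      _ = 2 * Real.exp b * ∑ i, (k i : ℝ) ^ (-(1 + σ)) * (y i : ℝ) ^ (-σ) := by
          rw [Finset.mul_sum]
          exact Finset.sum_congr rfl fun i _ => by ring
      _ ≤ 2 * Real.exp b * (2 * A) := by
          apply mul_le_mul_of_nonneg_left hsumA (by positivity)
      _ = _ := by ring
  obtain ⟨SP, hSP⟩ : ∃ s : ℝ, s = ∑ i, w i * Real.log (p (f i)) := ⟨_, rfl⟩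
  obtain ⟨SY, hSY⟩ : ∃ s : ℝ, s = ∑ i, w i * Real.log (y i) := ⟨_, rfl⟩
  have hS2 : W * b - (1 + σ) * SP - (1 + σ) * Real.log 2 * W + SY ≤ 4 * A * Real.exp b := by
    refine le_trans (le_of_eq ?_) (le_trans (?_ :
      ∑ i, w i * (b - ((1 + σ) * (Real.log 2 + Real.log (p (f i))) - Real.log (y i))) ≤ _) hS1)
    · rw [hWr, hSP, hSY, Finset.sum_mul, Finset.mul_sum, Finset.mul_sum, ← Finset.sum_sub_distrib,
        ← Finset.sum_sub_distrib, ← Finset.sum_add_distrib]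
      exact Finset.sum_congr rfl fun i _ => by ring
    · apply Finset.sum_le_sum
      intro i _
      apply mul_le_mul_of_nonneg_left _ (hw0 i)
      have := mul_le_mul_of_nonneg_left (hlogu2 i) (by linarith : (0 : ℝ) ≤ 1 + σ)
      linarith
  have hI0 : (0 : ℝ) < I := by exact_mod_cast hI
  have hlI0 : 0 ≤ Real.log I := Real.log_nonneg (by exact_mod_cast hI)
  have hlI : Real.log I + SP ≤ R := by
    have h1 : (I : ℝ) * ∏ i, (p (f i) : ℝ) ^ w i ≤ n * 4 ^ Fintype.card ι := by exact_mod_cast hle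
    have h2 : 0 < ∏ i, (p (f i) : ℝ) ^ w i := Finset.prod_pos fun i _ => pow_pos (hp0 i) _
    have h3 := Real.log_le_log (mul_pos hI0 h2) h1
    rw [Real.log_mul hI0.ne' h2.ne', Real.log_mul (by exact_mod_cast (by omega : n ≠ 0)) (by positivity),
      Real.log_pow, Real.log_prod (fun i _ => (pow_pos (hp0 i) _).ne'), ← hR] at h3
    have h4 : ∑ i, Real.log ((p (f i) : ℝ) ^ w i) = SP := by
      rw [hSP]
      exact Finset.sum_congr rfl fun i _ => Real.log_pow _ _
    linarith
  have hSP0 : 0 ≤ SP := by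
    rw [hSP]
    apply Finset.sum_nonneg
    intro i _
    apply mul_nonneg (hw0 i) (Real.log_nonneg _)
    have := h17 i
    exact_mod_cast (by omega : 1 ≤ p (f i))
  rw [← hW]
  -- final
  have hQx : ∀ i, (1 : ℝ) ≤ Qp Q (x i) := fun i => by exact_mod_cast Qp_pos (Q : Set ℕ) (x i)
  have hprod0 : ∀ i, 0 < (Qp Q (x i) : ℝ) ^ (KK * (W : ℝ) * w i) := fun i =>
    Real.rpow_pos_of_pos (by linarith [hQx i]) _
  rw [← Real.log_le_iff_le_exp (mul_pos (pow_pos hI0 _) (Finset.prod_pos fun i _ => hprod0 i)),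
    Real.log_mul (pow_pos hI0 _).ne' (Finset.prod_pos fun i _ => hprod0 i).ne', Real.log_pow,
    Real.log_prod (fun i _ => (hprod0 i).ne')]
  have hKW : 0 ≤ KK * (W : ℝ) := mul_nonneg KK_pos.le (Nat.cast_nonneg _)
  have hf1 : ∑ i, Real.log ((Qp Q (x i) : ℝ) ^ (KK * (W : ℝ) * w i)) ≤ KK * W * SY := by
    rw [hSY, Finset.mul_sum]
    apply Finset.sum_le_sum
    intro i _
    rw [Real.log_rpow (by linarith [hQx i]), ← mul_assoc]
    apply mul_le_mul_of_nonneg_left _ (mul_nonneg hKW (hw0 i))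
    apply Real.log_le_log (by linarith [hQx i])
    rw [hy i]
    exact_mod_cast Qp_le_of_dvd (Q : Set ℕ) (hu0 i).ne' (hxu i)
  have hf2 : ((⌈KK * (W : ℝ)⌉₊ + 2 * d : ℕ) : ℝ) * Real.log I ≤ (KK * W + (1 + 2 * d)) * Real.log I := by
    apply mul_le_mul_of_nonneg_right _ hlI0
    push_cast
    have := (Nat.ceil_lt_add_one hKW).le
    linarith
  have hf3 : (1 + 2 * (d : ℝ)) * Real.log I ≤ (1 + 2 * d) * R :=
    mul_le_mul_of_nonneg_left (by linarith) (by positivity)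
  have hl2 : 0 ≤ Real.log 2 := Real.log_nonneg (by norm_num)
  have hf4 : Real.log I + SY ≤ Y - W * b := by
    have h1 : σ * SP ≤ σ * R := mul_le_mul_of_nonneg_left (by linarith) hσ.le
    have h2 : (1 + σ) * Real.log 2 * W ≤ (1 + σ) * Real.log 2 * (2 * Fintype.card ι) :=
      mul_le_mul_of_nonneg_left hW2 (by positivity)
    rw [hY]
    linarith
  have hf5 : KK * W * (Real.log I + SY) ≤ KK * (Y ^ 2 / (4 * b)) := by
    calc KK * W * (Real.log I + SY) ≤ KK * W * (Y - W * b) := mul_le_mul_of_nonneg_left hf4 hKW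
      _ = KK * (W * (Y - W * b)) := by ring
      _ ≤ _ := mul_le_mul_of_nonneg_left (quad_max hb) KK_pos.le
  linarith

section
variable {ι : Type} [Fintype ι] [DecidableEq ι] (p : ι → ℕ)

theorem omega_bound (hp : ∀ i, (p i).Prime) (hinj : Function.Injective p) (M z : ℝ) (hz : 1 < z)
    (hM : ∑ i, Real.log (p i) ≤ M) : (Fintype.card ι : ℝ) ≤ M / Real.log z + z := by
  classical
  have hlz := Real.log_pos hz
  have hl0 : ∀ i, 0 ≤ Real.log (p i) := fun i =>
    Real.log_nonneg (by exact_mod_cast (hp i).one_lt.le)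
  have h1 : (Finset.univ.filter fun i => (p i : ℝ) ≤ z).card ≤ z := by
    have h2 : (Finset.univ.filter fun i => (p i : ℝ) ≤ z).card ≤ (Finset.Icc 1 ⌊z⌋₊).card := by
      apply Finset.card_le_card_of_injOn p _ hinj.injOn
      intro i hi
      simp only [Finset.coe_filter, Finset.mem_univ, true_and, Set.mem_ofPred_eq] at hi
      simp only [Finset.coe_Icc, Set.mem_Icc]
      exact ⟨(hp i).one_lt.le, Nat.le_floor hi⟩
    rw [Nat.card_Icc, Nat.add_sub_cancel] at h2
    exact le_trans (by exact_mod_cast h2) (Nat.floor_le (by linarith))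
  have h3 : ((Finset.univ.filter fun i => ¬ (p i : ℝ) ≤ z).card : ℝ) ≤ M / Real.log z := by
    rw [le_div_iff₀ hlz]
    calc ((Finset.univ.filter fun i => ¬ (p i : ℝ) ≤ z).card : ℝ) * Real.log z =
        ∑ i ∈ Finset.univ.filter fun i => ¬ (p i : ℝ) ≤ z, Real.log z := by
          rw [Finset.sum_const, nsmul_eq_mul]
      _ ≤ ∑ i ∈ Finset.univ.filter fun i => ¬ (p i : ℝ) ≤ z, Real.log (p i) := by
          apply Finset.sum_le_sum
          intro i hi
          apply Real.log_le_log (by linarith)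
          exact (not_le.1 (Finset.mem_filter.1 hi).2).le
      _ ≤ ∑ i, Real.log (p i) :=
          Finset.sum_le_sum_of_subset_of_nonneg (Finset.filter_subset _ _) fun i _ _ => hl0 i
      _ ≤ M := hM
  have h4 := Finset.card_filter_add_card_filter_not (s := (Finset.univ : Finset ι))
    (fun i => (p i : ℝ) ≤ z)
  rw [Finset.card_univ] at h4
  have h5 : (Fintype.card ι : ℝ) = (Finset.univ.filter fun i => (p i : ℝ) ≤ z).card +
      (Finset.univ.filter fun i => ¬ (p i : ℝ) ≤ z).card := by exact_mod_cast h4.symm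
  linarith

theorem Q_bound (hp : ∀ i, (p i).Prime) (M : ℝ) (d : ℕ) (hM : ∑ i, Real.log (p i) ≤ M)
    (Q : Finset ℕ) (hQp : ∀ q ∈ Q, q.Prime)
    (hQ : ∀ q ∈ Q, d ≤ (Finset.univ.filter fun i => q ∣ p i - 1 ∨ q ∣ p i + 1).card) :
    (Q.card : ℝ) * d ≤ 3 * M := by
  classical
  have h1 : Q.card * d ≤ ∑ i, (Q.filter fun q => q ∣ p i - 1 ∨ q ∣ p i + 1).card := by
    calc Q.card * d = ∑ q ∈ Q, d := by rw [Finset.sum_const, smul_eq_mul]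
      _ ≤ ∑ q ∈ Q, (Finset.univ.filter fun i => q ∣ p i - 1 ∨ q ∣ p i + 1).card :=
          Finset.sum_le_sum hQ
      _ = _ := Finset.sum_card_bipartiteAbove_eq_sum_card_bipartiteBelow _
  have h2 : ∀ i, ((Q.filter fun q => q ∣ p i - 1 ∨ q ∣ p i + 1).card : ℝ) ≤ 3 * Real.log (p i) := by
    intro i
    obtain ⟨N, hN⟩ : ∃ N, N = (p i - 1) * (p i + 1) := ⟨_, rfl⟩
    have hp2 := (hp i).two_le
    have hN0 : 0 < N := by
      rw [hN]; exact Nat.mul_pos (by omega) (by omega)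
    have hNp : N ≤ p i ^ 2 := by
      rw [hN]
      obtain ⟨r, hr⟩ : ∃ r, p i = r + 1 := ⟨p i - 1, by omega⟩
      rw [hr, Nat.add_sub_cancel]
      nlinarith
    have h3 : (Q.filter fun q => q ∣ p i - 1 ∨ q ∣ p i + 1) ⊆ N.primeFactors := by
      intro q hq
      obtain ⟨hq1, hq2⟩ := Finset.mem_filter.1 hq
      refine Nat.mem_primeFactors.2 ⟨hQp q hq1, ?_, hN0.ne'⟩
      rw [hN]
      rcases hq2 with h | h
      · exact h.mul_right _
      · exact h.mul_left _
    have h4 : 2 ^ N.primeFactors.card ≤ N := by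
      calc 2 ^ N.primeFactors.card ≤ ∏ q ∈ N.primeFactors, q :=
            Finset.pow_card_le_prod _ _ _ fun q hq => (Nat.prime_of_mem_primeFactors hq).two_le
        _ ≤ N := Nat.le_of_dvd hN0 (Nat.prod_primeFactors_dvd N)
    have h5 : 2 ^ (Q.filter fun q => q ∣ p i - 1 ∨ q ∣ p i + 1).card ≤ p i ^ 2 :=
      (Nat.pow_le_pow_right (by norm_num) (Finset.card_le_card h3)).trans (h4.trans hNp)
    have h6 : (2 : ℝ) ^ (Q.filter fun q => q ∣ p i - 1 ∨ q ∣ p i + 1).card ≤ (p i : ℝ) ^ 2 := by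
      exact_mod_cast h5
    have h7 := Real.log_le_log (by positivity) h6
    rw [Real.log_pow, Real.log_pow] at h7
    have h8 := Real.log_two_gt_d9
    push_cast at h7
    have h9 : (0 : ℝ) ≤ (Q.filter fun q => q ∣ p i - 1 ∨ q ∣ p i + 1).card := Nat.cast_nonneg _
    nlinarith
  calc (Q.card : ℝ) * d ≤ ∑ i, ((Q.filter fun q => q ∣ p i - 1 ∨ q ∣ p i + 1).card : ℝ) := by
        exact_mod_cast h1
    _ ≤ ∑ i, 3 * Real.log (p i) := Finset.sum_le_sum fun i _ => h2 i
    _ = 3 * ∑ i, Real.log (p i) := by rw [Finset.mul_sum]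
    _ ≤ 3 * M := by linarith

end

theorem TBound.mono {ι : Type} [Fintype ι] {p : ι → ℕ} {Q : Set ℕ} {n d : ℕ} {T T' : ℝ}
    (h : TBound p Q n d T) (hT : T ≤ T') : TBound p Q n d T' :=
  fun κ _ f hf w x I a b c e g => (h κ f hf w x I a b c e g).trans hT

/-- upper bound for number of primes -/
noncomputable def tB (l : ℝ) : ℝ := 10 * Real.exp l / l + Real.exp (l / 2)

noncomputable def RB (l : ℝ) : ℝ := Real.exp l + 2 * tB l

noncomputable def YB (ε C l : ℝ) : ℝ :=
  RB l * (1 + ε) + 4 * C * Real.exp ((1 - ε) * l) + (1 + ε) * (2 * tB l)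

noncomputable def BB (ε C l : ℝ) : ℝ :=
  (4 * cR * (20 + 15 * l / ε + (ε * Real.exp l / l + 1)) + 8) * (5 * Real.exp l) +
  (12 * cR * tB l ^ 2 + (2 * tB l + 1) * tB l) + KK * (YB ε C l ^ 2 / (4 * ((1 - 2 * ε) * l))) +
  (1 + 2 * (ε * Real.exp l / l + 1)) * RB l

theorem per_m {ε C : ℝ} (hε : 0 < ε) (hε4 : ε < 1 / 4) (hC : 1 ≤ C)
    (hR : ∀ Q : Finset ℕ, (∀ q ∈ Q, q.Prime) → ∀ U : Finset ℕ, 0 ∉ U →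
      ∑ u ∈ U, ((u / Qp Q u : ℕ) : ℝ) ^ (-(1 + ε)) * (Qp Q u : ℝ) ^ (-ε) ≤
        C * Real.exp (ε ^ 2 / 15 * Q.card))
    (n : ℕ) (hn : 1 ≤ n) (l : ℝ) (hl : 0 < l) (hL : Real.log n = Real.exp l)
    (m : ℕ) (hm : 1 ≤ m) (hmn : Real.log m ≤ 5 * Real.exp l) :
    ((SubM (pOf m) (eOf m) n).ncard : ℝ) ≤ Real.exp (BB ε C l) := by
  classical
  have hL0 := Real.exp_pos l
  obtain ⟨t, ht⟩ : ∃ t : ℕ, t = Fintype.card m.primeFactors := ⟨_, rfl⟩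
  have hp : ∀ i : m.primeFactors, (pOf m i).Prime := fun i => Nat.prime_of_mem_primeFactors i.2
  have hinj : Function.Injective (pOf m) := Subtype.val_injective
  have hmp := prod_pOf (m := m) (by omega)
  have hm0 : (0 : ℝ) < m := by exact_mod_cast hm
  have hsum : ∑ i, Real.log (pOf m i) ≤ 5 * Real.exp l := by
    refine le_trans ?_ hmn
    have hpos : ∀ i, (0 : ℝ) < pOf m i := fun i => by exact_mod_cast (hp i).pos
    rw [← Real.log_prod (fun i _ => (hpos i).ne')]
    apply Real.log_le_log (Finset.prod_pos fun i _ => hpos i)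
    have : ∏ i, pOf m i ≤ m := by
      conv_rhs => rw [← hmp]
      exact Finset.prod_le_prod' fun i _ => Nat.le_self_pow (NeZero.ne _) _
    exact_mod_cast this
  have htB : (t : ℝ) ≤ tB l := by
    have h1 := omega_bound (pOf m) hp hinj (5 * Real.exp l) (Real.exp (l / 2))
      (Real.one_lt_exp_iff.2 (by linarith)) hsum
    rw [Real.log_exp, ← ht] at h1
    unfold tB
    have h2 : 5 * Real.exp l / (l / 2) = 10 * Real.exp l / l := by
      field_simp
      norm_num
    linarith
  have ht0 : (0 : ℝ) ≤ t := Nat.cast_nonneg _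
  have htB0 : 0 ≤ tB l := ht0.trans htB
  obtain ⟨D, hD⟩ : ∃ D : ℝ, D = ε * Real.exp l / l := ⟨_, rfl⟩
  have hD0 : 0 < D := by rw [hD]; positivity
  obtain ⟨d, hd⟩ : ∃ d : ℕ, d = ⌈D⌉₊ := ⟨_, rfl⟩
  have hd1 : D ≤ d := by rw [hd]; exact Nat.le_ceil _
  have hd2 : (d : ℝ) ≤ D + 1 := by rw [hd]; exact (Nat.ceil_lt_add_one hD0.le).le
  obtain ⟨Q, hQ⟩ : ∃ Q : Finset ℕ, Q = (Finset.range (m + 2)).filter (fun q => q.Prime ∧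
    d < (Finset.univ.filter fun i => q ∣ pOf m i - 1 ∨ q ∣ pOf m i + 1).card) := ⟨_, rfl⟩
  have hQp : ∀ q ∈ Q, q.Prime := fun q hq => by
    rw [hQ] at hq; exact (Finset.mem_filter.1 hq).2.1
  have hQd : ∀ q ∈ Q, d ≤ (Finset.univ.filter fun i => q ∣ pOf m i - 1 ∨ q ∣ pOf m i + 1).card :=
    fun q hq => by rw [hQ] at hq; exact (Finset.mem_filter.1 hq).2.2.le
  have hQn : ∀ q : ℕ, q.Prime → q ∉ (Q : Set ℕ) →
      (Finset.univ.filter fun i => q ∣ pOf m i - 1 ∨ q ∣ pOf m i + 1).card ≤ d := by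
    intro q hq hqQ
    by_contra hlt
    push Not at hlt
    apply hqQ
    rw [Finset.mem_coe, hQ, Finset.mem_filter]
    refine ⟨?_, hq, hlt⟩
    obtain ⟨i, hi⟩ := Finset.card_pos.1 (lt_of_le_of_lt (Nat.zero_le _) hlt)
    have h1 := (Finset.mem_filter.1 hi).2
    have h2 := (hp i).two_le
    have h3 : pOf m i ≤ m := Nat.le_of_mem_primeFactors i.2
    rw [Finset.mem_range]
    rcases h1 with h | h
    · have := Nat.le_of_dvd (by omega) h
      omega
    · have := Nat.le_of_dvd (by omega) h
      omega
  have hQc : (Q.card : ℝ) ≤ 15 * l / ε := by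
    have h1 := Q_bound (pOf m) hp _ d hsum Q hQp hQd
    have h2 : (Q.card : ℝ) * D ≤ 15 * Real.exp l := by
      have := mul_le_mul_of_nonneg_left hd1 (Nat.cast_nonneg (α := ℝ) Q.card)
      linarith
    rw [hD] at h2
    rw [le_div_iff₀ hε]
    have h3 : (Q.card : ℝ) * (ε * Real.exp l / l) = (Q.card * ε / l) * Real.exp l := by ring
    rw [h3] at h2
    have h4 : (Q.card : ℝ) * ε / l ≤ 15 := le_of_mul_le_mul_right h2 hL0
    rwa [div_le_iff₀ hl] at h4
  obtain ⟨S, hS⟩ : ∃ S : Finset m.primeFactors,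
    S = Finset.univ.filter (fun i => pOf m i < 17 ∨ pOf m i ∈ Q) := ⟨_, rfl⟩
  have hSc : S.card ≤ 17 + Q.card := by
    calc S.card ≤ (Finset.range 17 ∪ Q).card := by
          apply Finset.card_le_card_of_injOn (pOf m) _ hinj.injOn
          intro i hi
          rw [hS] at hi
          simpa using hi
      _ ≤ _ := (Finset.card_union_le _ _).trans (by simp)
  have hSn : ∀ i, i ∉ S → 17 ≤ pOf m i ∧ pOf m i ∉ (Q : Set ℕ) := by
    intro i hi
    rw [hS, Finset.mem_filter] at hi
    push Not at hi
    simpa using hi (Finset.mem_univ i)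
  have hA := hR Q hQp
  have hAe : C * Real.exp (ε ^ 2 / 15 * Q.card) ≤ C * Real.exp (ε * l) := by
    apply mul_le_mul_of_nonneg_left _ (by linarith)
    apply Real.exp_le_exp.2
    calc ε ^ 2 / 15 * Q.card ≤ ε ^ 2 / 15 * (15 * l / ε) :=
          mul_le_mul_of_nonneg_left hQc (by positivity)
      _ = ε * l := by field_simp
  have hb : 0 < (1 - 2 * ε) * l := mul_pos (by linarith) hl
  have hT := tbound (pOf m) hinj Q n d hn (C * Real.exp (ε * l)) ε ((1 - 2 * ε) * l) hε hb
    (by positivity) (fun U hU => (hA U hU).trans hAe) _ _ rfl rfl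
  rw [← ht, hL] at hT
  have hlog4 : Real.log 4 ≤ 2 := by
    have : (4 : ℝ) = 2 ^ 2 := by norm_num
    rw [this, Real.log_pow]
    have := Real.log_two_lt_d9
    push_cast
    linarith
  have hlog4' : 0 ≤ Real.log 4 := Real.log_nonneg (by norm_num)
  have hlog2 : Real.log 2 ≤ 1 := by linarith [Real.log_two_lt_d9]
  have hlog2' : 0 ≤ Real.log 2 := Real.log_nonneg (by norm_num)
  have hlog240 : Real.log 240 ≤ 6 := by
    have h1 : Real.log 240 ≤ Real.log (2 ^ 8) := Real.log_le_log (by norm_num) (by norm_num)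
    rw [Real.log_pow] at h1
    have := Real.log_two_lt_d9
    push_cast at h1
    linarith
  have hRle : Real.exp l + t * Real.log 4 ≤ RB l := by
    unfold RB
    have := mul_le_mul htB hlog4 hlog4' htB0
    linarith
  have hR0 : 0 ≤ Real.exp l + t * Real.log 4 := by positivity
  have hYle : (Real.exp l + t * Real.log 4) * (1 + ε) +
      4 * (C * Real.exp (ε * l)) * Real.exp ((1 - 2 * ε) * l) +
      (1 + ε) * (2 * t * Real.log 2) ≤ YB ε C l := by
    unfold YB
    have h1 := mul_le_mul_of_nonneg_right hRle (by linarith : (0 : ℝ) ≤ 1 + ε)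
    have h2 : Real.exp (ε * l) * Real.exp ((1 - 2 * ε) * l) = Real.exp ((1 - ε) * l) := by
      rw [← Real.exp_add]; congr 1; ring
    have h3 : 4 * (C * Real.exp (ε * l)) * Real.exp ((1 - 2 * ε) * l) =
        4 * C * Real.exp ((1 - ε) * l) := by rw [← h2]; ring
    have h4 := mul_le_mul htB hlog2 hlog2' htB0
    have h5 := mul_le_mul_of_nonneg_left h4 (by linarith : (0 : ℝ) ≤ 2 * (1 + ε))
    rw [h3]
    linarith
  have hY0 : 0 ≤ (Real.exp l + t * Real.log 4) * (1 + ε) +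
      4 * (C * Real.exp (ε * l)) * Real.exp ((1 - 2 * ε) * l) +
      (1 + ε) * (2 * t * Real.log 2) := by positivity
  obtain ⟨E1, hE1⟩ : ∃ E1 : ℝ, E1 = KK * (YB ε C l ^ 2 / (4 * ((1 - 2 * ε) * l))) +
    (1 + 2 * (D + 1)) * RB l := ⟨_, rfl⟩
  have hT' : TBound (pOf m) Q n d (Real.exp E1) := by
    refine hT.mono (Real.exp_le_exp.2 ?_)
    rw [hE1]
    apply add_le_add
    · apply mul_le_mul_of_nonneg_left _ KK_pos.le
      apply div_le_div_of_nonneg_right _ (by positivity)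
      exact pow_le_pow_left₀ hY0 hYle 2
    · exact mul_le_mul (by linarith) hRle hR0 (by linarith)
  have hmain := finite_main (pOf m) (eOf m) hp hinj n d Q hQn S hSn (Real.exp E1)
    (Real.exp_pos _).le hT' m hmp
  rw [← ht] at hmain
  refine hmain.trans ?_
  have e1 : (m : ℝ) ^ (4 * cR * (S.card + d + 3) + 8) ≤
      Real.exp ((4 * cR * (20 + 15 * l / ε + (D + 1)) + 8) * (5 * Real.exp l)) := by
    rw [← Real.log_le_iff_le_exp (by positivity), Real.log_pow]
    have hlm : 0 ≤ Real.log m := Real.log_nonneg (by exact_mod_cast hm)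
    apply mul_le_mul _ hmn hlm (by positivity)
    push_cast
    have h1 : (S.card : ℝ) ≤ 17 + Q.card := by exact_mod_cast hSc
    have h2 : (S.card : ℝ) + d + 3 ≤ 20 + 15 * l / ε + (D + 1) := by linarith
    have h3 := mul_le_mul_of_nonneg_left h2 (by positivity : (0 : ℝ) ≤ 4 * cR)
    linarith
  have e2 : ((240 : ℝ) ^ t) ^ (2 * cR * t) * 2 ^ ((2 * t + 1) * t) ≤
      Real.exp (12 * cR * tB l ^ 2 + (2 * tB l + 1) * tB l) := by
    rw [← Real.log_le_iff_le_exp (by positivity), Real.log_mul (by positivity) (by positivity),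
      Real.log_pow, Real.log_pow, Real.log_pow]
    push_cast
    have h1 : (t : ℝ) ^ 2 ≤ tB l ^ 2 := pow_le_pow_left₀ ht0 htB 2
    apply add_le_add
    · calc 2 * (cR : ℝ) * t * (t * Real.log 240) = 2 * cR * (t ^ 2 * Real.log 240) := by ring
        _ ≤ 2 * cR * (tB l ^ 2 * 6) := by
          apply mul_le_mul_of_nonneg_left _ (by positivity)
          exact mul_le_mul h1 hlog240 (Real.log_nonneg (by norm_num)) (by positivity)
        _ = _ := by ring
    · have h2 : (2 * (t : ℝ) + 1) * t ≤ (2 * tB l + 1) * tB l :=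
        mul_le_mul (by linarith) htB ht0 (by linarith)
      have h3 : 0 ≤ (2 * (t : ℝ) + 1) * t := by positivity
      calc (2 * (t : ℝ) + 1) * t * Real.log 2 ≤ (2 * (t : ℝ) + 1) * t * 1 :=
            mul_le_mul_of_nonneg_left hlog2 h3
        _ ≤ _ := by linarith
  refine (mul_le_mul_of_nonneg_right (mul_le_mul e1 e2 (by positivity) (by positivity))
    (Real.exp_pos _).le).trans (le_of_eq ?_)
  rw [← Real.exp_add, ← Real.exp_add, hE1, hD]
  congr 1
  unfold BB
  ring

open Filter

theorem tau_eq {l : ℝ} : tB l = Real.exp l * (10 * l⁻¹ + Real.exp (-(l / 2))) := by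
  unfold tB
  have : Real.exp (l / 2) = Real.exp l * Real.exp (-(l / 2)) := by
    rw [← Real.exp_add]; congr 1; ring
  rw [this]
  ring

theorem BB_eq {ε C l : ℝ} (hε : 0 < ε) (hε4 : ε < 1 / 4) (hl : 0 < l) {τ : ℝ}
    (hτ : τ = 10 * l⁻¹ + Real.exp (-(l / 2))) :
    (BB ε C l + 5 * Real.exp l) / (Real.exp l ^ 2 / l) =
      20 * cR * (21 * (l * Real.exp (-l)) + 15 / ε * (l ^ 2 * Real.exp (-l)) + ε) +
      45 * (l * Real.exp (-l)) +
      ((12 * cR + 2) * (100 * l⁻¹ + 20 * Real.exp (-(l / 2)) + l * Real.exp (-l)) +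
        τ * (l * Real.exp (-l))) +
      KK * (((1 + 2 * τ) * (1 + ε) + 4 * C * Real.exp (-(ε * l)) + (1 + ε) * (2 * τ)) ^ 2 /
        (4 * (1 - 2 * ε))) +
      (3 * (l * Real.exp (-l)) + 2 * ε) * (1 + 2 * τ) := by
  have hE := Real.exp_pos l
  have h1 : (1 - 2 * ε) ≠ 0 := by linarith
  have h2 : Real.exp (-l) = (Real.exp l)⁻¹ := Real.exp_neg l
  have h4 : Real.exp (-(l / 2)) ^ 2 = (Real.exp l)⁻¹ := by
    rw [← h2, ← Real.exp_nat_mul]; congr 1; push_cast; ring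
  have h3 : Real.exp ((1 - ε) * l) = Real.exp l * Real.exp (-(ε * l)) := by
    rw [← Real.exp_add]; congr 1; ring
  have h5 : 100 * l⁻¹ + 20 * Real.exp (-(l / 2)) + l * Real.exp (-l) = τ ^ 2 * l := by
    rw [hτ, h2, ← h4]
    field_simp
    ring
  rw [h5]
  unfold BB YB RB
  rw [tau_eq, ← hτ, h3, h2]
  obtain ⟨E, hEE⟩ : ∃ E, E = Real.exp l := ⟨_, rfl⟩
  obtain ⟨K, hK⟩ : ∃ K, K = Real.exp (-(ε * l)) := ⟨_, rfl⟩
  rw [← hEE, ← hK]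
  rw [← hEE] at hE
  field_simp
  ring

noncomputable def gl (ε : ℝ) : ℝ := 20 * cR * ε + KK * ((1 + ε) ^ 2 / (4 * (1 - 2 * ε))) + 2 * ε

theorem BB_tendsto {ε C : ℝ} (hε : 0 < ε) (hε4 : ε < 1 / 4) :
    Tendsto (fun l : ℝ => (BB ε C l + 5 * Real.exp l) / (Real.exp l ^ 2 / l)) atTop
      (nhds (gl ε)) := by
  have h1 : Tendsto (fun l : ℝ => l * Real.exp (-l)) atTop (nhds 0) := by
    simpa using Real.tendsto_pow_mul_exp_neg_atTop_nhds_zero 1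
  have h2 : Tendsto (fun l : ℝ => l ^ 2 * Real.exp (-l)) atTop (nhds 0) :=
    Real.tendsto_pow_mul_exp_neg_atTop_nhds_zero 2
  have h3 : Tendsto (fun l : ℝ => l⁻¹) atTop (nhds 0) := tendsto_inv_atTop_zero
  have h4 : Tendsto (fun l : ℝ => Real.exp (-(l / 2))) atTop (nhds 0) :=
    Real.tendsto_exp_neg_atTop_nhds_zero.comp (tendsto_id.atTop_div_const (by norm_num))
  have h5 : Tendsto (fun l : ℝ => Real.exp (-(ε * l))) atTop (nhds 0) :=
    Real.tendsto_exp_neg_atTop_nhds_zero.comp (tendsto_id.const_mul_atTop hε)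
  have h6 : Tendsto (fun l : ℝ => 10 * l⁻¹ + Real.exp (-(l / 2))) atTop (nhds 0) := by
    simpa using (h3.const_mul 10).add h4
  have key := ((((((h1.const_mul 21).add (h2.const_mul (15 / ε))).add_const ε).const_mul
    (20 * (cR : ℝ))).add (h1.const_mul 45)).add
    (((((h3.const_mul 100).add (h4.const_mul 20)).add h1).const_mul (12 * (cR : ℝ) + 2)).add
      (h6.mul h1))).add
    (((((((h6.const_mul 2).const_add 1).mul_const (1 + ε)).add (h5.const_mul (4 * C))).add
      ((h6.const_mul 2).const_mul (1 + ε))).pow 2).div_const (4 * (1 - 2 * ε)) |>.const_mul KK)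
  have key2 := key.add (((h1.const_mul 3).add_const (2 * ε)).mul ((h6.const_mul 2).const_add 1))
  refine (key2.congr' ?_).trans (le_of_eq ?_)
  · filter_upwards [eventually_gt_atTop 0] with l hl
    exact (BB_eq hε hε4 hl rfl).symm
  · congr 1
    unfold gl
    ring

theorem gl_lt {η : ℝ} (hη : 0 < η) : ∃ ε : ℝ, 0 < ε ∧ ε < 1 / 4 ∧ gl ε < KK / 4 + η := by
  have h1 : ContinuousAt gl 0 := by
    unfold gl
    have : (4 * (1 - 2 * (0 : ℝ))) ≠ 0 := by norm_num
    fun_prop (disch := assumption)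
  have h0 : gl 0 = KK / 4 := by unfold gl; ring
  have h2 : ∀ᶠ ε in nhds (0 : ℝ), gl ε < KK / 4 + η :=
    h1.eventually_lt_const (by rw [h0]; linarith)
  obtain ⟨r, hr, hr2⟩ := Metric.eventually_nhds_iff.1 h2
  refine ⟨min (r / 2) (1 / 8), by positivity, ?_, ?_⟩
  · exact lt_of_le_of_lt (min_le_right _ _) (by norm_num)
  · apply hr2
    rw [Real.dist_eq, sub_zero, abs_of_pos (by positivity)]
    exact lt_of_le_of_lt (min_le_left _ _) (by linarith)

open Filter

theorem final_eventually {η : ℝ} (hη : 0 < η) :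
    ∀ᶠ n : ℕ in atTop, 0 < Real.log (Real.log n) ∧ ∀ c : ℕ,
      c ≤ ∑ m ∈ Finset.Icc 1 (17 ^ 34 * n ^ 4), (SubM (pOf m) (eOf m) n).ncard →
      Real.log c / ((Real.log n) ^ 2 / Real.log (Real.log n)) ≤ KK / 4 + η := by
  obtain ⟨ε, hε, hε4, hg⟩ := gl_lt hη
  obtain ⟨C, hC, hR⟩ := rankin_bound (σ := ε) (δ := ε ^ 2 / 15) hε (by positivity)
  have hlog : Tendsto (fun n : ℕ => Real.log (Real.log n)) atTop atTop :=
    Real.tendsto_log_atTop.comp (Real.tendsto_log_atTop.comp tendsto_natCast_atTop_atTop)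
  have h1 := hlog.eventually ((BB_tendsto (C := C) hε hε4).eventually_le_const hg)
  have h2 := hlog.eventually (eventually_gt_atTop 0)
  have h3 : ∀ᶠ n : ℕ in atTop, 1 < Real.log n :=
    (Real.tendsto_log_atTop.comp tendsto_natCast_atTop_atTop).eventually (eventually_gt_atTop 1)
  filter_upwards [h1, h2, h3, eventually_ge_atTop (17 ^ 34)] with n h1 hl hL hn
  refine ⟨hl, ?_⟩
  intro c hc
  obtain ⟨l, hldef⟩ : ∃ l, l = Real.log (Real.log n) := ⟨_, rfl⟩
  rw [← hldef] at h1 hl ⊢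
  have hLe : Real.log n = Real.exp l := by rw [hldef, Real.exp_log (by linarith)]
  have hn1 : 1 ≤ n := le_trans (Nat.one_le_pow _ _ (by norm_num)) hn
  have hn0 : (0 : ℝ) < n := by exact_mod_cast hn1
  rw [hLe]
  have hden : 0 < Real.exp l ^ 2 / l := by positivity
  rcases Nat.eq_zero_or_pos c with h0 | hpos
  · rw [h0, Nat.cast_zero, Real.log_zero, zero_div]
    have := KK_pos
    linarith
  refine le_trans ?_ h1
  apply div_le_div_of_nonneg_right _ hden.le
  rw [Real.log_le_iff_le_exp (by exact_mod_cast hpos), Real.exp_add]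
  have hN : 17 ^ 34 * n ^ 4 ≤ n ^ 5 := by
    calc 17 ^ 34 * n ^ 4 ≤ n * n ^ 4 := Nat.mul_le_mul_right _ hn
      _ = n ^ 5 := by ring
  have hn5 : (n : ℝ) ^ 5 = Real.exp (5 * Real.exp l) := by
    rw [← hLe, ← Real.exp_log (pow_pos hn0 5), Real.log_pow]
    norm_num
  calc (c : ℝ) ≤ ∑ m ∈ Finset.Icc 1 (17 ^ 34 * n ^ 4), ((SubM (pOf m) (eOf m) n).ncard : ℝ) := by
        exact_mod_cast hc
    _ ≤ ∑ m ∈ Finset.Icc 1 (17 ^ 34 * n ^ 4), Real.exp (BB ε C l) := by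
        apply Finset.sum_le_sum
        intro m hm
        obtain ⟨hm1, hm2⟩ := Finset.mem_Icc.1 hm
        refine per_m hε hε4 hC hR n hn1 l hl hLe m hm1 ?_
        rw [Real.log_le_iff_le_exp (by exact_mod_cast hm1), ← hn5]
        exact_mod_cast hm2.trans hN
    _ = ((17 ^ 34 * n ^ 4 : ℕ) : ℝ) * Real.exp (BB ε C l) := by
        rw [Finset.sum_const, Nat.card_Icc, Nat.add_sub_cancel, nsmul_eq_mul]
    _ ≤ (n : ℝ) ^ 5 * Real.exp (BB ε C l) := by
        apply mul_le_mul_of_nonneg_right _ (Real.exp_pos _).le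
        exact_mod_cast hN
    _ = _ := by rw [hn5, mul_comm]

theorem congruence_growth_SL2_upper :
    limsup
        (fun n : ℕ => Real.log (congCount 2 n) / ((Real.log n) ^ 2 / Real.log (Real.log n)))
        atTop ≤ (3 - 2 * Real.sqrt 2) / 4 := by
  rw [show (3 - 2 * Real.sqrt 2) / 4 = KK / 4 by rfl]
  apply le_of_forall_pos_le_add
  intro η hη
  have h := final_eventually hη
  apply limsup_le_of_le
  · apply isCoboundedUnder_le_of_eventually_le atTop (x := 0)
    filter_upwards [h] with n hn
    apply div_nonneg (Real.log_natCast_nonneg _)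
    exact div_nonneg (sq_nonneg _) hn.1.le
  · filter_upwards [h] with n hn
    exact hn.2 _ (cong_count_le n)
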